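/- Let ω be a radial weight in the class D̂, let 0<q≤1, and set μ_q = ω·ω̂^{1/q}. Then (A^{1,q}_ω)* ≃ BMOA(∞,ω) under the A²_{μ_q}-pairing with equivalence of norms: there exist constants C₁,C₂>0 (depending only on q,ω) such that (a) for every g∈BMOA(∞,ω) and every f∈A^{1,q}_ω the limit defining ⟨f,g⟩_{A²_{μ_q}} exists and L_g(f)=⟨f,g⟩_{A²_{μ_q}} defines a bounded linear functional on A^{1,q}_ω with ‖L_g‖ ≤ C₂‖g‖_{BMOA(∞,ω)}, and (b) every bounded linear functional L on A^{1,q}_ω equals L_g for some g∈BMOA(∞,ω) with ‖g‖_{BMOA(∞,ω)} ≤ C₁‖L‖. -/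

import Mathlib

open MeasureTheory Filter Set
open scoped ENNReal

noncomputable section

/-- `ω̂(r) = ∫_r^1 ω(s) ds`. -/
def omegaHat (ω : ℝ → ℝ) (r : ℝ) : ℝ := ∫ s in r..1, ω s

/-- A radial weight: nonnegative and Lebesgue integrable on `[0,1)`. -/
def IsRadialWeight (ω : ℝ → ℝ) : Prop :=
  (∀ r ∈ Set.Ico (0:ℝ) 1, 0 ≤ ω r) ∧ MeasureTheory.IntegrableOn ω (Set.Ico 0 1)

/-- The class `D̂` of upper doubling radial weights. -/
def InDhat (ω : ℝ → ℝ) : Prop :=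
  ∃ C > (0:ℝ), ∀ r ∈ Set.Ico (0:ℝ) 1, omegaHat ω r ≤ C * omegaHat ω ((1 + r) / 2)

/-- The class `Ď`. -/
def InDcheck (ω : ℝ → ℝ) : Prop :=
  ∃ K > (1:ℝ), ∃ C > (1:ℝ), ∀ r ∈ Set.Ico (0:ℝ) 1,
    C * omegaHat ω (1 - (1 - r) / K) ≤ omegaHat ω r

/-- Moments `μ_x = ∫_0^1 r^x μ(r) dr`. -/
def momentW (μ : ℝ → ℝ) (x : ℝ) : ℝ := ∫ r in (0:ℝ)..1, r ^ x * μ r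

/-- The coefficients `μ_{2k+1}` of the `A²_μ` pairing. -/
def momentCoeff (μ : ℝ → ℝ) : ℕ → ℝ := fun k => momentW μ (2 * (k:ℝ) + 1)

/-- The point `r e^{iθ}` of the circle of radius `r`. -/
def circlePt (r θ : ℝ) : ℂ := (r:ℂ) * Complex.exp ((θ:ℂ) * Complex.I)

/-- Integral means `M_p(r,f)` (with values in `[0,∞]`). -/
def MpE (p r : ℝ) (f : ℂ → ℂ) : ℝ≥0∞ :=
  (ENNReal.ofReal (1 / (2 * Real.pi)) *
    ∫⁻ θ in Set.Ioo (0:ℝ) (2 * Real.pi), ENNReal.ofReal (‖f (circlePt r θ)‖ ^ p)) ^ (1 / p)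

/-- Integral means of a `[0,∞]`-valued function. -/
def MpEE (p r : ℝ) (F : ℂ → ℝ≥0∞) : ℝ≥0∞ :=
  (ENNReal.ofReal (1 / (2 * Real.pi)) *
    ∫⁻ θ in Set.Ioo (0:ℝ) (2 * Real.pi), (F (circlePt r θ)) ^ p) ^ (1 / p)

/-- The norm of the mixed norm space `L^{p,q}_ω`. -/
def LpqNormE (ω : ℝ → ℝ) (p q : ℝ) (f : ℂ → ℂ) : ℝ≥0∞ :=
  (∫⁻ r in Set.Ioo (0:ℝ) 1, (MpE p r f) ^ q * ENNReal.ofReal (r * ω r)) ^ (1 / q)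

/-- The `L^{p,q}_ω` norm of a `[0,∞]`-valued function. -/
def LpqNormEE (ω : ℝ → ℝ) (p q : ℝ) (F : ℂ → ℝ≥0∞) : ℝ≥0∞ :=
  (∫⁻ r in Set.Ioo (0:ℝ) 1, (MpEE p r F) ^ q * ENNReal.ofReal (r * ω r)) ^ (1 / q)

/-- The norm of `A^{p,∞}_ω` : `sup_{0 ≤ r < 1} M_p(r,f) ω̂(r)`. -/
def ApInfNormE (ω : ℝ → ℝ) (p : ℝ) (f : ℂ → ℂ) : ℝ≥0∞ :=
  ⨆ r ∈ Set.Ico (0:ℝ) 1, MpE p r f * ENNReal.ofReal (omegaHat ω r)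

/-- Membership in the mixed norm space `A^{p,q}_ω`. -/
def InApq (ω : ℝ → ℝ) (p q : ℝ) (f : ℂ → ℂ) : Prop :=
  DifferentiableOn ℂ f (Metric.ball 0 1) ∧ LpqNormE ω p q f < ⊤

/-- Membership in `A^{p,∞}_ω`. -/
def InApInf (ω : ℝ → ℝ) (p : ℝ) (f : ℂ → ℂ) : Prop :=
  DifferentiableOn ℂ f (Metric.ball 0 1) ∧ ApInfNormE ω p f < ⊤

/-- Taylor coefficient of `f` at `0`. -/
def taylorCoeff (f : ℂ → ℂ) (n : ℕ) : ℂ := iteratedDeriv n f 0 / (n.factorial : ℂ)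

/-- The pairing `⟨f,g⟩ = lim_{r→1⁻} ∑_k f̂(k) conj(ĝ(k)) c(k) r^k` exists and equals `l`. -/
def HasPairingC (c : ℕ → ℝ) (f g : ℂ → ℂ) (l : ℂ) : Prop :=
  (∀ r ∈ Set.Ico (0:ℝ) 1, Summable (fun k : ℕ =>
    taylorCoeff f k * (starRingEnd ℂ) (taylorCoeff g k) * ((c k : ℝ) : ℂ) * ((r:ℂ)) ^ k)) ∧
  Filter.Tendsto (fun r : ℝ => ∑' k : ℕ,
    taylorCoeff f k * (starRingEnd ℂ) (taylorCoeff g k) * ((c k : ℝ) : ℂ) * ((r:ℂ)) ^ k)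
    (nhdsWithin 1 (Set.Iio 1)) (nhds l)

/-- `L` is linear on the functions satisfying `P`. -/
def IsLinearOn (P : (ℂ → ℂ) → Prop) (L : (ℂ → ℂ) → ℂ) : Prop :=
  (∀ f g : ℂ → ℂ, P f → P g → L (f + g) = L f + L g) ∧
  (∀ (c : ℂ) (f : ℂ → ℂ), P f → L (c • f) = c * L f)

/-- Dilation `f_r(z) = f(rz)`. -/
def dilateF (f : ℂ → ℂ) (r : ℝ) : ℂ → ℂ := fun z => f ((r:ℂ) * z)

/-- The BMOA norm `|f(0)| + sup_{a∈D} sup_{0<r<1} M₂(r, f∘φ_a - f(a))`. -/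
def BMOANormE (f : ℂ → ℂ) : ℝ≥0∞ :=
  ENNReal.ofReal ‖f 0‖ +
    ⨆ a ∈ Metric.ball (0:ℂ) 1, ⨆ r ∈ Set.Ioo (0:ℝ) 1,
      MpE 2 r (fun z => f ((a - z) / (1 - (starRingEnd ℂ) a * z)) - f a)

/-- The Bloch norm `|f(0)| + sup_{z∈D} (1-|z|²)|f'(z)|`. -/
def BlochNormE (f : ℂ → ℂ) : ℝ≥0∞ :=
  ENNReal.ofReal ‖f 0‖ +
    ⨆ z ∈ Metric.ball (0:ℂ) 1, ENNReal.ofReal ((1 - ‖z‖ ^ 2) * ‖deriv f z‖)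

/-- The norm of `X(q,ω)`: `(∫_0^1 ‖f_r‖_X^q ω(r) dr)^{1/q}`. -/
def XqNormE (Xnorm : (ℂ → ℂ) → ℝ≥0∞) (ω : ℝ → ℝ) (q : ℝ) (f : ℂ → ℂ) : ℝ≥0∞ :=
  (∫⁻ r in Set.Ioo (0:ℝ) 1, (Xnorm (dilateF f r)) ^ q * ENNReal.ofReal (ω r)) ^ (1 / q)

/-- The norm of `X(∞,ω)`: `sup_{0<r<1} ‖f_r‖_X ω̂(r)`. -/
def XInfNormE (Xnorm : (ℂ → ℂ) → ℝ≥0∞) (ω : ℝ → ℝ) (f : ℂ → ℂ) : ℝ≥0∞ :=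
  ⨆ r ∈ Set.Ioo (0:ℝ) 1, Xnorm (dilateF f r) * ENNReal.ofReal (omegaHat ω r)

/-- The standard radial weight `ν_β(r) = (β+1)(1-r²)^β`. -/
def nuWeight (β : ℝ) : ℝ → ℝ := fun r => (β + 1) * (1 - r ^ 2) ^ β

/-- The Bergman reproducing kernel `B^ω_a(z) = ∑ (z conj a)^n / (2 ω_{2n+1})`. -/
def bergmanKernel (ω : ℝ → ℝ) (a z : ℂ) : ℂ :=
  ∑' n : ℕ, (z * (starRingEnd ℂ) a) ^ n / (2 * ((momentW ω (2 * (n:ℝ) + 1) : ℝ) : ℂ))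

/-- The Bergman projection (`dA` is normalized area measure). -/
def PomegaProj (ω : ℝ → ℝ) (f : ℂ → ℂ) (z : ℂ) : ℂ :=
  (Real.pi)⁻¹ • ∫ ζ in Metric.ball (0:ℂ) 1,
    f ζ * (starRingEnd ℂ) (bergmanKernel ω z ζ) * ((ω ‖ζ‖ : ℝ) : ℂ)

/-- The maximal Bergman projection applied to `|f|`, with values in `[0,∞]`. -/
def PomegaPlusL (ω : ℝ → ℝ) (f : ℂ → ℂ) (z : ℂ) : ℝ≥0∞ :=
  ∫⁻ ζ in Metric.ball (0:ℂ) 1,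
    ENNReal.ofReal (‖f ζ‖ * ‖bergmanKernel ω z ζ‖ * ω ‖ζ‖ / Real.pi)

/-- The Hardy `H¹` norm. -/
def H1NormE (f : ℂ → ℂ) : ℝ≥0∞ := ⨆ r ∈ Set.Ioo (0:ℝ) 1, MpE 1 r f

/-- `r_n = inf{ r ∈ [0,1) : ω̂(r) = ω̂(0) K^{-n} }`. -/
def rSeq (ω : ℝ → ℝ) (K : ℝ) (n : ℕ) : ℝ :=
  sInf {r | r ∈ Set.Ico (0:ℝ) 1 ∧ omegaHat ω r = omegaHat ω 0 * K ^ (-(n:ℝ))}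

/-- `M_n = ⌊1/(1-r_n)⌋`. -/
def MSeq (ω : ℝ → ℝ) (K : ℝ) (n : ℕ) : ℕ := ⌊1 / (1 - rSeq ω K n)⌋₊

/-- Weighted Hadamard product of a polynomial with an analytic function:
`z ↦ ∑_j c(j) P̂(j) ĝ(j) z^j`. -/
def hadamardPolyC (c : ℕ → ℂ) (P : Polynomial ℂ) (g : ℂ → ℂ) : ℂ → ℂ :=
  fun z => ∑ j ∈ Finset.range (P.natDegree + 1), c j * P.coeff j * taylorCoeff g j * z ^ j

/-- An admissible Banach space of analytic functions on the unit disc, given by a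
carrier set and a norm function. -/
structure AdmissibleSpace where
  carrier : Set (ℂ → ℂ)
  nrm : (ℂ → ℂ) → ℝ
  mem_analytic : ∀ f ∈ carrier, DifferentiableOn ℂ f (Metric.ball 0 1)
  zero_mem : (0 : ℂ → ℂ) ∈ carrier
  add_mem : ∀ f g : ℂ → ℂ, f ∈ carrier → g ∈ carrier → f + g ∈ carrier
  smul_mem : ∀ (c : ℂ) (f : ℂ → ℂ), f ∈ carrier → c • f ∈ carrier
  nrm_nonneg : ∀ f ∈ carrier, 0 ≤ nrm f
  nrm_eq_zero : ∀ f ∈ carrier, nrm f = 0 → ∀ z ∈ Metric.ball (0:ℂ) 1, f z = 0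
  nrm_add : ∀ f g : ℂ → ℂ, f ∈ carrier → g ∈ carrier → nrm (f + g) ≤ nrm f + nrm g
  nrm_smul : ∀ (c : ℂ) (f : ℂ → ℂ), f ∈ carrier → nrm (c • f) = ‖c‖ * nrm f
  complete : ∀ u : ℕ → (ℂ → ℂ), (∀ n, u n ∈ carrier) →
    (∀ ε : ℝ, 0 < ε → ∃ N : ℕ, ∀ m ≥ N, ∀ n ≥ N, nrm (u m - u n) < ε) →
    ∃ f ∈ carrier, Filter.Tendsto (fun n => nrm (u n - f)) Filter.atTop (nhds 0)
  norm_conv_implies_ucc : ∀ (u : ℕ → (ℂ → ℂ)) (f : ℂ → ℂ),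
    (∀ n, u n ∈ carrier) → f ∈ carrier →
    Filter.Tendsto (fun n => nrm (u n - f)) Filter.atTop (nhds 0) →
    ∀ Kc : Set ℂ, Kc ⊆ Metric.ball 0 1 → IsCompact Kc →
      TendstoUniformlyOn (fun n => u n) f Filter.atTop Kc
  ucc_implies_norm_conv : ∀ R : ℝ, 1 < R → ∀ (u : ℕ → (ℂ → ℂ)) (f : ℂ → ℂ),
    (∀ n, u n ∈ carrier ∧ DifferentiableOn ℂ (u n) (Metric.ball 0 R)) →
    DifferentiableOn ℂ f (Metric.ball 0 R) →
    (∀ Kc : Set ℂ, Kc ⊆ Metric.ball (0:ℂ) R → IsCompact Kc →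
      TendstoUniformlyOn (fun n => u n) f Filter.atTop Kc) →
    f ∈ carrier ∧ Filter.Tendsto (fun n => nrm (u n - f)) Filter.atTop (nhds 0)
  dilation_bound : ∃ C > (0:ℝ), ∀ f ∈ carrier, ∀ ζ : ℂ, ‖ζ‖ ≤ 1 →
    (fun z => f (ζ * z)) ∈ carrier ∧ nrm (fun z => f (ζ * z)) ≤ C * nrm f

/-- The operator `T_p = I^{ν_{1/p-2}}`. -/
def TpOp (p : ℝ) (g : ℂ → ℂ) : ℂ → ℂ :=
  fun z => ∑' k : ℕ,
    taylorCoeff g k * ((momentW (nuWeight (1 / p - 2)) (2 * (k:ℝ) + 1) : ℝ) : ℂ) * z ^ k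

/-- Membership in the Bloch space. -/
def InBloch (g : ℂ → ℂ) : Prop :=
  DifferentiableOn ℂ g (Metric.ball 0 1) ∧ BlochNormE g < ⊤

open Classical in
/-- The norm of the space `X_p = T_p(B)`, normed so that `T_p` is an isometry. -/
def XpNormE (p : ℝ) (h : ℂ → ℂ) : ℝ≥0∞ :=
  if H : ∃ g : ℂ → ℂ, InBloch g ∧ Set.EqOn h (TpOp p g) (Metric.ball 0 1)
  then BlochNormE H.choose else ⊤

/-- The polynomial `V_n ∗ g` where `V_n(z) = ∑_{j=2^{n-1}}^{2^{n+1}-1} ψ(j/2^{n-1}) z^j`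
and `ψ(t) = Ψ(t/2) - Ψ(t)`. -/
def VnStar (Ψ : ℝ → ℝ) (n : ℕ) (g : ℂ → ℂ) : ℂ → ℂ :=
  fun z => ∑ j ∈ Finset.Icc (2 ^ (n - 1) : ℕ) (2 ^ (n + 1) - 1 : ℕ),
    (((Ψ ((j:ℝ) / 2 ^ n) - Ψ ((j:ℝ) / 2 ^ (n - 1))) : ℝ) : ℂ) * taylorCoeff g j * z ^ j

/-- `D^ω(V_n ∗ g)`, where `D^ω h(z) = ∑ ĥ(k) z^k/(2ω_{2k+1})`. -/
def DVnStar (Ψ : ℝ → ℝ) (ω : ℝ → ℝ) (n : ℕ) (g : ℂ → ℂ) : ℂ → ℂ :=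
  fun z => ∑ j ∈ Finset.Icc (2 ^ (n - 1) : ℕ) (2 ^ (n + 1) - 1 : ℕ),
    (((Ψ ((j:ℝ) / 2 ^ n) - Ψ ((j:ℝ) / 2 ^ (n - 1))) : ℝ) : ℂ) * taylorCoeff g j * z ^ j /
      (2 * ((momentW ω (2 * (j:ℝ) + 1) : ℝ) : ℂ))

/-- `J_ω(t) = ∫_0^t ds/(ω̂(s)(1-s))`. -/
def Jomega (ω : ℝ → ℝ) (t : ℝ) : ℝ := ∫ s in (0:ℝ)..t, 1 / (omegaHat ω s * (1 - s))

open scoped Topology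
open Real (circleAverage)

/-- `u` has first derivative `a` and second derivative `b` at `0`. -/
def HasJet (u : ℝ → ℝ) (a b : ℝ) : Prop :=
  ∃ u' : ℝ → ℝ, (∀ᶠ t in 𝓝 0, HasDerivAt u (u' t) t) ∧ u' 0 = a ∧ HasDerivAt u' b 0

namespace HasJet

variable {u v : ℝ → ℝ} {a b c d : ℝ}

lemma hasDerivAt (h : HasJet u a b) : HasDerivAt u a 0 := by
  obtain ⟨u', h1, h2, -⟩ := h
  exact h2 ▸ h1.self_of_nhds

lemma const (k : ℝ) : HasJet (fun _ => k) 0 0 :=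
  ⟨fun _ => 0, Eventually.of_forall fun t => hasDerivAt_const t k, rfl, hasDerivAt_const _ _⟩

lemma add (h : HasJet u a b) (h' : HasJet v c d) :
    HasJet (fun t => u t + v t) (a + c) (b + d) := by
  obtain ⟨u', h1, h2, h3⟩ := h
  obtain ⟨v', k1, k2, k3⟩ := h'
  exact ⟨fun t => u' t + v' t, by filter_upwards [h1, k1] with t x y using x.add y,
    by simp [h2, k2], h3.add k3⟩

lemma mul (h : HasJet u a b) (h' : HasJet v c d) :
    HasJet (fun t => u t * v t) (a * v 0 + u 0 * c) (b * v 0 + 2 * (a * c) + u 0 * d) := by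
  have hu := h.hasDerivAt
  have hv := h'.hasDerivAt
  obtain ⟨u', h1, h2, h3⟩ := h
  obtain ⟨v', k1, k2, k3⟩ := h'
  refine ⟨fun t => u' t * v t + u t * v' t,
    by filter_upwards [h1, k1] with t x y using x.mul y, by simp [h2, k2], ?_⟩
  refine ((h3.mul hv).add (hu.mul k3)).congr_deriv ?_
  rw [h2, k2]; ring

lemma exp (h : HasJet u a b) :
    HasJet (fun t => Real.exp (u t)) (Real.exp (u 0) * a) (Real.exp (u 0) * (b + a ^ 2)) := by
  have hu := h.hasDerivAt
  obtain ⟨u', h1, h2, h3⟩ := h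
  refine ⟨fun t => Real.exp (u t) * u' t, by filter_upwards [h1] with t x using x.exp,
    by simp [h2], ?_⟩
  refine (hu.exp.mul h3).congr_deriv ?_
  rw [h2]; ring

lemma log (h : HasJet u a b) (h0 : u 0 ≠ 0) :
    HasJet (fun t => Real.log (u t)) (a / u 0) (b / u 0 - a ^ 2 / u 0 ^ 2) := by
  have hu := h.hasDerivAt
  obtain ⟨u', h1, h2, h3⟩ := h
  have hne : ∀ᶠ t in 𝓝 (0:ℝ), u t ≠ 0 := hu.continuousAt.eventually_ne h0
  refine ⟨fun t => u' t / u t, by filter_upwards [h1, hne] with t x y using x.log y,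
    by simp [h2], ?_⟩
  refine (h3.div hu h0).congr_deriv ?_
  rw [h2]; field_simp

lemma of_re {f : ℂ → ℂ} {s : Set ℂ} (hs : IsOpen s) (hf : DifferentiableOn ℂ f s) {z : ℂ}
    (hz : z ∈ s) (e : ℂ) :
    HasJet (fun t : ℝ => (f (z + t * e)).re) (deriv f z * e).re (deriv (deriv f) z * e * e).re := by
  have line : ∀ t : ℝ, HasDerivAt (fun t : ℂ => z + t * e) e t := fun t => by
    simpa using ((hasDerivAt_id (t:ℂ)).mul_const e).const_add z
  have cont : Continuous fun t : ℝ => z + t * e := by fun_prop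
  have ev : ∀ᶠ t : ℝ in 𝓝 0, z + t * e ∈ s :=
    cont.continuousAt.eventually_mem (hs.mem_nhds (by simpa using hz))
  have key : ∀ {g : ℂ → ℂ} (_ : DifferentiableOn ℂ g s) {t : ℝ} (_ : z + t * e ∈ s),
      HasDerivAt (fun t : ℝ => (g (z + t * e)).re) (deriv g (z + t * e) * e).re t := by
    intro g hg t ht
    have h1 : HasDerivAt g (deriv g (z + t * e)) (z + t * e) :=
      (hg.differentiableAt (hs.mem_nhds ht)).hasDerivAt
    exact (h1.comp (t:ℂ) (line t)).real_of_complex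
  refine ⟨fun t => (deriv f (z + t * e) * e).re, ?_, by simp, ?_⟩
  · filter_upwards [ev] with t ht using key hf ht
  · have hd := (hf.deriv hs).mul_const e
    have h0 : z + ((0:ℝ):ℂ) * e ∈ s := by simpa using hz
    have h2 := key hd h0
    have h3 : deriv (fun y => deriv f y * e) (z + ((0:ℝ):ℂ) * e) = deriv (deriv f) z * e := by
      rw [deriv_mul_const ((hf.deriv hs).differentiableAt (hs.mem_nhds h0))]; simp
    rwa [h3] at h2

lemma nonpos_of_isLocalMax (h : HasJet u a b) (hm : IsLocalMax u 0) : b ≤ 0 := by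
  by_contra! hb
  obtain ⟨u', h1, h2, h3⟩ := id h
  have hd : deriv u =ᶠ[𝓝 0] u' := by filter_upwards [h1] with t ht using ht.deriv
  have hdd : deriv (deriv u) 0 = b := by rw [hd.deriv_eq, h3.deriv]
  have hmin : IsLocalMin u 0 := isLocalMin_of_deriv_deriv_pos (by rw [hdd]; exact hb)
    hm.deriv_eq_zero h.hasDerivAt.continuousAt
  have hconst : u =ᶠ[𝓝 0] fun _ => u 0 := by
    filter_upwards [hm, hmin] with t x y using le_antisymm x y
  have h4 : deriv u =ᶠ[𝓝 0] fun _ => 0 := by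
    filter_upwards [hconst.eventuallyEq_nhds] with t ht
    rw [ht.deriv_eq]; simp
  have : deriv (deriv u) 0 = 0 := by rw [h4.deriv_eq]; simp
  linarith

end HasJet

/-- `U` has gradient `(p₁, p₂)` and Laplacian `l` at `z`. -/
def HasLap (U : ℂ → ℝ) (z : ℂ) (p₁ p₂ l : ℝ) : Prop :=
  ∃ b₁ b₂ : ℝ, HasJet (fun t : ℝ => U (z + t)) p₁ b₁ ∧
    HasJet (fun t : ℝ => U (z + t * Complex.I)) p₂ b₂ ∧ b₁ + b₂ = l

namespace HasLap

variable {U V : ℂ → ℝ} {z : ℂ} {p₁ p₂ l q₁ q₂ m : ℝ}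

lemma const (k : ℝ) : HasLap (fun _ => k) z 0 0 0 :=
  ⟨0, 0, HasJet.const k, HasJet.const k, by simp⟩

lemma add (h : HasLap U z p₁ p₂ l) (h' : HasLap V z q₁ q₂ m) :
    HasLap (fun w => U w + V w) z (p₁ + q₁) (p₂ + q₂) (l + m) := by
  obtain ⟨b, c, h1, h2, rfl⟩ := h
  obtain ⟨b', c', k1, k2, rfl⟩ := h'
  exact ⟨_, _, h1.add k1, h2.add k2, by ring⟩

lemma mul (h : HasLap U z p₁ p₂ l) (h' : HasLap V z q₁ q₂ m) :
    HasLap (fun w => U w * V w) z (p₁ * V z + U z * q₁) (p₂ * V z + U z * q₂)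
      (l * V z + 2 * (p₁ * q₁ + p₂ * q₂) + U z * m) := by
  obtain ⟨b, c, h1, h2, rfl⟩ := h
  obtain ⟨b', c', k1, k2, rfl⟩ := h'
  have e1 := h1.mul k1
  have e2 := h2.mul k2
  simp only [Complex.ofReal_zero, zero_mul, add_zero] at e1 e2
  exact ⟨_, _, e1, e2, by ring⟩

lemma const_mul (k : ℝ) (h : HasLap U z p₁ p₂ l) :
    HasLap (fun w => k * U w) z (k * p₁) (k * p₂) (k * l) := by
  simpa using (const (z := z) k).mul h

lemma exp (h : HasLap U z p₁ p₂ l) :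
    HasLap (fun w => Real.exp (U w)) z (Real.exp (U z) * p₁) (Real.exp (U z) * p₂)
      (Real.exp (U z) * (l + (p₁ ^ 2 + p₂ ^ 2))) := by
  obtain ⟨b, c, h1, h2, rfl⟩ := h
  have e1 := h1.exp
  have e2 := h2.exp
  simp only [Complex.ofReal_zero, zero_mul, add_zero] at e1 e2
  exact ⟨_, _, e1, e2, by ring⟩

lemma log (h : HasLap U z p₁ p₂ l) (h0 : U z ≠ 0) :
    HasLap (fun w => Real.log (U w)) z (p₁ / U z) (p₂ / U z)
      (l / U z - (p₁ ^ 2 + p₂ ^ 2) / U z ^ 2) := by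
  obtain ⟨b, c, h1, h2, rfl⟩ := h
  have e1 := h1.log (by simpa using h0)
  have e2 := h2.log (by simpa using h0)
  simp only [Complex.ofReal_zero, zero_mul, add_zero] at e1 e2
  exact ⟨_, _, e1, e2, by ring⟩

lemma re {f : ℂ → ℂ} {s : Set ℂ} (hs : IsOpen s) (hf : DifferentiableOn ℂ f s) (hz : z ∈ s) :
    HasLap (fun w => (f w).re) z (deriv f z).re (-(deriv f z).im) 0 := by
  have h1 := HasJet.of_re hs hf hz 1
  have h2 := HasJet.of_re hs hf hz Complex.I
  simp only [mul_one] at h1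
  exact ⟨_, _, h1, by simpa using h2, by simp⟩

lemma im {f : ℂ → ℂ} {s : Set ℂ} (hs : IsOpen s) (hf : DifferentiableOn ℂ f s) (hz : z ∈ s) :
    HasLap (fun w => (f w).im) z (deriv f z).im (deriv f z).re 0 := by
  have h := re hs (hf.const_mul (-Complex.I)) hz
  have hd : deriv (fun y => -Complex.I * f y) z = -Complex.I * deriv f z :=
    deriv_const_mul _ (hf.differentiableAt (hs.mem_nhds hz))
  rw [hd] at h
  simpa using h

lemma norm_sq {f : ℂ → ℂ} {s : Set ℂ} (hs : IsOpen s) (hf : DifferentiableOn ℂ f s)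
    (hz : z ∈ s) :
    ∃ p₁ p₂ : ℝ, p₁ ^ 2 + p₂ ^ 2 = 4 * ‖f z‖ ^ 2 * ‖deriv f z‖ ^ 2 ∧
      HasLap (fun w => ‖f w‖ ^ 2) z p₁ p₂ (4 * ‖deriv f z‖ ^ 2) := by
  have h := ((re hs hf hz).mul (re hs hf hz)).add ((im hs hf hz).mul (im hs hf hz))
  simp only [Complex.sq_norm, Complex.normSq_apply]
  refine ⟨_, _, ?_, by convert h using 1; ring⟩
  ring

lemma re_mul_conj {f g : ℂ → ℂ} {s : Set ℂ} (hs : IsOpen s) (hf : DifferentiableOn ℂ f s)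
    (hg : DifferentiableOn ℂ g s) (hz : z ∈ s) :
    ∃ p₁ p₂ : ℝ, HasLap (fun w => (f w * (starRingEnd ℂ) (g w)).re) z p₁ p₂
      (4 * (deriv f z * (starRingEnd ℂ) (deriv g z)).re) := by
  have h := ((re hs hf hz).mul (re hs hg hz)).add ((im hs hf hz).mul (im hs hg hz))
  have hU : (fun w => (f w * (starRingEnd ℂ) (g w)).re) =
      fun w => (f w).re * (g w).re + (f w).im * (g w).im := by
    ext w; simp
  rw [hU]
  obtain ⟨b, c, h1, h2, h3⟩ := h
  refine ⟨_, _, b, c, h1, h2, h3.trans ?_⟩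
  simp only [Complex.mul_re, Complex.conj_re, Complex.conj_im]
  ring

end HasLap

/-- Continuous on the closed unit disc, with nonnegative Laplacian in the interior. -/
def IsSubharm (U : ℂ → ℝ) : Prop :=
  ContinuousOn U (Metric.closedBall 0 1) ∧
    ∀ z ∈ Metric.ball (0:ℂ) 1, ∃ p₁ p₂ l : ℝ, HasLap U z p₁ p₂ l ∧ 0 ≤ l

lemma IsSubharm.add {U V : ℂ → ℝ} (hU : IsSubharm U) (hV : IsSubharm V) :
    IsSubharm fun z => U z + V z := by
  refine ⟨hU.1.add hV.1, fun z hz => ?_⟩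
  obtain ⟨_, _, l, h, hl⟩ := hU.2 z hz
  obtain ⟨_, _, m, k, hm⟩ := hV.2 z hz
  exact ⟨_, _, _, h.add k, by positivity⟩

lemma isSubharm_re {f : ℂ → ℂ} (hf : DiffContOnCl ℂ f (Metric.ball 0 1)) :
    IsSubharm fun z => (f z).re := by
  refine ⟨Complex.continuous_re.comp_continuousOn ?_, fun z hz => ?_⟩
  · simpa [closure_ball] using hf.continuousOn
  · exact ⟨_, _, _, HasLap.re Metric.isOpen_ball hf.differentiableOn hz, le_rfl⟩

/-- Maximum principle. -/
lemma IsSubharm.le_of_sphere {U : ℂ → ℝ} (hU : IsSubharm U) {M : ℝ}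
    (hM : ∀ z ∈ Metric.sphere (0:ℂ) 1, U z ≤ M) {z : ℂ} (hz : z ∈ Metric.closedBall (0:ℂ) 1) :
    U z ≤ M := by
  refine le_of_forall_pos_le_add fun δ hδ => ?_
  set W : ℂ → ℝ := fun w => U w + δ * ‖w‖ ^ 2 with hW
  have hWc : ContinuousOn W (Metric.closedBall 0 1) := hU.1.add (by fun_prop)
  obtain ⟨w, hw, hmax⟩ := (isCompact_closedBall (0:ℂ) 1).exists_isMaxOn ⟨0, by simp⟩ hWc
  have hle : U z ≤ W w := by
    have h1 : W z ≤ W w := hmax hz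
    have : 0 ≤ δ * ‖z‖ ^ 2 := by positivity
    simp only [hW] at h1 ⊢
    linarith
  have hwn : ‖w‖ ≤ 1 := by simpa using hw
  rcases hwn.eq_or_lt with h1 | h1
  · have := hM w (by simpa using h1)
    simp only [hW, h1] at hle
    linarith
  · exfalso
    have hwb : w ∈ Metric.ball (0:ℂ) 1 := by simpa using h1
    obtain ⟨p₁, p₂, l, hl, hl0⟩ := hU.2 w hwb
    obtain ⟨q₁, q₂, -, hq⟩ := HasLap.norm_sq (f := fun z => z) isOpen_univ differentiableOn_id
      (mem_univ w)
    obtain ⟨b, c, hb, hc, hbc⟩ := hl.add (hq.const_mul δ)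
    have hloc : IsLocalMax W w :=
      (hmax.isLocalMax (Metric.closedBall_mem_nhds_of_mem hwb))
    have aux : ∀ e : ℂ, IsLocalMax (fun t : ℝ => W (w + t * e)) 0 := fun e => by
      have hcont : ContinuousAt (fun t : ℝ => w + t * e) 0 := by fun_prop
      have h2 : Tendsto (fun t : ℝ => w + t * e) (𝓝 0) (𝓝 w) := by
        simpa [ContinuousAt] using hcont
      have := h2.eventually hloc
      simpa [IsLocalMax, IsMaxFilter] using this
    have hb0 := hb.nonpos_of_isLocalMax (by simpa [hW] using aux 1)
    have hc0 := hc.nonpos_of_isLocalMax (by simpa [hW] using aux Complex.I)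
    have : deriv (fun z : ℂ => z) w = 1 := by simp
    rw [this] at hbc
    norm_num at hbc
    linarith

lemma circleIntegrable_of_sphere {E : Type*} [NormedAddCommGroup E] {u : ℂ → E}
    (h : ContinuousOn u (Metric.sphere 0 1)) : CircleIntegrable u 0 1 :=
  h.circleIntegrable zero_le_one

lemma circleAverage_mono_sphere {u v : ℂ → ℝ} (hu : ContinuousOn u (Metric.sphere 0 1))
    (hv : ContinuousOn v (Metric.sphere 0 1)) (h : ∀ z ∈ Metric.sphere (0:ℂ) 1, u z ≤ v z) :
    circleAverage u 0 1 ≤ circleAverage v 0 1 :=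
  Real.circleAverage_mono (circleIntegrable_of_sphere hu) (circleIntegrable_of_sphere hv)
    (by simpa using h)

/-- Real parts of polynomials are uniformly dense in the continuous functions on the circle. -/
lemma exists_polynomial_re_near {u : ℂ → ℝ} (hu : ContinuousOn u (Metric.sphere 0 1)) {ε : ℝ}
    (hε : 0 < ε) :
    ∃ Q : Polynomial ℂ, ∀ z ∈ Metric.sphere (0:ℂ) 1, |(Q.eval z).re - u z| ≤ ε := by
  have : Fact (0 < (1:ℝ)) := ⟨one_pos⟩
  have hmem : ∀ x : AddCircle (1:ℝ), (AddCircle.toCircle x : ℂ) ∈ Metric.sphere (0:ℂ) 1 :=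
    fun x => (AddCircle.toCircle x).2
  have hcont : Continuous fun x : AddCircle (1:ℝ) => ((u (AddCircle.toCircle x) : ℝ) : ℂ) := by
    refine Complex.continuous_ofReal.comp (hu.comp_continuous ?_ hmem)
    exact continuous_subtype_val.comp AddCircle.continuous_toCircle
  set F : C(AddCircle (1:ℝ), ℂ) := ⟨_, hcont⟩ with hF
  have hFc : F ∈ (Submodule.span ℂ (range <| @fourier (1:ℝ))).topologicalClosure := by
    rw [span_fourier_closure_eq_top]; trivial
  rw [← SetLike.mem_coe, Submodule.topologicalClosure_coe, Metric.mem_closure_iff] at hFc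
  obtain ⟨G, hG, hd⟩ := hFc ε hε
  have key : ∀ h ∈ Submodule.span ℂ (range <| @fourier (1:ℝ)), ∃ Q R : Polynomial ℂ,
      ∀ x : AddCircle (1:ℝ), h x = Q.eval (AddCircle.toCircle x : ℂ) +
        (starRingEnd ℂ) (R.eval (AddCircle.toCircle x : ℂ)) := by
    intro h hh
    induction hh using Submodule.span_induction with
    | mem h hh =>
      obtain ⟨n, rfl⟩ := hh
      obtain ⟨k, rfl | rfl⟩ := n.eq_nat_or_neg
      · exact ⟨Polynomial.X ^ k, 0, fun x => by
          rw [fourier_apply, AddCircle.toCircle_zsmul]; simp⟩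
      · refine ⟨0, Polynomial.X ^ k, fun x => ?_⟩
        rw [fourier_apply, AddCircle.toCircle_zsmul]
        simp [← Circle.coe_inv_eq_conj]
    | zero => exact ⟨0, 0, by simp⟩
    | add f g _ _ hf hg =>
      obtain ⟨Q, R, h1⟩ := hf
      obtain ⟨Q', R', h2⟩ := hg
      exact ⟨Q + Q', R + R', fun x => by simp [h1, h2]; ring⟩
    | smul c f _ hf =>
      obtain ⟨Q, R, h1⟩ := hf
      exact ⟨Polynomial.C c * Q, Polynomial.C ((starRingEnd ℂ) c) * R,
        fun x => by simp [h1]; ring⟩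
  obtain ⟨Q, R, h⟩ := key G hG
  refine ⟨Q + R, fun z hz => ?_⟩
  obtain ⟨x, hx⟩ := (AddCircle.homeomorphCircle (one_ne_zero : (1:ℝ) ≠ 0)).surjective
    ⟨z, hz⟩
  have hxz : (AddCircle.toCircle x : ℂ) = z := by
    rw [← AddCircle.homeomorphCircle_apply one_ne_zero, hx]
  have h1 : ‖(F - G) x‖ ≤ ε := (ContinuousMap.norm_coe_le_norm _ x).trans
    (by rw [← dist_eq_norm]; exact hd.le)
  have h2 := (Complex.abs_re_le_norm _).trans h1
  rw [abs_sub_comm]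
  simpa [hF, h, hxz] using h2

lemma circleAverage_re {F : ℂ → ℂ} {R : ℝ} (hF : CircleIntegrable F 0 R) :
    circleAverage (fun z => (F z).re) 0 R = (circleAverage F 0 R).re :=
  Complex.reCLM.circleAverage_comp_comm hF

lemma DiffContOnCl.continuousOn_closedBall {f : ℂ → ℂ}
    (hf : DiffContOnCl ℂ f (Metric.ball 0 1)) : ContinuousOn f (Metric.closedBall 0 1) := by
  simpa [closure_ball] using hf.continuousOn

lemma DiffContOnCl.continuousOn_sphere {f : ℂ → ℂ}
    (hf : DiffContOnCl ℂ f (Metric.ball 0 1)) : ContinuousOn f (Metric.sphere 0 1) :=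
  hf.continuousOn_closedBall.mono Metric.sphere_subset_closedBall

lemma circleAverage_re_of_diffContOnCl {F : ℂ → ℂ} (hF : DiffContOnCl ℂ F (Metric.ball 0 1))
    {ρ : ℝ} (h0 : 0 ≤ ρ) (h1 : ρ ≤ 1) :
    circleAverage (fun z => (F z).re) 0 ρ = (F 0).re := by
  have hs : Metric.sphere (0:ℂ) ρ ⊆ Metric.closedBall 0 1 :=
    Metric.sphere_subset_closedBall.trans (Metric.closedBall_subset_closedBall h1)
  rw [circleAverage_re ((hF.continuousOn_closedBall.mono hs).circleIntegrable h0)]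
  congr 1
  refine DiffContOnCl.circleAverage (hF.mono (Metric.ball_subset_ball ?_))
  rwa [abs_of_nonneg h0]

lemma Polynomial.diffContOnCl_eval (Q : Polynomial ℂ) (s : Set ℂ) :
    DiffContOnCl ℂ (fun z => Q.eval z) s :=
  Q.differentiable.diffContOnCl

lemma circleAverage_le_add_of_sphere {u v : ℂ → ℝ} (hu : ContinuousOn u (Metric.sphere 0 1))
    (hv : ContinuousOn v (Metric.sphere 0 1)) {ε : ℝ}
    (h : ∀ z ∈ Metric.sphere (0:ℂ) 1, u z ≤ v z + ε) :
    circleAverage u 0 1 ≤ circleAverage v 0 1 + ε := by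
  have := circleAverage_mono_sphere hu (hv.add continuousOn_const) h
  rwa [Real.circleAverage_add (circleIntegrable_of_sphere hv)
    (circleIntegrable_of_sphere continuousOn_const), Real.circleAverage_const] at this

/-- Integral means of subharmonic functions increase up to the boundary. -/
lemma IsSubharm.circleAverage_le {U : ℂ → ℝ} (hU : IsSubharm U) {ρ : ℝ} (h0 : 0 ≤ ρ)
    (h1 : ρ ≤ 1) : circleAverage U 0 ρ ≤ circleAverage U 0 1 := by
  have hUs := hU.1.mono Metric.sphere_subset_closedBall
  refine le_of_forall_pos_le_add fun δ hδ => ?_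
  obtain ⟨Q, hQ⟩ := exists_polynomial_re_near hUs (half_pos hδ)
  have hQd := Q.diffContOnCl_eval (Metric.ball 0 1)
  have hW : IsSubharm fun z => U z + (-Q.eval z).re := hU.add (isSubharm_re hQd.neg)
  have hle : ∀ z ∈ Metric.closedBall (0:ℂ) 1, U z ≤ (Q.eval z).re + δ / 2 := fun z hz => by
    have := hW.le_of_sphere (M := δ / 2)
      (fun z hz => by have := abs_le.1 (hQ z hz); simp; linarith) hz
    simp at this; linarith
  have hs : Metric.sphere (0:ℂ) ρ ⊆ Metric.closedBall 0 1 :=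
    Metric.sphere_subset_closedBall.trans (Metric.closedBall_subset_closedBall h1)
  have hQc : Continuous fun z : ℂ => (Q.eval z).re := by fun_prop
  have e1 : circleAverage U 0 ρ ≤ circleAverage (fun z => (Q.eval z).re + δ / 2) 0 ρ :=
    Real.circleAverage_mono ((hU.1.mono hs).circleIntegrable h0)
      ((hQc.add continuous_const).continuousOn.circleIntegrable h0)
      (fun z hz => hle z (hs (by rwa [abs_of_nonneg h0] at hz)))
  rw [Real.circleAverage_fun_add (hQc.continuousOn.circleIntegrable h0)
    (continuousOn_const.circleIntegrable h0), Real.circleAverage_const,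
    circleAverage_re_of_diffContOnCl hQd h0 h1,
    ← circleAverage_re_of_diffContOnCl hQd zero_le_one le_rfl] at e1
  have e2 : circleAverage (fun z => (Q.eval z).re) 0 1 ≤ circleAverage U 0 1 + δ / 2 :=
    circleAverage_le_add_of_sphere hQc.continuousOn hUs
      (fun z hz => by have := abs_le.1 (hQ z hz); linarith)
  linarith

/-- The disc automorphism exchanging `0` and `a`. -/
def discAut (a z : ℂ) : ℂ := (a - z) / (1 - (starRingEnd ℂ) a * z)

lemma one_sub_conj_mul_ne_zero {a z : ℂ} (ha : ‖a‖ < 1) (hz : ‖z‖ ≤ 1) :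
    1 - (starRingEnd ℂ) a * z ≠ 0 := by
  intro h
  have h1 : ‖(starRingEnd ℂ) a * z‖ = 1 := by rw [← sub_eq_zero.1 h]; simp
  rw [norm_mul, RCLike.norm_conj] at h1
  nlinarith [norm_nonneg a, norm_nonneg z]

lemma norm_sq_one_sub_conj_mul (a z : ℂ) :
    ‖1 - (starRingEnd ℂ) a * z‖ ^ 2 = ‖a - z‖ ^ 2 + (1 - ‖a‖ ^ 2) * (1 - ‖z‖ ^ 2) := by
  simp only [Complex.sq_norm, Complex.normSq_apply]
  simp; ring

lemma norm_discAut_lt {a z : ℂ} (ha : ‖a‖ < 1) (hz : ‖z‖ < 1) : ‖discAut a z‖ < 1 := by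
  have h := norm_pos_iff.2 (one_sub_conj_mul_ne_zero ha hz.le)
  rw [discAut, norm_div, div_lt_one h]
  refine lt_of_pow_lt_pow_left₀ 2 h.le ?_
  rw [norm_sq_one_sub_conj_mul]
  have : 0 < (1 - ‖a‖ ^ 2) * (1 - ‖z‖ ^ 2) := by
    apply mul_pos <;> nlinarith [norm_nonneg a, norm_nonneg z]
  linarith

lemma norm_discAut_eq {a z : ℂ} (ha : ‖a‖ < 1) (hz : ‖z‖ = 1) : ‖discAut a z‖ = 1 := by
  have h := norm_pos_iff.2 (one_sub_conj_mul_ne_zero ha hz.le)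
  rw [discAut, norm_div, div_eq_one_iff_eq h.ne']
  have := norm_sq_one_sub_conj_mul a z
  rw [hz] at this
  refine ((sq_eq_sq₀ (norm_nonneg _) h.le).1 ?_)
  rw [this]; ring

lemma discAut_zero (a : ℂ) : discAut a 0 = a := by simp [discAut]

lemma differentiableAt_discAut {a z : ℂ} (ha : ‖a‖ < 1) (hz : ‖z‖ ≤ 1) :
    DifferentiableAt ℂ (discAut a) z := by
  unfold discAut
  exact DifferentiableAt.div (by fun_prop) (by fun_prop) (one_sub_conj_mul_ne_zero ha hz)

lemma continuousOn_discAut {a : ℂ} (ha : ‖a‖ < 1) :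
    ContinuousOn (discAut a) (Metric.closedBall 0 1) := fun z hz =>
  (differentiableAt_discAut ha (by simpa using hz)).continuousAt.continuousWithinAt

lemma diffContOnCl_comp_discAut {a : ℂ} (ha : ‖a‖ < 1) {F : ℂ → ℂ}
    (hF : DiffContOnCl ℂ F (Metric.ball 0 1)) :
    DiffContOnCl ℂ (fun z => F (discAut a z)) (Metric.ball 0 1) := by
  refine hF.comp ⟨fun z hz => ?_, ?_⟩ fun z hz => ?_
  · exact (differentiableAt_discAut ha (by simpa using (mem_ball_zero_iff.1 hz).le)
      ).differentiableWithinAt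
  · simpa [closure_ball] using continuousOn_discAut ha
  · simpa using norm_discAut_lt ha (by simpa using hz)

lemma continuousOn_comp_discAut {E : Type*} [TopologicalSpace E] {a : ℂ} (ha : ‖a‖ < 1)
    {u : ℂ → E} (hu : ContinuousOn u (Metric.sphere 0 1)) :
    ContinuousOn (fun z => u (discAut a z)) (Metric.sphere 0 1) :=
  hu.comp ((continuousOn_discAut ha).mono Metric.sphere_subset_closedBall)
    fun z hz => by simpa using norm_discAut_eq ha (by simpa using hz)

lemma poissonKernel_nonneg {a z : ℂ} (ha : ‖a‖ < 1) (hz : z ∈ Metric.sphere (0:ℂ) 1) :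
    0 ≤ poissonKernel 0 a z := by
  rw [mem_sphere_zero_iff_norm] at hz
  rw [poissonKernel_def, sub_zero, sub_zero, hz]
  have : 0 ≤ 1 ^ 2 - ‖a‖ ^ 2 := by nlinarith [norm_nonneg a]
  positivity

lemma continuousOn_poissonKernel {a : ℂ} (ha : ‖a‖ < 1) :
    ContinuousOn (poissonKernel 0 a) (Metric.sphere 0 1) := by
  unfold poissonKernel
  refine ContinuousOn.div (by fun_prop) (by fun_prop) fun z hz => ?_
  have : z ≠ a := by rintro rfl; simp at hz; linarith
  simpa [sub_eq_zero] using this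

lemma circleAverage_poissonKernel {a : ℂ} (ha : ‖a‖ < 1) :
    circleAverage (poissonKernel 0 a) 0 1 = 1 := by
  have h : DiffContOnCl ℂ (fun _ : ℂ => (1:ℂ)) (Metric.ball 0 1) := diffContOnCl_const
  have := h.circleAverage_poissonKernel_smul (w := a) (by simpa using ha)
  have h2 := circleAverage_re (F := poissonKernel 0 a • fun _ : ℂ => (1:ℂ)) (R := 1)
    (circleIntegrable_of_sphere ((continuousOn_poissonKernel ha).smul continuousOn_const))
  rw [this] at h2
  simpa using h2

/-- Change of variables under disc automorphisms. -/
lemma circleAverage_comp_discAut {a : ℂ} (ha : ‖a‖ < 1) {u : ℂ → ℝ}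
    (hu : ContinuousOn u (Metric.sphere 0 1)) :
    circleAverage (fun z => u (discAut a z)) 0 1 =
      circleAverage (fun z => poissonKernel 0 a z * u z) 0 1 := by
  have hPc := continuousOn_poissonKernel ha
  have hφ : ∀ z ∈ Metric.sphere (0:ℂ) 1, discAut a z ∈ Metric.sphere (0:ℂ) 1 :=
    fun z hz => by simpa using norm_discAut_eq ha (by simpa using hz)
  refine eq_of_forall_dist_le fun ε hε => ?_
  obtain ⟨Q, hQ⟩ := exists_polynomial_re_near hu (half_pos hε)
  have hQd := Q.diffContOnCl_eval (Metric.ball 0 1)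
  have hQc : ContinuousOn (fun z : ℂ => (Q.eval z).re) (Metric.sphere 0 1) :=
    (by fun_prop : Continuous fun z : ℂ => (Q.eval z).re).continuousOn
  have e1 : circleAverage (fun z => (Q.eval (discAut a z)).re) 0 1 = (Q.eval a).re := by
    rw [circleAverage_re_of_diffContOnCl (diffContOnCl_comp_discAut ha hQd) zero_le_one le_rfl,
      discAut_zero]
  have e2 : circleAverage (fun z => poissonKernel 0 a z * (Q.eval z).re) 0 1 = (Q.eval a).re := by
    rw [← hQd.circleAverage_poissonKernel_smul (w := a) (by simpa using ha),
      ← circleAverage_re]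
    · simp
    · exact circleIntegrable_of_sphere (hPc.smul hQd.continuousOn_sphere)
  have hPu := hPc.mul hu
  have hPQ := hPc.mul hQc
  have hP2 : ContinuousOn (fun z => ε / 2 * poissonKernel 0 a z) (Metric.sphere 0 1) :=
    hPc.const_mul _
  have e3 : circleAverage (fun z => ε / 2 * poissonKernel 0 a z) 0 1 = ε / 2 := by
    have := Real.circleAverage_fun_smul (a := ε / 2) (f := poissonKernel 0 a) (c := 0) (R := 1)
    simp only [smul_eq_mul] at this
    rw [this, circleAverage_poissonKernel ha, mul_one]
  have i1 := circleAverage_le_add_of_sphere (continuousOn_comp_discAut ha hu)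
    (continuousOn_comp_discAut ha hQc) (ε := ε / 2)
    (fun z hz => by have := abs_le.1 (hQ _ (hφ z hz)); linarith)
  have i2 := circleAverage_le_add_of_sphere (continuousOn_comp_discAut ha hQc)
    (continuousOn_comp_discAut ha hu) (ε := ε / 2)
    (fun z hz => by have := abs_le.1 (hQ _ (hφ z hz)); linarith)
  have i3 := circleAverage_mono_sphere hPu (hPQ.add hP2) fun z hz => by
    have h1 := abs_le.1 (hQ z hz)
    have h2 := poissonKernel_nonneg ha hz
    simp only [Pi.mul_apply, Pi.add_apply]
    nlinarith
  have i4 := circleAverage_mono_sphere hPQ (hPu.add hP2) fun z hz => by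
    have h1 := abs_le.1 (hQ z hz)
    have h2 := poissonKernel_nonneg ha hz
    simp only [Pi.mul_apply, Pi.add_apply]
    nlinarith
  rw [Real.circleAverage_add (circleIntegrable_of_sphere hPQ) (circleIntegrable_of_sphere hP2)]
    at i3
  rw [Real.circleAverage_add (circleIntegrable_of_sphere hPu) (circleIntegrable_of_sphere hP2)]
    at i4
  rw [e3] at i3 i4
  simp only [Pi.mul_def] at i3 i4
  rw [Real.dist_eq, abs_le]
  constructor <;> linarith

/-- The function `½ log (‖f‖² + δ²)`, whose exponential is a smooth substitute for `‖f‖`. -/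
def logReg (f : ℂ → ℂ) (δ : ℝ) (z : ℂ) : ℝ := 1 / 2 * Real.log (‖f z‖ ^ 2 + δ ^ 2)

lemma exp_logReg {f : ℂ → ℂ} {δ : ℝ} (hδ : 0 < δ) (z : ℂ) :
    Real.exp (logReg f δ z) = √(‖f z‖ ^ 2 + δ ^ 2) := by
  have h : 0 < ‖f z‖ ^ 2 + δ ^ 2 := by positivity
  rw [logReg, Real.sqrt_eq_rpow, Real.rpow_def_of_pos h, mul_comm]

lemma exp_logReg_sq {f : ℂ → ℂ} {δ : ℝ} (hδ : 0 < δ) (z : ℂ) :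
    Real.exp (logReg f δ z) ^ 2 = ‖f z‖ ^ 2 + δ ^ 2 := by
  rw [exp_logReg hδ, Real.sq_sqrt (by positivity)]

lemma norm_le_exp_logReg {f : ℂ → ℂ} {δ : ℝ} (hδ : 0 < δ) (z : ℂ) :
    ‖f z‖ ≤ Real.exp (logReg f δ z) := by
  rw [exp_logReg hδ]
  exact Real.le_sqrt_of_sq_le (by nlinarith)

lemma exp_logReg_le {f : ℂ → ℂ} {δ : ℝ} (hδ : 0 < δ) (z : ℂ) :
    Real.exp (logReg f δ z) ≤ ‖f z‖ + δ := by
  rw [exp_logReg hδ, Real.sqrt_le_left (by positivity)]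
  nlinarith [norm_nonneg (f z)]

lemma continuousOn_logReg {f : ℂ → ℂ} {δ : ℝ} (hδ : 0 < δ) {s : Set ℂ} (hf : ContinuousOn f s) :
    ContinuousOn (logReg f δ) s :=
  (((hf.norm.pow 2).add continuousOn_const).log fun z _ => by
    have : 0 < ‖f z‖ ^ 2 + δ ^ 2 := by positivity
    exact this.ne').const_mul _

lemma hasLap_logReg {f : ℂ → ℂ} {δ : ℝ} (hδ : 0 < δ) {s : Set ℂ} (hs : IsOpen s)
    (hf : DifferentiableOn ℂ f s) {z : ℂ} (hz : z ∈ s) :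
    ∃ p₁ p₂ l : ℝ, HasLap (logReg f δ) z p₁ p₂ l ∧ 0 ≤ l ∧
      ‖deriv f z‖ ^ 2 ≤ Real.exp (logReg f δ z) ^ 2 * (l + (p₁ ^ 2 + p₂ ^ 2)) := by
  obtain ⟨p₁, p₂, hp, h⟩ := HasLap.norm_sq hs hf hz
  have hw : 0 < ‖f z‖ ^ 2 + δ ^ 2 := by positivity
  have h1 := ((h.add (HasLap.const (δ ^ 2))).log hw.ne').const_mul (1 / 2)
  simp only [add_zero] at h1
  rw [hp] at h1
  refine ⟨_, _, _, h1, ?_, ?_⟩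
  · have : 1 / 2 * (4 * ‖deriv f z‖ ^ 2 / (‖f z‖ ^ 2 + δ ^ 2) -
        4 * ‖f z‖ ^ 2 * ‖deriv f z‖ ^ 2 / (‖f z‖ ^ 2 + δ ^ 2) ^ 2) =
        2 * δ ^ 2 * ‖deriv f z‖ ^ 2 / (‖f z‖ ^ 2 + δ ^ 2) ^ 2 := by
      field_simp; ring
    rw [this]; positivity
  · rw [exp_logReg_sq hδ]
    have : (‖f z‖ ^ 2 + δ ^ 2) * (1 / 2 * (4 * ‖deriv f z‖ ^ 2 / (‖f z‖ ^ 2 + δ ^ 2) -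
        4 * ‖f z‖ ^ 2 * ‖deriv f z‖ ^ 2 / (‖f z‖ ^ 2 + δ ^ 2) ^ 2) +
        ((1 / 2 * (p₁ / (‖f z‖ ^ 2 + δ ^ 2))) ^ 2 + (1 / 2 * (p₂ / (‖f z‖ ^ 2 + δ ^ 2))) ^ 2)) =
        (2 * ‖deriv f z‖ ^ 2 * δ ^ 2 + 1 / 4 * (p₁ ^ 2 + p₂ ^ 2)) / (‖f z‖ ^ 2 + δ ^ 2) := by
      field_simp; ring
    rw [this, hp, le_div_iff₀ hw]
    nlinarith [mul_nonneg (sq_nonneg ‖deriv f z‖) (sq_nonneg δ)]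

lemma isSubharm_exp_logReg {f : ℂ → ℂ} (hf : DiffContOnCl ℂ f (Metric.ball 0 1)) {δ : ℝ}
    (hδ : 0 < δ) : IsSubharm fun z => Real.exp (logReg f δ z) := by
  refine ⟨(continuousOn_logReg hδ hf.continuousOn_closedBall).rexp, fun z hz => ?_⟩
  obtain ⟨p₁, p₂, l, h, hl, -⟩ := hasLap_logReg hδ Metric.isOpen_ball hf.differentiableOn hz
  exact ⟨_, _, _, h.exp, by positivity⟩

lemma isSubharm_norm_sq {f : ℂ → ℂ} (hf : DiffContOnCl ℂ f (Metric.ball 0 1)) :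
    IsSubharm fun z => ‖f z‖ ^ 2 := by
  refine ⟨hf.continuousOn_closedBall.norm.pow 2, fun z hz => ?_⟩
  obtain ⟨p₁, p₂, -, h⟩ := HasLap.norm_sq Metric.isOpen_ball hf.differentiableOn hz
  exact ⟨_, _, _, h, by positivity⟩

lemma circleAverage_norm_le {f : ℂ → ℂ} (hf : DiffContOnCl ℂ f (Metric.ball 0 1)) {ρ : ℝ}
    (h0 : 0 ≤ ρ) (h1 : ρ ≤ 1) :
    circleAverage (fun z => ‖f z‖) 0 ρ ≤ circleAverage (fun z => ‖f z‖) 0 1 := by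
  refine le_of_forall_pos_le_add fun δ hδ => ?_
  have hs : Metric.sphere (0:ℂ) ρ ⊆ Metric.closedBall 0 1 :=
    Metric.sphere_subset_closedBall.trans (Metric.closedBall_subset_closedBall h1)
  have hU := isSubharm_exp_logReg hf hδ
  calc circleAverage (fun z => ‖f z‖) 0 ρ
      ≤ circleAverage (fun z => Real.exp (logReg f δ z)) 0 ρ :=
        Real.circleAverage_mono ((hf.continuousOn_closedBall.norm.mono hs).circleIntegrable h0)
          ((hU.1.mono hs).circleIntegrable h0) fun z _ => norm_le_exp_logReg hδ z
    _ ≤ circleAverage (fun z => Real.exp (logReg f δ z)) 0 1 := hU.circleAverage_le h0 h1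
    _ ≤ circleAverage (fun z => ‖f z‖) 0 1 + δ :=
        circleAverage_le_add_of_sphere (hU.1.mono Metric.sphere_subset_closedBall)
          hf.continuousOn_sphere.norm fun z _ => exp_logReg_le hδ z

lemma circleAverage_norm_sq_le {f : ℂ → ℂ} (hf : DiffContOnCl ℂ f (Metric.ball 0 1)) {ρ : ℝ}
    (h0 : 0 ≤ ρ) (h1 : ρ ≤ 1) :
    circleAverage (fun z => ‖f z‖ ^ 2) 0 ρ ≤ circleAverage (fun z => ‖f z‖ ^ 2) 0 1 :=
  (isSubharm_norm_sq hf).circleAverage_le h0 h1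

lemma norm_zero_le_circleAverage {f : ℂ → ℂ} (hf : DiffContOnCl ℂ f (Metric.ball 0 1)) :
    ‖f 0‖ ≤ circleAverage (fun z => ‖f z‖) 0 1 := by
  simpa using circleAverage_norm_le hf le_rfl zero_le_one

lemma circleAverage_norm_sq_eq {u : ℂ → ℂ} (hu : DiffContOnCl ℂ u (Metric.ball 0 1)) :
    circleAverage (fun z => ‖u z‖ ^ 2) 0 1 =
      circleAverage (fun z => ‖u z - u 0‖ ^ 2) 0 1 + ‖u 0‖ ^ 2 := by
  set c := u 0 with hc
  have e : (fun z => ‖u z‖ ^ 2) =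
      (fun z => ‖u z - c‖ ^ 2) +
        fun z => (2 * (starRingEnd ℂ) c * u z - c * (starRingEnd ℂ) c).re := by
    ext z
    simp only [Pi.add_apply, Complex.sq_norm, Complex.normSq_apply]
    simp; ring
  have hF : DiffContOnCl ℂ (fun z => 2 * (starRingEnd ℂ) c * u z - c * (starRingEnd ℂ) c)
      (Metric.ball 0 1) := (hu.const_smul (2 * (starRingEnd ℂ) c)).sub_const _
  have i1 : ContinuousOn (fun z => ‖u z - c‖ ^ 2) (Metric.sphere 0 1) :=
    (hu.continuousOn_sphere.sub continuousOn_const).norm.pow 2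
  have i2 : ContinuousOn (fun z => (2 * (starRingEnd ℂ) c * u z - c * (starRingEnd ℂ) c).re)
      (Metric.sphere 0 1) := Complex.continuous_re.comp_continuousOn hF.continuousOn_sphere
  rw [e, Real.circleAverage_add (circleIntegrable_of_sphere i1) (circleIntegrable_of_sphere i2),
    circleAverage_re_of_diffContOnCl hF zero_le_one le_rfl, ← hc]
  congr 1
  rw [Complex.sq_norm, Complex.normSq_apply]
  simp; ring

/-- One-sided, normalised form of Fefferman's inequality. -/
lemma neg_circleAverage_re_mul_conj_le {f g : ℂ → ℂ} (hf : DiffContOnCl ℂ f (Metric.ball 0 1))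
    (hg : DiffContOnCl ℂ g (Metric.ball 0 1))
    (hB : ∀ a ∈ Metric.ball (0:ℂ) 1,
      circleAverage (fun z => ‖g (discAut a z) - g a‖ ^ 2) 0 1 ≤ 1) :
    -circleAverage (fun z => (f z * (starRingEnd ℂ) (g z)).re) 0 1 ≤
      ‖f 0‖ * ‖g 0‖ + 12 * circleAverage (fun z => ‖f z‖) 0 1 := by
  refine le_of_forall_pos_le_add fun η hη => ?_
  set δ := η / 12 with hδdef
  have hδ : 0 < δ := by positivity
  have hgs : ContinuousOn (fun z => ‖g z‖ ^ 2) (Metric.sphere 0 1) :=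
    hg.continuousOn_sphere.norm.pow 2
  obtain ⟨Q, hQ⟩ := exists_polynomial_re_near hgs one_pos
  have hQd := Q.diffContOnCl_eval (Metric.ball 0 1)
  set φ : ℂ → ℝ := fun z => ‖g z‖ ^ 2 + (-Q.eval z).re with hφ
  have hφc : ContinuousOn φ (Metric.closedBall 0 1) :=
    (hg.continuousOn_closedBall.norm.pow 2).add
      (Complex.continuous_re.comp_continuousOn hQd.neg.continuousOn_closedBall)
  have hφlow : ∀ a ∈ Metric.ball (0:ℂ) 1, -2 ≤ φ a := fun a ha => by
    have ha' : ‖a‖ < 1 := by simpa using ha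
    have hga := diffContOnCl_comp_discAut ha' hg
    have h1 := circleAverage_re_of_diffContOnCl (diffContOnCl_comp_discAut ha' hQd)
      zero_le_one le_rfl
    have h2 := circleAverage_norm_sq_eq hga
    have h3 := hB a ha
    have h4 := circleAverage_le_add_of_sphere (u := fun z => (Q.eval (discAut a z)).re)
      (v := fun z => ‖g (discAut a z)‖ ^ 2) (ε := 1)
      (Complex.continuous_re.comp_continuousOn
        (diffContOnCl_comp_discAut ha' hQd).continuousOn_sphere)
      (hga.continuousOn_sphere.norm.pow 2) fun z hz => by
        have := abs_le.1 (hQ (discAut a z)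
          (by simpa using norm_discAut_eq ha' (by simpa using hz)))
        linarith
    simp only [discAut_zero] at h1 h2
    simp only [hφ, Complex.neg_re]
    linarith
  set v := logReg f δ with hv
  have hvc := continuousOn_logReg hδ hf.continuousOn_closedBall
  set T : ℂ → ℝ := fun z => Real.exp 1 * (Real.exp (v z) + Real.exp (φ z + v z)) +
    (f z * (starRingEnd ℂ) (g z)).re with hT
  have hVc : ContinuousOn (fun z => Real.exp 1 * (Real.exp (v z) + Real.exp (φ z + v z)))
      (Metric.closedBall 0 1) := (hvc.rexp.add (hφc.add hvc).rexp).const_mul _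
  have hRc : ContinuousOn (fun z => (f z * (starRingEnd ℂ) (g z)).re) (Metric.closedBall 0 1) :=
    Complex.continuous_re.comp_continuousOn (hf.continuousOn_closedBall.mul
      (Complex.continuous_conj.comp_continuousOn hg.continuousOn_closedBall))
  have hTs : IsSubharm T := by
    refine ⟨hVc.add hRc, fun z hz => ?_⟩
    obtain ⟨p₁, p₂, l, h, hl, hle⟩ :=
      hasLap_logReg hδ Metric.isOpen_ball hf.differentiableOn hz
    obtain ⟨r₁, r₂, -, hgn⟩ := HasLap.norm_sq Metric.isOpen_ball hg.differentiableOn hz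
    have hQl := HasLap.re Metric.isOpen_ball hQd.neg.differentiableOn hz
    obtain ⟨s₁, s₂, hre⟩ := HasLap.re_mul_conj Metric.isOpen_ball hf.differentiableOn
      hg.differentiableOn hz
    refine ⟨_, _, _, ((h.exp.add ((hgn.add hQl).add h).exp).const_mul (Real.exp 1)).add hre, ?_⟩
    have hre4 : -(‖deriv f z‖ * ‖deriv g z‖) ≤ (deriv f z * (starRingEnd ℂ) (deriv g z)).re := by
      have := (abs_le.1 (Complex.abs_re_le_norm (deriv f z * (starRingEnd ℂ) (deriv g z)))).1
      rwa [norm_mul, RCLike.norm_conj] at this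
    have hE := Real.exp_pos (v z)
    have e1 : ‖deriv f z‖ ^ 2 / Real.exp (v z) ≤
        Real.exp (v z) * (l + (p₁ ^ 2 + p₂ ^ 2)) := by
      rw [div_le_iff₀ hE]; linarith
    have e2 : Real.exp (-2) * Real.exp (v z) ≤ Real.exp (φ z + v z) := by
      rw [← Real.exp_add]; gcongr; exact hφlow z hz
    have hx : Real.exp (-2) = Real.exp (-1) ^ 2 := by rw [← Real.exp_nat_mul]; norm_num
    have hx1 : Real.exp 1 * Real.exp (-1) = 1 := by rw [← Real.exp_add]; simp
    have e3 : 4 * Real.exp (-1) * (‖deriv f z‖ * ‖deriv g z‖) ≤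
        ‖deriv f z‖ ^ 2 / Real.exp (v z) + Real.exp (-2) * Real.exp (v z) *
          (4 * ‖deriv g z‖ ^ 2) := by
      have : ‖deriv f z‖ ^ 2 / Real.exp (v z) + Real.exp (-2) * Real.exp (v z) *
          (4 * ‖deriv g z‖ ^ 2) - 4 * Real.exp (-1) * (‖deriv f z‖ * ‖deriv g z‖) =
          (‖deriv f z‖ - 2 * Real.exp (-1) * Real.exp (v z) * ‖deriv g z‖) ^ 2 /
            Real.exp (v z) := by
        rw [hx]; field_simp; ring
      have h0 : 0 ≤ (‖deriv f z‖ - 2 * Real.exp (-1) * Real.exp (v z) * ‖deriv g z‖) ^ 2 /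
            Real.exp (v z) := by positivity
      linarith
    have e4 : Real.exp (-2) * Real.exp (v z) * (4 * ‖deriv g z‖ ^ 2) ≤
        Real.exp (φ z + v z) * (4 * ‖deriv g z‖ ^ 2) := by gcongr
    have e5 := mul_le_mul_of_nonneg_left (e3.trans (add_le_add e1 e4)) (Real.exp_pos 1).le
    have e6 : Real.exp 1 * (4 * Real.exp (-1) * (‖deriv f z‖ * ‖deriv g z‖)) =
        4 * (‖deriv f z‖ * ‖deriv g z‖) := by
      linear_combination 4 * (‖deriv f z‖ * ‖deriv g z‖) * hx1
    rw [e6] at e5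
    refine le_trans (b := Real.exp 1 * (Real.exp (v z) * (l + (p₁ ^ 2 + p₂ ^ 2)) +
      Real.exp (φ z + v z) * (4 * ‖deriv g z‖ ^ 2)) + 4 *
        (deriv f z * (starRingEnd ℂ) (deriv g z)).re) (by linarith) ?_
    have : ∀ x y : ℝ, 4 * ‖deriv g z‖ ^ 2 ≤ 4 * ‖deriv g z‖ ^ 2 + 0 + l + (x ^ 2 + y ^ 2) :=
      fun x y => by nlinarith [sq_nonneg x, sq_nonneg y]
    exact add_le_add_left (mul_le_mul_of_nonneg_left (add_le_add_right
      (mul_le_mul_of_nonneg_left (this _ _) (Real.exp_pos _).le) _) (Real.exp_pos 1).le) _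
  have hmean := hTs.circleAverage_le le_rfl zero_le_one
  simp only [Real.circleAverage_zero] at hmean
  have hsub := Metric.sphere_subset_closedBall (x := (0:ℂ)) (ε := 1)
  rw [hT, Real.circleAverage_fun_add (circleIntegrable_of_sphere (hVc.mono hsub))
    (circleIntegrable_of_sphere (hRc.mono hsub))] at hmean
  have hub : circleAverage (fun z => Real.exp 1 * (Real.exp (v z) + Real.exp (φ z + v z))) 0 1 ≤
      circleAverage (fun z => 12 * ‖f z‖) 0 1 + η := by
    refine circleAverage_le_add_of_sphere (hVc.mono hsub)
      (hf.continuousOn_sphere.norm.const_mul _) fun z hz => ?_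
    have h1 : φ z ≤ 1 := by
      have := abs_le.1 (hQ z hz)
      simp only [hφ, Complex.neg_re]; linarith
    have h2 : Real.exp (φ z + v z) ≤ Real.exp 1 * Real.exp (v z) := by
      rw [← Real.exp_add]; gcongr
    have h3 := exp_logReg_le (f := f) hδ z
    have h4 : Real.exp 1 * (1 + Real.exp 1) ≤ 12 := by
      have := Real.exp_one_lt_d9
      nlinarith [Real.exp_pos 1]
    calc Real.exp 1 * (Real.exp (v z) + Real.exp (φ z + v z))
        ≤ Real.exp 1 * (Real.exp (v z) + Real.exp 1 * Real.exp (v z)) := by gcongr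
      _ = Real.exp 1 * (1 + Real.exp 1) * Real.exp (v z) := by ring
      _ ≤ 12 * (‖f z‖ + δ) := by gcongr
      _ = 12 * ‖f z‖ + η := by rw [hδdef]; ring
  have hc : circleAverage (fun z => 12 * ‖f z‖) 0 1 = 12 * circleAverage (fun z => ‖f z‖) 0 1 := by
    simpa using Real.circleAverage_fun_smul (a := (12:ℝ)) (f := fun z => ‖f z‖) (c := 0) (R := 1)
  have h0 : -(f 0 * (starRingEnd ℂ) (g 0)).re ≤ ‖f 0‖ * ‖g 0‖ := by
    have := (abs_le.1 (Complex.abs_re_le_norm (f 0 * (starRingEnd ℂ) (g 0)))).1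
    rw [norm_mul, RCLike.norm_conj] at this
    linarith
  have hV0 : 0 ≤ Real.exp 1 * (Real.exp (v 0) + Real.exp (φ 0 + v 0)) := by positivity
  simp only at hmean
  linarith

lemma exists_norm_eq_one_mul (w : ℂ) : ∃ τ : ℂ, ‖τ‖ = 1 ∧ τ * w = (-‖w‖ : ℝ) := by
  rcases eq_or_ne w 0 with rfl | h
  · exact ⟨1, by simp, by simp⟩
  · refine ⟨-‖w‖ / w, by simp [h], ?_⟩
    field_simp
    simp

lemma norm_circleAverage_mul_conj_le_of_one {f g : ℂ → ℂ}
    (hf : DiffContOnCl ℂ f (Metric.ball 0 1)) (hg : DiffContOnCl ℂ g (Metric.ball 0 1))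
    (hB : ∀ a ∈ Metric.ball (0:ℂ) 1,
      circleAverage (fun z => ‖g (discAut a z) - g a‖ ^ 2) 0 1 ≤ 1) :
    ‖circleAverage (fun z => f z * (starRingEnd ℂ) (g z)) 0 1‖ ≤
      (‖g 0‖ + 12) * circleAverage (fun z => ‖f z‖) 0 1 := by
  obtain ⟨τ, hτ, h⟩ := exists_norm_eq_one_mul
    (circleAverage (fun z => f z * (starRingEnd ℂ) (g z)) 0 1)
  have hI : ContinuousOn (fun z => f z * (starRingEnd ℂ) (g z)) (Metric.sphere 0 1) :=
    hf.continuousOn_sphere.mul (Complex.continuous_conj.comp_continuousOn hg.continuousOn_sphere)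
  have h1 := neg_circleAverage_re_mul_conj_le (hf.const_smul τ) hg hB
  simp only [Pi.smul_apply, smul_eq_mul, norm_mul, hτ, one_mul] at h1
  have h2 := circleAverage_re (F := fun z => τ * f z * (starRingEnd ℂ) (g z)) (R := 1)
    (circleIntegrable_of_sphere (by simpa [mul_assoc, Pi.smul_def] using hI.const_smul τ))
  rw [h2] at h1
  have h3 : circleAverage (fun z => τ * f z * (starRingEnd ℂ) (g z)) 0 1 =
      τ * circleAverage (fun z => f z * (starRingEnd ℂ) (g z)) 0 1 := by
    simpa [mul_assoc] using Real.circleAverage_fun_smul (a := τ)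
      (f := fun z => f z * (starRingEnd ℂ) (g z)) (c := 0) (R := 1)
  rw [h3, h, Complex.ofReal_re, neg_neg] at h1
  have := mul_le_mul_of_nonneg_right (norm_zero_le_circleAverage hf) (norm_nonneg (g 0))
  linarith

/-- Fefferman's inequality for functions continuous up to the boundary. -/
lemma norm_circleAverage_mul_conj_le {f g : ℂ → ℂ}
    (hf : DiffContOnCl ℂ f (Metric.ball 0 1)) (hg : DiffContOnCl ℂ g (Metric.ball 0 1)) {B : ℝ}
    (hB0 : 0 ≤ B) (hB : ∀ a ∈ Metric.ball (0:ℂ) 1,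
      circleAverage (fun z => ‖g (discAut a z) - g a‖ ^ 2) 0 1 ≤ B ^ 2) :
    ‖circleAverage (fun z => f z * (starRingEnd ℂ) (g z)) 0 1‖ ≤
      (‖g 0‖ + 12 * B) * circleAverage (fun z => ‖f z‖) 0 1 := by
  set A := circleAverage (fun z => ‖f z‖) 0 1 with hAdef
  set X := circleAverage (fun z => f z * (starRingEnd ℂ) (g z)) 0 1 with hX
  have hA : 0 ≤ A := (norm_nonneg _).trans (norm_zero_le_circleAverage hf)
  have key : ∀ K > B, ‖X‖ ≤ (‖g 0‖ + 12 * K) * A := fun K hK => by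
    have hK0 : 0 < K := hB0.trans_lt hK
    have h := norm_circleAverage_mul_conj_le_of_one hf (hg.const_smul ((K⁻¹ : ℝ) : ℂ))
      fun a ha => by
        have e : (fun z => ‖(((K⁻¹ : ℝ) : ℂ) • g) (discAut a z) - (((K⁻¹ : ℝ) : ℂ) • g) a‖ ^ 2) =
            fun z => (K⁻¹ ^ 2) • ‖g (discAut a z) - g a‖ ^ 2 := by
          ext z
          simp only [Pi.smul_apply, smul_eq_mul, ← mul_sub, norm_mul, Complex.norm_real, mul_pow,
            Real.norm_eq_abs, sq_abs]
        rw [e, Real.circleAverage_fun_smul, smul_eq_mul, inv_pow, inv_mul_le_iff₀ (by positivity)]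
        have := hB a ha
        nlinarith
    have e2 : circleAverage (fun z => f z * (starRingEnd ℂ) ((((K⁻¹ : ℝ) : ℂ) • g) z)) 0 1 =
        ((K⁻¹ : ℝ) : ℂ) * X := by
      rw [hX, ← smul_eq_mul, ← Real.circleAverage_fun_smul]
      congr 1; ext z
      simp [mul_left_comm]
    rw [e2] at h
    simp only [Pi.smul_apply, smul_eq_mul, norm_mul, Complex.norm_real, norm_inv,
      Real.norm_of_nonneg hK0.le] at h
    rw [inv_mul_le_iff₀ hK0] at h
    rw [← hAdef] at h
    refine h.trans_eq ?_
    field_simp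
  refine le_of_forall_pos_le_add fun η hη => ?_
  have h := key (B + η / (12 * (A + 1))) (by have : 0 < η / (12 * (A + 1)) := by positivity
                                             linarith)
  have e : 12 * (η / (12 * (A + 1))) * A ≤ η := by
    have : 12 * (η / (12 * (A + 1))) * A = η * (A / (A + 1)) := by field_simp
    rw [this]
    have : A / (A + 1) ≤ 1 := by rw [div_le_one (by positivity)]; linarith
    nlinarith
  linarith

section Fejer

open AddCircle

variable {T : ℝ}

/-- The unnormalised Fejér kernel. -/
def fejer (n : ℕ) (x : AddCircle T) : ℝ := ‖∑ j ∈ Finset.range (n + 1), fourier (j : ℤ) x‖ ^ 2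

lemma continuous_fejer (n : ℕ) : Continuous (fejer n : AddCircle T → ℝ) := by
  unfold fejer
  fun_prop

lemma fejer_nonneg (n : ℕ) (x : AddCircle T) : 0 ≤ fejer n x := by unfold fejer; positivity

lemma ofReal_fejer (n : ℕ) (x : AddCircle T) :
    (fejer n x : ℂ) = ∑ j ∈ Finset.range (n + 1), ∑ l ∈ Finset.range (n + 1),
      fourier ((j : ℤ) + -l) x := by
  rw [fejer, Complex.ofReal_pow, ← Complex.mul_conj', map_sum, Finset.sum_mul_sum]
  simp_rw [fourier_add, fourier_neg]

variable {c : ℕ → ℂ}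

lemma continuous_tsum_fourier (hc : Summable fun k => ‖c k‖) :
    Continuous fun x : AddCircle T => ∑' k : ℕ, c k * fourier (k : ℤ) x :=
  continuous_tsum (fun k => by fun_prop) hc fun k x => by simp [Circle.norm_coe]

variable [hT : Fact (0 < T)]

lemma Continuous.integrable_haarAddCircle {E : Type*} [NormedAddCommGroup E]
    {u : AddCircle T → E} (hu : Continuous u) : Integrable u haarAddCircle :=
  hu.integrable_of_hasCompactSupport (HasCompactSupport.of_compactSpace u)

lemma integral_fourier (n : ℤ) :
    ∫ x : AddCircle T, fourier n x ∂haarAddCircle = if n = 0 then 1 else 0 := by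
  split_ifs with h
  · subst h
    simp_rw [fourier_zero]
    simp
  · have h1 := integral_add_right_eq_self (μ := (haarAddCircle : Measure (AddCircle T)))
      (fun x => fourier n x) ((T / 2 / n : ℝ) : AddCircle T)
    simp_rw [fourier_add_half_inv_index h hT.out] at h1
    rw [integral_neg] at h1
    exact self_eq_neg.1 h1.symm

lemma integral_fourier_neg_mul_fejer (n k : ℕ) :
    ∫ x : AddCircle T, fourier (-(k:ℤ)) x * (fejer n x : ℂ) ∂haarAddCircle =
      ((n + 1 - k : ℕ) : ℂ) := by
  simp_rw [ofReal_fejer, Finset.mul_sum, ← fourier_add]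
  rw [integral_finsetSum _ fun j _ =>
    (continuous_finsetSum _ fun l _ => (fourier _).continuous).integrable_haarAddCircle]
  simp_rw [integral_finsetSum (Finset.range (n + 1)) fun l _ =>
    (fourier _).continuous.integrable_haarAddCircle, integral_fourier]
  rw [Finset.sum_comm]
  have : ∀ l ∈ Finset.range (n + 1), (∑ j ∈ Finset.range (n + 1),
      if -(k:ℤ) + ((j:ℤ) + -l) = 0 then (1:ℂ) else 0) =
        if l ∈ Finset.range (n + 1 - k) then 1 else 0 := fun l hl => by
    have h2 : ∀ j : ℕ, (-(k:ℤ) + ((j:ℤ) + -l) = 0) ↔ j = k + l := fun j => by omega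
    simp_rw [h2, Finset.sum_ite_eq', Finset.mem_range]
    congr 1
    exact propext (by omega)
  rw [Finset.sum_congr rfl this, Finset.sum_ite_mem, Finset.inter_eq_right.2
    (Finset.range_subset_range.2 (by omega))]
  simp

lemma integral_fejer (n : ℕ) :
    ∫ x : AddCircle T, fejer n x ∂haarAddCircle = n + 1 := by
  have h := integral_fourier_neg_mul_fejer (T := T) n 0
  simp only [Nat.cast_zero, neg_zero, fourier_zero, one_mul] at h
  rw [integral_complex_ofReal] at h
  simpa using congrArg Complex.re h

lemma tsum_fejer (hc : Summable fun k => ‖c k‖) (n : ℕ) (x : AddCircle T) :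
    ∑' k : ℕ, ((n + 1 - k : ℕ) : ℂ) * c k * fourier (k : ℤ) x =
      ∫ t : AddCircle T, (∑' k : ℕ, c k * fourier (k : ℤ) (x - t)) * (fejer n t : ℂ)
        ∂haarAddCircle := by
  have e : ∀ t : AddCircle T, (∑' k : ℕ, c k * fourier (k : ℤ) (x - t)) * (fejer n t : ℂ) =
      ∑' k : ℕ, c k * fourier (k : ℤ) x * (fourier (-(k:ℤ)) t * (fejer n t : ℂ)) := fun t => by
    rw [← tsum_mul_right]
    refine tsum_congr fun k => ?_
    have : (fourier (k:ℤ) (x - t) : ℂ) = fourier (k:ℤ) x * fourier (-(k:ℤ)) t := by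
      rw [fourier_apply, fourier_apply, fourier_apply, zsmul_sub, sub_eq_add_neg, toCircle_add,
        Circle.coe_mul, neg_smul]
    rw [this]; ring
  simp_rw [e]
  rw [← integral_tsum_of_summable_integral_norm]
  · refine tsum_congr fun k => ?_
    rw [integral_const_mul, integral_fourier_neg_mul_fejer]
    ring
  · intro k
    have := continuous_fejer (T := T) n
    exact Continuous.integrable_haarAddCircle (by fun_prop)
  · have : ∀ (k : ℕ) (t : AddCircle T),
        ‖c k * fourier (k : ℤ) x * (fourier (-(k:ℤ)) t * (fejer n t : ℂ))‖ =
        ‖c k‖ * fejer n t := fun k t => by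
      simp [Circle.norm_coe, abs_of_nonneg (fejer_nonneg n t)]
    simp_rw [this, integral_const_mul]
    exact hc.mul_right _

lemma integral_norm_tsum_fejer_le (hc : Summable fun k => ‖c k‖) (n : ℕ) :
    ∫ x : AddCircle T, ‖∑' k : ℕ, ((n + 1 - k : ℕ) : ℂ) * c k * fourier (k : ℤ) x‖
      ∂haarAddCircle ≤
      (n + 1) * ∫ x : AddCircle T, ‖∑' k : ℕ, c k * fourier (k : ℤ) x‖ ∂haarAddCircle := by
  set F : AddCircle T → ℂ := fun x => ∑' k : ℕ, c k * fourier (k : ℤ) x with hF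
  have hFc : Continuous F := continuous_tsum_fourier hc
  have hK := continuous_fejer (T := T) n
  have hc2 : Continuous (Function.uncurry fun x t : AddCircle T => ‖F (x - t)‖ * fejer n t) := by
    unfold Function.uncurry; fun_prop
  have hI : Integrable (Function.uncurry fun x t : AddCircle T => ‖F (x - t)‖ * fejer n t)
      ((haarAddCircle : Measure (AddCircle T)).prod haarAddCircle) :=
    hc2.integrable_of_hasCompactSupport (HasCompactSupport.of_compactSpace _)
  have hle : ∀ x : AddCircle T, ‖∑' k : ℕ, ((n + 1 - k : ℕ) : ℂ) * c k * fourier (k : ℤ) x‖ ≤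
      ∫ t : AddCircle T, ‖F (x - t)‖ * fejer n t ∂haarAddCircle := fun x => by
    rw [tsum_fejer hc]
    refine (norm_integral_le_integral_norm _).trans_eq ?_
    simp [abs_of_nonneg (fejer_nonneg n _), hF]
  refine (integral_mono_of_nonneg (Eventually.of_forall fun x => norm_nonneg _)
    hI.integral_prod_left (Eventually.of_forall hle)).trans_eq ?_
  simp only [Function.uncurry_apply_pair]
  rw [integral_integral_swap hI]
  simp_rw [integral_mul_const]
  have : ∀ t : AddCircle T, ∫ x, ‖F (x - t)‖ ∂haarAddCircle = ∫ x, ‖F x‖ ∂haarAddCircle :=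
    fun t => integral_sub_right_eq_self (fun x => ‖F x‖) t
  simp_rw [this]
  rw [integral_const_mul, integral_fejer, mul_comm]

/-- Multipliers with summable weighted second differences are bounded in the `L¹` norm. -/
lemma integral_norm_tsum_multiplier_le (hc : Summable fun k => ‖c k‖) {a s : ℕ → ℝ}
    (hs : Summable fun n : ℕ => (n + 1 : ℝ) * |s n|)
    (ha : ∀ k : ℕ, HasSum (fun n : ℕ => ((n + 1 - k : ℕ) : ℝ) * s n) (a k)) :
    ∫ x : AddCircle T, ‖∑' k : ℕ, (a k : ℂ) * c k * fourier (k : ℤ) x‖ ∂haarAddCircle ≤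
      (∑' n : ℕ, (n + 1 : ℝ) * |s n|) *
        ∫ x : AddCircle T, ‖∑' k : ℕ, c k * fourier (k : ℤ) x‖ ∂haarAddCircle := by
  set A := ∫ x : AddCircle T, ‖∑' k : ℕ, c k * fourier (k : ℤ) x‖ ∂haarAddCircle
  set G : ℕ → AddCircle T → ℂ := fun n x =>
    ∑' k : ℕ, ((n + 1 - k : ℕ) : ℂ) * c k * fourier (k : ℤ) x with hG
  have hsub : ∀ n k : ℕ, ((n + 1 - k : ℕ) : ℝ) ≤ n + 1 := fun n k => by
    exact_mod_cast Nat.sub_le (n + 1) k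
  have hcn : ∀ n : ℕ, Summable fun k => ‖((n + 1 - k : ℕ) : ℂ) * c k‖ := fun n =>
    Summable.of_nonneg_of_le (fun _ => norm_nonneg _) (fun k => by
      rw [norm_mul, Complex.norm_natCast]
      exact mul_le_mul_of_nonneg_right (hsub n k) (norm_nonneg _)) (hc.mul_left ((n:ℝ) + 1))
  have hGc : ∀ n, Continuous (G n) := fun n => continuous_tsum_fourier (hcn n)
  have hGi : ∀ n, Integrable (fun x => ‖(s n : ℂ) * G n x‖) haarAddCircle := fun n => by
    have := hGc n
    exact Continuous.integrable_haarAddCircle (by fun_prop)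
  have hint : ∀ n, ∫ x : AddCircle T, ‖(s n : ℂ) * G n x‖ ∂haarAddCircle ≤
      (n + 1 : ℝ) * |s n| * A := fun n => by
    simp_rw [norm_mul, Complex.norm_real, Real.norm_eq_abs, integral_const_mul]
    have := mul_le_mul_of_nonneg_left (integral_norm_tsum_fejer_le (T := T) hc n) (abs_nonneg (s n))
    linarith
  have hsum : Summable fun n => ∫ x : AddCircle T, ‖(s n : ℂ) * G n x‖ ∂haarAddCircle :=
    Summable.of_nonneg_of_le (fun n => integral_nonneg fun x => norm_nonneg _) hint
      (hs.mul_right A)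
  have hprod : ∀ x : AddCircle T, Summable (Function.uncurry fun n k : ℕ =>
      (s n : ℂ) * (((n + 1 - k : ℕ) : ℂ) * c k * fourier (k : ℤ) x)) := fun x => by
    refine Summable.of_norm_bounded (hs.mul_of_nonneg hc (fun n => by positivity)
      (fun k => norm_nonneg _)) fun p => ?_
    simp only [Function.uncurry, norm_mul, Complex.norm_real, Complex.norm_natCast,
      Real.norm_eq_abs, fourier_apply, Circle.norm_coe, mul_one]
    have := mul_le_mul_of_nonneg_right (hsub p.1 p.2)
      (mul_nonneg (abs_nonneg (s p.1)) (norm_nonneg (c p.2)))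
    linarith
  have hid : ∀ x : AddCircle T, ∑' k : ℕ, (a k : ℂ) * c k * fourier (k : ℤ) x =
      ∑' n, (s n : ℂ) * G n x := fun x => by
    simp_rw [hG, ← tsum_mul_left]
    rw [← (hprod x).tsum_comm]
    refine tsum_congr fun k => ?_
    rw [← (ha k).tsum_eq, Complex.ofReal_tsum, mul_assoc, ← tsum_mul_right]
    refine tsum_congr fun n => ?_
    push_cast; ring
  have hGb : ∀ (n : ℕ) (x : AddCircle T),
      ‖(s n : ℂ) * G n x‖ ≤ (n + 1 : ℝ) * |s n| * ∑' k, ‖c k‖ := fun n x => by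
    have h1 : ‖G n x‖ ≤ ∑' k, (n + 1 : ℝ) * ‖c k‖ := by
      refine tsum_of_norm_bounded (hc.mul_left ((n:ℝ) + 1)).hasSum fun k => ?_
      simp only [norm_mul, Complex.norm_natCast, fourier_apply, Circle.norm_coe, mul_one]
      exact mul_le_mul_of_nonneg_right (hsub n k) (norm_nonneg _)
    rw [tsum_mul_left] at h1
    rw [norm_mul, Complex.norm_real, Real.norm_eq_abs]
    have := mul_le_mul_of_nonneg_left h1 (abs_nonneg (s n))
    linarith
  have hnorm : ∀ x : AddCircle T, Summable fun n => ‖(s n : ℂ) * G n x‖ := fun x =>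
    Summable.of_nonneg_of_le (fun _ => norm_nonneg _) (fun n => hGb n x) (hs.mul_right _)
  simp_rw [hid]
  have hh := hasSum_integral_of_summable_integral_norm (F := fun n (x : AddCircle T) =>
    ‖(s n : ℂ) * G n x‖) (μ := haarAddCircle) hGi (by simpa using hsum)
  have hti : Integrable (fun x : AddCircle T => ∑' n, ‖(s n : ℂ) * G n x‖) haarAddCircle := by
    refine Continuous.integrable_haarAddCircle
      (continuous_tsum (u := fun n : ℕ => (n + 1 : ℝ) * |s n| * ∑' k, ‖c k‖)
        (fun n => by have := hGc n; fun_prop) (hs.mul_right _) fun n x => ?_)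
    rw [norm_norm]
    exact hGb n x
  calc ∫ x : AddCircle T, ‖∑' n, (s n : ℂ) * G n x‖ ∂haarAddCircle
      ≤ ∫ x : AddCircle T, ∑' n, ‖(s n : ℂ) * G n x‖ ∂haarAddCircle :=
        integral_mono_of_nonneg (Eventually.of_forall fun x => norm_nonneg _) hti
          (Eventually.of_forall fun x => norm_tsum_le_tsum_norm (hnorm x))
    _ = ∑' n, ∫ x : AddCircle T, ‖(s n : ℂ) * G n x‖ ∂haarAddCircle := hh.tsum_eq.symm
    _ ≤ ∑' n : ℕ, (n + 1 : ℝ) * |s n| * A :=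
        Summable.tsum_le_tsum hint hsum (hs.mul_right A)
    _ = _ := tsum_mul_right

end Fejer

lemma circleAverage_eq_integral_haarAddCircle {E : Type*} [NormedAddCommGroup E]
    [NormedSpace ℝ E] [Fact (0 < 2 * Real.pi)] (u : ℂ → E) :
    circleAverage u 0 1 =
      ∫ x : AddCircle (2 * Real.pi), u (AddCircle.toCircle x) ∂AddCircle.haarAddCircle := by
  rw [AddCircle.integral_haarAddCircle,
    ← AddCircle.intervalIntegral_preimage (2 * Real.pi) 0, zero_add, Real.circleAverage]
  congr 1
  refine intervalIntegral.integral_congr fun θ _ => ?_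
  simp only [circleMap, AddCircle.toCircle_apply_mk, Circle.coe_exp]
  congr 1
  have : (2 * Real.pi) ≠ 0 := by positivity
  rw [div_self this]
  simp

lemma circleAverage_norm_multiplier_le {c : ℕ → ℂ} (hc : Summable fun k => ‖c k‖) {a s : ℕ → ℝ}
    (hs : Summable fun n : ℕ => (n + 1 : ℝ) * |s n|)
    (ha : ∀ k : ℕ, HasSum (fun n : ℕ => ((n + 1 - k : ℕ) : ℝ) * s n) (a k)) :
    circleAverage (fun z => ‖∑' k : ℕ, (a k : ℂ) * c k * z ^ k‖) 0 1 ≤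
      (∑' n : ℕ, (n + 1 : ℝ) * |s n|) * circleAverage (fun z => ‖∑' k : ℕ, c k * z ^ k‖) 0 1 := by
  have : Fact (0 < 2 * Real.pi) := ⟨by positivity⟩
  have h := integral_norm_tsum_multiplier_le (T := 2 * Real.pi) hc hs ha
  have e : ∀ (x : AddCircle (2 * Real.pi)) (k : ℕ),
      (fourier (k : ℤ) x : ℂ) = (AddCircle.toCircle x : ℂ) ^ k := fun x k => by
    rw [fourier_apply, AddCircle.toCircle_zsmul]; simp
  simp_rw [e] at h
  simpa only [circleAverage_eq_integral_haarAddCircle] using h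

lemma sum_range_mul_pow_le {y : ℝ} (h0 : 0 ≤ y) (h1 : y ≤ 1) (N : ℕ) :
    (1 - y) ^ 2 * ∑ k ∈ Finset.range N, (k + 1 : ℝ) * y ^ k ≤ 1 := by
  have : (1 - y) ^ 2 * ∑ k ∈ Finset.range N, (k + 1 : ℝ) * y ^ k =
      1 - y ^ N * ((N + 1) - N * y) := by
    induction N with
    | zero => simp
    | succ N ih => rw [Finset.sum_range_succ, mul_add, ih]; push_cast; ring
  rw [this]
  have h2 : (N:ℝ) * y ≤ N := mul_le_of_le_one_right (by positivity) h1
  have : 0 ≤ y ^ N * ((N + 1) - N * y) := mul_nonneg (by positivity) (by linarith)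
  linarith

lemma sum_range_pow_le {y : ℝ} (h0 : 0 ≤ y) (N : ℕ) :
    (1 - y) * ∑ k ∈ Finset.range N, y ^ k ≤ 1 := by
  rw [mul_neg_geom_sum]
  have := pow_nonneg h0 N
  linarith

/-- The second difference of a sequence. -/
def diff2 (a : ℕ → ℝ) (n : ℕ) : ℝ := a (n + 2) - 2 * a (n + 1) + a n

lemma hasSum_diff2 {a : ℕ → ℝ} {K y : ℝ} (hy0 : 0 ≤ y) (hy1 : y < 1)
    (ha : ∀ k, |a k| ≤ K * y ^ k) (hs : Summable fun n : ℕ => (n + 1 : ℝ) * |diff2 a n|) (k : ℕ) :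
    HasSum (fun n : ℕ => ((n + 1 - k : ℕ) : ℝ) * diff2 a n) (a k) := by
  have hsum : Summable fun n : ℕ => ((n + 1 - k : ℕ) : ℝ) * diff2 a n := by
    refine Summable.of_norm_bounded hs fun n => ?_
    rw [norm_mul, Real.norm_natCast, Real.norm_eq_abs]
    gcongr
    exact_mod_cast Nat.sub_le (n + 1) k
  have hpart : ∀ N : ℕ, ∑ n ∈ Finset.range (N + k), ((n + 1 - k : ℕ) : ℝ) * diff2 a n =
      a k - a (N + k) - N * a (N + k) + N * a (N + k + 1) := fun N => by
    induction N with
    | zero =>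
      rw [zero_add, Finset.sum_eq_zero]
      · simp
      · intro n hn
        rw [Finset.mem_range] at hn
        rw [Nat.sub_eq_zero_of_le (by omega)]; simp
    | succ N ih =>
      rw [show N + 1 + k = N + k + 1 by ring, Finset.sum_range_succ, ih,
        show N + k + 1 - k = N + 1 by omega, diff2]
      push_cast; ring
  have h1 : Tendsto (fun N : ℕ => K * y ^ k * y ^ N) atTop (𝓝 0) := by
    simpa using (tendsto_pow_atTop_nhds_zero_of_lt_one hy0 hy1).const_mul (K * y ^ k)
  have h2 : Tendsto (fun N : ℕ => K * y ^ k * (N * y ^ N)) atTop (𝓝 0) := by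
    simpa using (tendsto_self_mul_const_pow_of_lt_one hy0 hy1).const_mul (K * y ^ k)
  have t1 : Tendsto (fun N : ℕ => a (N + k)) atTop (𝓝 0) := by
    refine squeeze_zero_norm (fun N => ?_) h1
    rw [Real.norm_eq_abs]
    refine (ha _).trans_eq ?_
    rw [pow_add]; ring
  have t2 : Tendsto (fun N : ℕ => (N:ℝ) * a (N + k)) atTop (𝓝 0) := by
    refine squeeze_zero_norm (fun N => ?_) h2
    rw [norm_mul, Real.norm_natCast, Real.norm_eq_abs]
    refine (mul_le_mul_of_nonneg_left (ha _) (by positivity)).trans_eq ?_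
    rw [pow_add]; ring
  have t3 : Tendsto (fun N : ℕ => (N:ℝ) * a (N + k + 1)) atTop (𝓝 0) := by
    refine squeeze_zero_norm (fun N => ?_) (by simpa using h2.const_mul y)
    rw [norm_mul, Real.norm_natCast, Real.norm_eq_abs]
    refine (mul_le_mul_of_nonneg_left (ha _) (by positivity)).trans_eq ?_
    rw [pow_add, pow_add]; ring
  have ht := ((tendsto_const_nhds (x := a k)).sub t1).sub t2 |>.add t3
  simp_rw [← hpart] at ht
  simp only [sub_zero, add_zero] at ht
  have ht2 := (tendsto_add_atTop_iff_nat
    (f := fun N => ∑ n ∈ Finset.range N, ((n + 1 - k : ℕ) : ℝ) * diff2 a n) k).1 ht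
  have := tendsto_nhds_unique hsum.hasSum.tendsto_sum_nat ht2
  rw [← this]
  exact hsum.hasSum

section Reciprocal

variable {m : ℕ → ℝ} {C : ℝ}

lemma sum_mul_abs_diff2_inv_le (hm : ∀ k, 0 < m k) (hmono : ∀ k, m (k + 1) ≤ m k)
    (hconv : ∀ k, m (k + 1) - m (k + 2) ≤ m k - m (k + 1))
    (hd : ∀ k : ℕ, (k + 1 : ℝ) * (m k - m (k + 1)) ≤ C * m (k + 2)) (n : ℕ) :
    ∑ k ∈ Finset.range n, (k + 1 : ℝ) * |diff2 (fun k => (m k)⁻¹) k| ≤ (4 * C + 1) * (m n)⁻¹ := by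
  set b : ℕ → ℝ := fun k => (m k)⁻¹ with hb
  have hC : 0 ≤ C := by
    by_contra! h
    have := hd 0
    have h2 := hmono 0
    simp only [Nat.cast_zero, zero_add, one_mul] at this
    nlinarith [mul_neg_of_neg_of_pos h (hm 2)]
  have hbpos : ∀ k, 0 < b k := fun k => inv_pos.2 (hm k)
  have hD : ∀ k, 0 ≤ b (k + 1) - b k := fun k =>
    sub_nonneg.2 (inv_anti₀ (hm _) (hmono k))
  have hterm : ∀ k : ℕ, (k + 1 : ℝ) * |diff2 b k| ≤
      4 * C * (b (k + 1) - b k) - (k + 1) * diff2 b k := fun k => by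
    have h0 := hm k
    have h1 := hm (k + 1)
    have h2 := hm (k + 2)
    have hd0 : 0 ≤ m k - m (k + 1) := sub_nonneg.2 (hmono k)
    have hd1 : 0 ≤ m (k + 1) - m (k + 2) := sub_nonneg.2 (hmono (k + 1))
    set R := (m k - m (k + 1)) * ((m k - m (k + 1)) + (m (k + 1) - m (k + 2))) /
      (m k * m (k + 1) * m (k + 2)) with hR
    set P := ((m k - m (k + 1)) - (m (k + 1) - m (k + 2))) / (m (k + 1) * m (k + 2)) with hP
    have hP0 : 0 ≤ P := div_nonneg (sub_nonneg.2 (hconv k)) (by positivity)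
    have hR0 : 0 ≤ R := by positivity
    have e : diff2 b k = R - P := by
      simp only [diff2, hb, hR, hP]
      field_simp
      ring
    have habs : |diff2 b k| ≤ 2 * R - diff2 b k := by
      rw [abs_le]; constructor <;> linarith
    have hRD : (k + 1 : ℝ) * R ≤ 2 * C * (b (k + 1) - b k) := by
      have e2 : b (k + 1) - b k = (m k - m (k + 1)) / (m k * m (k + 1)) := by
        simp only [hb]; field_simp
      have e3 : (k + 1 : ℝ) * R = (m k - m (k + 1)) / (m k * m (k + 1)) *
          ((k + 1) * ((m k - m (k + 1)) + (m (k + 1) - m (k + 2))) / m (k + 2)) := by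
        rw [hR]; field_simp
      rw [e2, e3, mul_comm]
      gcongr
      rw [div_le_iff₀ h2]
      have h3 : (k + 1 : ℝ) * (m (k + 1) - m (k + 2)) ≤ (k + 1) * (m k - m (k + 1)) := by
        exact mul_le_mul_of_nonneg_left (hconv k) (by positivity)
      linarith [hd k]
    have := mul_le_mul_of_nonneg_left habs (by positivity : (0:ℝ) ≤ k + 1)
    linarith
  have hsum : ∀ n : ℕ, ∑ k ∈ Finset.range n, (4 * C * (b (k + 1) - b k) - (k + 1) * diff2 b k) =
      (4 * C + 1) * (b n - b 0) - n * (b (n + 1) - b n) := fun n => by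
    induction n with
    | zero => simp
    | succ n ih => rw [Finset.sum_range_succ, ih, diff2]; push_cast; ring
  refine (Finset.sum_le_sum fun k _ => hterm k).trans ?_
  rw [hsum]
  have h1 : 0 ≤ (n:ℝ) * (b (n + 1) - b n) := mul_nonneg (by positivity) (hD n)
  have h2 : 0 ≤ (4 * C + 1) * b 0 := by have := hbpos 0; positivity
  linarith

lemma sum_pow_mul_le {E e : ℕ → ℝ} (hE0 : E 0 = 0) (hE : ∀ k, E (k + 1) = E k + e k) {x y K : ℝ}
    (hy0 : 0 ≤ y) (hy1 : y < 1) (hx : x = y ^ 2) (hK : ∀ k, y ^ k * E k ≤ K) (N : ℕ)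
    (hK0 : 0 ≤ K) :
    ∑ k ∈ Finset.range N, x ^ (k + 1) * e k ≤ 3 * K := by
  have key : ∀ N : ℕ, ∑ k ∈ Finset.range N, x ^ (k + 1) * e k =
      x ^ (N + 1) * E N + ∑ k ∈ Finset.range N, x ^ (k + 1) * (1 - x) * E (k + 1) := fun N => by
    induction N with
    | zero => simp [hE0]
    | succ N ih =>
      rw [Finset.sum_range_succ, Finset.sum_range_succ, ih, hE N]
      ring
  have hx0 : 0 ≤ x := by rw [hx]; positivity
  have hx1 : x ≤ 1 := by rw [hx]; nlinarith
  have h1 : ∀ k, x ^ k * E k ≤ y ^ k * K := fun k => by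
    have : x ^ k * E k = y ^ k * (y ^ k * E k) := by rw [hx]; ring
    rw [this]; gcongr; exact hK k
  rw [key]
  have h2 : x ^ (N + 1) * E N ≤ K := by
    have hyN : y ^ N * K ≤ K := mul_le_of_le_one_left hK0 (pow_le_one₀ hy0 hy1.le)
    calc x ^ (N + 1) * E N = x * (x ^ N * E N) := by ring
      _ ≤ x * K := by gcongr; exact (h1 N).trans hyN
      _ ≤ K := mul_le_of_le_one_left hK0 hx1
  have h3 : ∑ k ∈ Finset.range N, x ^ (k + 1) * (1 - x) * E (k + 1) ≤
      ∑ k ∈ Finset.range N, (1 - x) * (y ^ k * K) := by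
    refine Finset.sum_le_sum fun k _ => ?_
    have : x ^ (k + 1) * (1 - x) * E (k + 1) = (1 - x) * (x ^ (k + 1) * E (k + 1)) := by ring
    rw [this]
    refine mul_le_mul_of_nonneg_left ((h1 _).trans ?_) (by linarith)
    gcongr ?_ * K
    exact pow_le_pow_of_le_one hy0 hy1.le (Nat.le_succ k)
  have h4 : ∑ k ∈ Finset.range N, (1 - x) * (y ^ k * K) =
      (1 + y) * K * ((1 - y) * ∑ k ∈ Finset.range N, y ^ k) := by
    rw [← Finset.mul_sum, ← Finset.sum_mul, hx]; ring
  have h5 : (1 + y) * K * ((1 - y) * ∑ k ∈ Finset.range N, y ^ k) ≤ 2 * K * 1 := by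
    refine mul_le_mul (by nlinarith) (sum_range_pow_le hy0 N) ?_ (by positivity)
    have : 0 ≤ 1 - y := by linarith
    positivity
  linarith

/-- Weighted `ℓ¹` bound for the second differences of `x ^ k / m k`. -/
lemma sum_mul_abs_diff2_pow_mul_inv_le (hm : ∀ k, 0 < m k) (hmono : ∀ k, m (k + 1) ≤ m k)
    (hconv : ∀ k, m (k + 1) - m (k + 2) ≤ m k - m (k + 1))
    (hd : ∀ k : ℕ, (k + 1 : ℝ) * (m k - m (k + 1)) ≤ C * m (k + 2)) (hC : 0 ≤ C) {x y K : ℝ}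
    (hy0 : 0 ≤ y) (hy1 : y < 1) (hx : x = y ^ 2) (hK : ∀ k, y ^ k * (m k)⁻¹ ≤ K) (N : ℕ) :
    ∑ k ∈ Finset.range N, (k + 1 : ℝ) * |diff2 (fun k => x ^ k * (m k)⁻¹) k| ≤
      (16 * C + 7) * K := by
  set b : ℕ → ℝ := fun k => (m k)⁻¹ with hb
  have hbpos : ∀ k, 0 < b k := fun k => inv_pos.2 (hm k)
  have hK0 : 0 ≤ K := by simpa using (by simpa using (hbpos 0).le : 0 ≤ y ^ 0 * b 0).trans (hK 0)
  have hx0 : 0 ≤ x := by rw [hx]; positivity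
  have hx1 : x ≤ 1 := by rw [hx]; nlinarith
  have hD : ∀ k, 0 ≤ b (k + 1) - b k := fun k => sub_nonneg.2 (inv_anti₀ (hm _) (hmono k))
  have hkD : ∀ k : ℕ, (k + 1 : ℝ) * (b (k + 1) - b k) ≤ C * b k := fun k => by
    have h0 := hm k
    have h1 := hm (k + 1)
    have e2 : (k + 1 : ℝ) * (b (k + 1) - b k) =
        (k + 1) * (m k - m (k + 1)) / m (k + 1) * b k := by
      simp only [hb]; field_simp
    rw [e2]
    refine mul_le_mul_of_nonneg_right ?_ (hbpos k).le
    rw [div_le_iff₀ h1]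
    exact (hd k).trans (mul_le_mul_of_nonneg_left (hmono (k + 1)) hC)
  have hxb : ∀ k, x ^ k * b k ≤ y ^ k * K := fun k => by
    have : x ^ k * b k = y ^ k * (y ^ k * b k) := by rw [hx]; ring
    rw [this]; gcongr; exact hK k
  have hterm : ∀ k : ℕ, (k + 1 : ℝ) * |diff2 (fun k => x ^ k * b k) k| ≤
      x ^ (k + 1) * ((k + 1) * |diff2 b k|) + 2 * C * K * ((1 - x) * y ^ k) +
        K * ((1 - x) ^ 2 * ((k + 1) * y ^ k)) := fun k => by
    have e : diff2 (fun k => x ^ k * b k) k = x ^ (k + 2) * diff2 b k -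
        2 * x ^ (k + 1) * (1 - x) * (b (k + 1) - b k) + x ^ k * (1 - x) ^ 2 * b k := by
      simp only [diff2]; ring
    have hx1' : 0 ≤ 1 - x := by linarith
    have h2 : |2 * x ^ (k + 1) * (1 - x) * (b (k + 1) - b k)| =
        2 * x ^ (k + 1) * (1 - x) * (b (k + 1) - b k) :=
      abs_of_nonneg (by have := hD k; positivity)
    have h3 : |x ^ k * (1 - x) ^ 2 * b k| = x ^ k * (1 - x) ^ 2 * b k :=
      abs_of_nonneg (by have := (hbpos k).le; positivity)
    have h1 : |x ^ (k + 2) * diff2 b k| ≤ x ^ (k + 1) * |diff2 b k| := by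
      rw [abs_mul, abs_of_nonneg (by positivity : 0 ≤ x ^ (k + 2))]
      exact mul_le_mul_of_nonneg_right (pow_le_pow_of_le_one hx0 hx1 (by omega)) (abs_nonneg _)
    have h4 : |diff2 (fun k => x ^ k * b k) k| ≤ x ^ (k + 1) * |diff2 b k| +
        2 * x ^ (k + 1) * (1 - x) * (b (k + 1) - b k) + x ^ k * (1 - x) ^ 2 * b k := by
      rw [e]
      refine (abs_add_le _ _).trans (add_le_add ((abs_sub _ _).trans (add_le_add h1 h2.le)) h3.le)
    refine (mul_le_mul_of_nonneg_left h4 (by positivity)).trans ?_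
    have h5 : (k + 1 : ℝ) * (2 * x ^ (k + 1) * (1 - x) * (b (k + 1) - b k)) ≤
        2 * C * K * ((1 - x) * y ^ k) := by
      calc (k + 1 : ℝ) * (2 * x ^ (k + 1) * (1 - x) * (b (k + 1) - b k))
          = 2 * (1 - x) * x ^ (k + 1) * ((k + 1) * (b (k + 1) - b k)) := by ring
        _ ≤ 2 * (1 - x) * x ^ k * (C * b k) := by
            have := hD k
            refine mul_le_mul ?_ (hkD k) (by positivity) (by positivity)
            gcongr 2 * (1 - x) * ?_
            exact pow_le_pow_of_le_one hx0 hx1 (Nat.le_succ k)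
        _ = 2 * (1 - x) * C * (x ^ k * b k) := by ring
        _ ≤ 2 * (1 - x) * C * (y ^ k * K) :=
            mul_le_mul_of_nonneg_left (hxb k) (by positivity)
        _ = _ := by ring
    have h6 : (k + 1 : ℝ) * (x ^ k * (1 - x) ^ 2 * b k) ≤
        K * ((1 - x) ^ 2 * ((k + 1) * y ^ k)) := by
      calc (k + 1 : ℝ) * (x ^ k * (1 - x) ^ 2 * b k)
          = (k + 1) * (1 - x) ^ 2 * (x ^ k * b k) := by ring
        _ ≤ (k + 1) * (1 - x) ^ 2 * (y ^ k * K) :=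
            mul_le_mul_of_nonneg_left (hxb k) (by positivity)
        _ = _ := by ring
    linarith
  refine (Finset.sum_le_sum fun k _ => hterm k).trans ?_
  rw [Finset.sum_add_distrib, Finset.sum_add_distrib, ← Finset.mul_sum, ← Finset.mul_sum,
    ← Finset.mul_sum, ← Finset.mul_sum]
  have t1 := sum_pow_mul_le
    (E := fun n => ∑ k ∈ Finset.range n, (k + 1 : ℝ) * |diff2 b k|)
    (e := fun k : ℕ => (k + 1 : ℝ) * |diff2 b k|) (by simp)
    (fun k => Finset.sum_range_succ _ _) hy0 hy1 hx (K := (4 * C + 1) * K) (fun k => by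
      have h1 := sum_mul_abs_diff2_inv_le hm hmono hconv hd k
      calc y ^ k * ∑ k ∈ Finset.range k, (k + 1 : ℝ) * |diff2 b k|
          ≤ y ^ k * ((4 * C + 1) * b k) := by gcongr
        _ = (4 * C + 1) * (y ^ k * b k) := by ring
        _ ≤ _ := by gcongr; exact hK k) N (by positivity)
  have hg : (1 - x) = (1 + y) * (1 - y) := by rw [hx]; ring
  have hy1' : 0 ≤ 1 - y := by linarith
  have t2 : (1 - x) * ∑ k ∈ Finset.range N, y ^ k ≤ 2 := by
    have := sum_range_pow_le hy0 N
    rw [hg, mul_assoc]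
    have h0 : 0 ≤ (1 - y) * ∑ k ∈ Finset.range N, y ^ k := by positivity
    nlinarith
  have t3 : (1 - x) ^ 2 * ∑ k ∈ Finset.range N, (k + 1 : ℝ) * y ^ k ≤ 4 := by
    have := sum_range_mul_pow_le hy0 hy1.le N
    rw [hg, mul_pow, mul_assoc]
    have h0 : 0 ≤ (1 - y) ^ 2 * ∑ k ∈ Finset.range N, (k + 1 : ℝ) * y ^ k := by positivity
    have : (1 + y) ^ 2 ≤ 4 := by nlinarith
    nlinarith
  have t2' := mul_le_mul_of_nonneg_left t2 (by positivity : 0 ≤ 2 * C * K)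
  have t3' := mul_le_mul_of_nonneg_left t3 hK0
  linarith

/-- Bound in `L¹` for the multiplier `x ^ k / m k`. -/
lemma circleAverage_norm_tsum_inv_le (hm : ∀ k, 0 < m k) (hmono : ∀ k, m (k + 1) ≤ m k)
    (hconv : ∀ k, m (k + 1) - m (k + 2) ≤ m k - m (k + 1))
    (hd : ∀ k : ℕ, (k + 1 : ℝ) * (m k - m (k + 1)) ≤ C * m (k + 2)) (hC : 0 ≤ C) {x y K : ℝ}
    (hy0 : 0 ≤ y) (hy1 : y < 1) (hx : x = y ^ 2) (hK : ∀ k, y ^ k * (m k)⁻¹ ≤ K)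
    {c : ℕ → ℂ} (hc : Summable fun k => ‖c k‖) :
    circleAverage (fun z => ‖∑' k : ℕ, ((x ^ k * (m k)⁻¹ : ℝ) : ℂ) * c k * z ^ k‖) 0 1 ≤
      (16 * C + 7) * K * circleAverage (fun z => ‖∑' k : ℕ, c k * z ^ k‖) 0 1 := by
  have hb := sum_mul_abs_diff2_pow_mul_inv_le hm hmono hconv hd hC hy0 hy1 hx hK
  have hs : Summable fun n : ℕ => (n + 1 : ℝ) * |diff2 (fun k => x ^ k * (m k)⁻¹) n| :=
    summable_of_sum_range_le (fun n => by positivity) hb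
  have h1 := circleAverage_norm_multiplier_le hc hs (hasSum_diff2 hy0 hy1 (K := K) (fun k => by
    have := (inv_pos.2 (hm k)).le
    rw [abs_of_nonneg (by rw [hx]; positivity)]
    calc x ^ k * (m k)⁻¹ = y ^ k * (y ^ k * (m k)⁻¹) := by rw [hx]; ring
      _ ≤ y ^ k * K := by gcongr; exact hK k
      _ = K * y ^ k := mul_comm _ _) hs)
  refine h1.trans (mul_le_mul_of_nonneg_right
    (Real.tsum_le_of_sum_range_le (fun n => by positivity) hb) ?_)
  exact Real.circleAverage_nonneg_of_nonneg fun z _ => norm_nonneg _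

end Reciprocal

namespace IsRadialWeight

variable {ω : ℝ → ℝ}

lemma intervalIntegrable (hω : IsRadialWeight ω) {a b : ℝ} (ha : a ∈ Icc (0:ℝ) 1)
    (hb : b ∈ Icc (0:ℝ) 1) : IntervalIntegrable ω volume a b := by
  have h : IntegrableOn ω (Icc 0 1) := (integrableOn_Icc_iff_integrableOn_Ico (by simp)).2 hω.2
  rw [intervalIntegrable_iff]
  refine h.mono_set fun x hx => ?_
  have := uIoc_subset_uIcc.trans (uIcc_subset_Icc ha hb) hx
  exact this

lemma intervalIntegrable_mul (hω : IsRadialWeight ω) {φ : ℝ → ℝ} (hφ : ContinuousOn φ (Icc 0 1))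
    {a b : ℝ} (ha : a ∈ Icc (0:ℝ) 1) (hb : b ∈ Icc (0:ℝ) 1) :
    IntervalIntegrable (fun t => φ t * ω t) volume a b :=
  (hω.intervalIntegrable ha hb).continuousOn_mul (hφ.mono (uIcc_subset_Icc ha hb))

lemma integral_mul_mono (hω : IsRadialWeight ω) {φ ψ : ℝ → ℝ} (hφ : ContinuousOn φ (Icc 0 1))
    (hψ : ContinuousOn ψ (Icc 0 1)) {a b : ℝ} (ha : 0 ≤ a) (hab : a ≤ b) (hb : b ≤ 1)
    (h : ∀ t ∈ Ioo a b, φ t ≤ ψ t) : ∫ t in a..b, φ t * ω t ≤ ∫ t in a..b, ψ t * ω t := by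
  have ha' : a ∈ Icc (0:ℝ) 1 := ⟨ha, hab.trans hb⟩
  have hb' : b ∈ Icc (0:ℝ) 1 := ⟨ha.trans hab, hb⟩
  refine intervalIntegral.integral_mono_on_of_le_Ioo hab (hω.intervalIntegrable_mul hφ ha' hb')
    (hω.intervalIntegrable_mul hψ ha' hb') fun t ht => ?_
  exact mul_le_mul_of_nonneg_right (h t ht) (hω.1 t ⟨ha.trans ht.1.le, ht.2.trans_le hb⟩)

lemma integral_nonneg (hω : IsRadialWeight ω) {φ : ℝ → ℝ} {a b : ℝ} (ha : 0 ≤ a) (hab : a ≤ b)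
    (hb : b ≤ 1) (h : ∀ t ∈ Ioo a b, 0 ≤ φ t) : 0 ≤ ∫ t in a..b, φ t * ω t := by
  rw [intervalIntegral.integral_of_le hab, integral_Ioc_eq_integral_Ioo]
  exact setIntegral_nonneg measurableSet_Ioo fun t ht =>
    mul_nonneg (h t ht) (hω.1 t ⟨ha.trans ht.1.le, ht.2.trans_le hb⟩)

lemma omegaHat_sub (hω : IsRadialWeight ω) {a b : ℝ} (ha : a ∈ Icc (0:ℝ) 1)
    (hb : b ∈ Icc (0:ℝ) 1) : omegaHat ω a - omegaHat ω b = ∫ s in a..b, ω s := by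
  have h1 : (1:ℝ) ∈ Icc (0:ℝ) 1 := ⟨zero_le_one, le_rfl⟩
  rw [omegaHat, omegaHat, sub_eq_iff_eq_add]
  exact (intervalIntegral.integral_add_adjacent_intervals (hω.intervalIntegrable ha hb)
    (hω.intervalIntegrable hb h1)).symm

lemma omegaHat_anti (hω : IsRadialWeight ω) {a b : ℝ} (ha : 0 ≤ a) (hab : a ≤ b) (hb : b ≤ 1) :
    omegaHat ω b ≤ omegaHat ω a := by
  have := hω.omegaHat_sub ⟨ha, hab.trans hb⟩ ⟨ha.trans hab, hb⟩
  have h2 := hω.integral_nonneg (φ := fun _ => 1) ha hab hb fun _ _ => zero_le_one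
  simp only [one_mul] at h2
  linarith

lemma continuousOn_omegaHat (hω : IsRadialWeight ω) : ContinuousOn (omegaHat ω) (Icc 0 1) := by
  have h : IntegrableOn ω (uIcc 0 1) := by
    rw [uIcc_of_le zero_le_one]; exact (integrableOn_Icc_iff_integrableOn_Ico (by simp)).2 hω.2
  have := intervalIntegral.continuousOn_primitive_interval_left h
  rwa [uIcc_of_le zero_le_one] at this

end IsRadialWeight

lemma omegaHat_one (ω : ℝ → ℝ) : omegaHat ω 1 = 0 := by simp [omegaHat]

namespace IsRadialWeight

variable {ω : ℝ → ℝ}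

lemma omegaHat_nonneg (hω : IsRadialWeight ω) {a : ℝ} (ha : a ∈ Icc (0:ℝ) 1) :
    0 ≤ omegaHat ω a := by
  simpa [omegaHat_one] using hω.omegaHat_anti ha.1 ha.2 le_rfl

/-- Points at which the tail takes a prescribed intermediate value. -/
lemma exists_omegaHat_eq (hω : IsRadialWeight ω) {a b v : ℝ} (ha : 0 ≤ a) (hab : a ≤ b)
    (hb : b ≤ 1) (h1 : omegaHat ω b ≤ v) (h2 : v ≤ omegaHat ω a) :
    ∃ c ∈ Icc a b, omegaHat ω c = v :=
  intermediate_value_Icc' hab (hω.continuousOn_omegaHat.mono (Icc_subset_Icc ha hb)) ⟨h1, h2⟩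

/-- The layer-cake formula for the moments. -/
lemma integral_pow_succ_mul (hω : IsRadialWeight ω) (n : ℕ) :
    ∫ t in (0:ℝ)..1, t ^ (n + 1) * ω t =
      ∫ s in (0:ℝ)..1, (n + 1) * s ^ n * omegaHat ω s := by
  have h0 : (0:ℝ) ∈ Icc (0:ℝ) 1 := ⟨le_rfl, zero_le_one⟩
  have h1 : (1:ℝ) ∈ Icc (0:ℝ) 1 := ⟨zero_le_one, le_rfl⟩
  have hI1 : IntegrableOn (fun t => t ^ (n + 1) * ω t) (Ioo 0 1) :=
    (intervalIntegrable_iff_integrableOn_Ioo_of_le zero_le_one).1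
      (hω.intervalIntegrable_mul (continuous_pow (n + 1)).continuousOn h0 h1)
  have hI2 : IntegrableOn (fun s => (n + 1) * s ^ n * omegaHat ω s) (Ioo 0 1) := by
    refine (ContinuousOn.integrableOn_Icc (a := 0) (b := 1) ?_).mono_set Ioo_subset_Icc_self
    exact (by fun_prop : ContinuousOn (fun s : ℝ => (n + 1) * s ^ n) (Icc 0 1)).mul
      hω.continuousOn_omegaHat
  have hωI : AEMeasurable (fun t => ENNReal.ofReal (ω t)) (volume.restrict (Ioo 0 1)) :=
    (hω.2.mono_set Ioo_subset_Ico_self).aemeasurable.ennreal_ofReal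
  set ν := (volume.restrict (Ioo (0:ℝ) 1)).withDensity fun t => ENNReal.ofReal (ω t) with hν
  have key := lintegral_comp_eq_lintegral_meas_lt_mul (f := fun t : ℝ => t)
    (g := fun s => (n + 1) * s ^ n) ν
    ((withDensity_absolutelyContinuous _ _).ae_le (by
      filter_upwards [ae_restrict_mem measurableSet_Ioo] with t ht using ht.1.le))
    measurable_id.aemeasurable (fun t _ => Continuous.intervalIntegrable (by fun_prop) _ _)
    (by filter_upwards [ae_restrict_mem measurableSet_Ioi] with t ht
        have : (0:ℝ) < t := ht
        positivity)
  have hpow : ∀ t : ℝ, ∫ s in (0:ℝ)..t, ((n:ℝ) + 1) * s ^ n = t ^ (n + 1) := fun t => by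
    rw [intervalIntegral.integral_const_mul, integral_pow]
    have : (n:ℝ) + 1 ≠ 0 := by positivity
    simp; field_simp
  simp only [hpow] at key
  rw [intervalIntegral.integral_of_le zero_le_one, intervalIntegral.integral_of_le zero_le_one,
    integral_Ioc_eq_integral_Ioo, integral_Ioc_eq_integral_Ioo]
  have n1 : 0 ≤ᵐ[volume.restrict (Ioo (0:ℝ) 1)] fun t => t ^ (n + 1) * ω t := by
    filter_upwards [ae_restrict_mem measurableSet_Ioo] with t ht
    exact mul_nonneg (pow_nonneg ht.1.le _) (hω.1 t ⟨ht.1.le, ht.2⟩)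
  have n2 : 0 ≤ᵐ[volume.restrict (Ioo (0:ℝ) 1)]
      fun s => ((n:ℝ) + 1) * s ^ n * omegaHat ω s := by
    filter_upwards [ae_restrict_mem measurableSet_Ioo] with t ht
    exact mul_nonneg (mul_nonneg (by positivity) (pow_nonneg ht.1.le _))
      (hω.omegaHat_nonneg ⟨ht.1.le, ht.2.le⟩)
  rw [integral_eq_lintegral_of_nonneg_ae n1 hI1.1, integral_eq_lintegral_of_nonneg_ae n2 hI2.1]
  congr 1
  rw [hν, lintegral_withDensity_eq_lintegral_mul₀ hωI (by fun_prop)] at key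
  have e1 : ∫⁻ t in Ioo (0:ℝ) 1, ENNReal.ofReal (t ^ (n + 1) * ω t) =
      ∫⁻ t in Ioo (0:ℝ) 1, ((fun t => ENNReal.ofReal (ω t)) *
        fun t => ENNReal.ofReal (t ^ (n + 1))) t := by
    refine setLIntegral_congr_fun measurableSet_Ioo fun t ht => ?_
    simp only [Pi.mul_apply]
    rw [ENNReal.ofReal_mul (pow_nonneg ht.1.le _), mul_comm]
  rw [e1, key, ← hν]
  have hmeas : ∀ t : ℝ, 0 < t → ν {a | t < a} =
      if t < 1 then ENNReal.ofReal (omegaHat ω t) else 0 := fun t ht => by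
    rw [hν, show {a | t < a} = Ioi t from rfl, withDensity_apply _ measurableSet_Ioi,
      Measure.restrict_restrict measurableSet_Ioi]
    have hs : Ioi t ∩ Ioo 0 1 = Ioo t 1 := by
      ext a; simp only [mem_inter_iff, mem_Ioi, mem_Ioo]
      exact ⟨fun h => ⟨h.1, h.2.2⟩, fun h => ⟨h.1, ht.trans h.1, h.2⟩⟩
    rw [hs]
    split_ifs with h
    · rw [omegaHat, intervalIntegral.integral_of_le h.le, integral_Ioc_eq_integral_Ioo,
        ofReal_integral_eq_lintegral_ofReal]
      · exact hω.2.mono_set fun x hx => ⟨ht.le.trans hx.1.le, hx.2⟩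
      · filter_upwards [ae_restrict_mem measurableSet_Ioo] with x hx
        exact hω.1 x ⟨ht.le.trans hx.1.le, hx.2⟩
    · rw [Ioo_eq_empty (by exact h)]; simp
  have e2 : ∫⁻ t in Ioi (0:ℝ), ν {a | t < a} * ENNReal.ofReal ((n + 1) * t ^ n) =
      ∫⁻ t in Ioi (0:ℝ), (Ioo (0:ℝ) 1).indicator
        (fun t => ENNReal.ofReal ((n + 1) * t ^ n * omegaHat ω t)) t := by
    refine setLIntegral_congr_fun measurableSet_Ioi fun t ht => ?_
    have ht' : (0:ℝ) < t := ht
    simp only [hmeas t ht', indicator, mem_Ioo, ht', true_and]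
    split_ifs with h
    · rw [← ENNReal.ofReal_mul' (by positivity), mul_comm]
    · simp
  rw [e2, lintegral_indicator measurableSet_Ioo, Measure.restrict_restrict measurableSet_Ioo,
    inter_eq_left.2 Ioo_subset_Ioi_self]

end IsRadialWeight

lemma momentCoeff_eq (μ : ℝ → ℝ) (k : ℕ) :
    momentCoeff μ k = ∫ t in (0:ℝ)..1, t ^ (2 * k + 1) * μ t := by
  simp only [momentCoeff, momentW]
  refine intervalIntegral.integral_congr fun t _ => ?_
  rw [← Real.rpow_natCast]
  push_cast
  rfl

lemma succ_mul_one_sub_mul_pow_le {x : ℝ} (h0 : 0 ≤ x) (h1 : x ≤ 1) (j : ℕ) :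
    (j + 1) * ((1 - x) * x ^ j) ≤ 1 := by
  have h : ∀ j : ℕ, (j + 1) * ((1 - x) * x ^ j) ≤ 1 - x ^ (j + 1) := fun j => by
    induction j with
    | zero => simp
    | succ j ih =>
      have h2 : x ^ (j + 1) ≤ x ^ j := pow_le_pow_of_le_one h0 h1 (Nat.le_succ j)
      have h3 := mul_le_mul_of_nonneg_left h2 (by linarith : 0 ≤ 1 - x)
      have h4 := mul_le_mul_of_nonneg_left h3 (by positivity : (0:ℝ) ≤ j + 1)
      have : x ^ (j + 1 + 1) = x ^ (j + 1) - (1 - x) * x ^ (j + 1) := by ring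
      push_cast
      rw [this]
      linarith
  have := pow_nonneg h0 (j + 1)
  linarith [h j]

namespace IsRadialWeight

variable {μ : ℝ → ℝ}

lemma moment_anti (hμ : IsRadialWeight μ) {m n : ℕ} (h : m ≤ n) :
    ∫ t in (0:ℝ)..1, t ^ n * μ t ≤ ∫ t in (0:ℝ)..1, t ^ m * μ t :=
  hμ.integral_mul_mono (continuous_pow n).continuousOn (continuous_pow m).continuousOn le_rfl
    zero_le_one le_rfl fun _ ht => pow_le_pow_of_le_one ht.1.le ht.2.le h

lemma moment_lower (hμ : IsRadialWeight μ) (n : ℕ) {y : ℝ} (hy : y ∈ Icc (0:ℝ) 1) :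
    y ^ n * omegaHat μ y ≤ ∫ t in (0:ℝ)..1, t ^ n * μ t := by
  have h0 : (0:ℝ) ∈ Icc (0:ℝ) 1 := ⟨le_rfl, zero_le_one⟩
  have h1 : (1:ℝ) ∈ Icc (0:ℝ) 1 := ⟨zero_le_one, le_rfl⟩
  have hc : ContinuousOn (fun t : ℝ => t ^ n) (Icc 0 1) := (continuous_pow n).continuousOn
  rw [← intervalIntegral.integral_add_adjacent_intervals (hμ.intervalIntegrable_mul hc h0 hy)
    (hμ.intervalIntegrable_mul hc hy h1), omegaHat, ← intervalIntegral.integral_const_mul]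
  have := hμ.integral_nonneg (φ := fun t => t ^ n) le_rfl hy.1 hy.2 fun t ht => pow_nonneg ht.1.le _
  have := hμ.integral_mul_mono (φ := fun _ => y ^ n) (ψ := fun t => t ^ n) continuousOn_const hc
    hy.1 hy.2 le_rfl fun t ht => pow_le_pow_left₀ hy.1 ht.1.le n
  linarith

lemma moment_pos (hμ : IsRadialWeight μ) (hpos : ∀ r ∈ Ico (0:ℝ) 1, 0 < omegaHat μ r) (n : ℕ) :
    0 < ∫ t in (0:ℝ)..1, t ^ n * μ t := by
  have := hμ.moment_lower n (y := 1 / 2) ⟨by norm_num, by norm_num⟩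
  have h2 := hpos (1 / 2) ⟨by norm_num, by norm_num⟩
  exact lt_of_lt_of_le (by positivity) this

lemma moment_doubling (hμ : IsRadialWeight μ) {C : ℝ} (hC : 0 < C)
    (hD : ∀ r ∈ Ico (0:ℝ) 1, omegaHat μ r ≤ C * omegaHat μ ((1 + r) / 2)) (n : ℕ) :
    ∫ t in (0:ℝ)..1, t ^ (n + 1) * μ t ≤ 2 * C * ∫ t in (0:ℝ)..1, t ^ (2 * n + 1) * μ t := by
  rw [hμ.integral_pow_succ_mul, hμ.integral_pow_succ_mul]
  have hcont := hμ.continuousOn_omegaHat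
  have hpc : ∀ m : ℕ, ContinuousOn (fun s : ℝ => ((m:ℝ) + 1) * s ^ m * omegaHat μ s)
      (Icc 0 1) := fun m =>
    (by fun_prop : ContinuousOn (fun s : ℝ => (m + 1) * s ^ m) (Icc 0 1)).mul hcont
  have hc2 : ContinuousOn (fun s : ℝ => omegaHat μ ((1 / 2) * s + 1 / 2)) (Icc 0 1) :=
    hcont.comp (by fun_prop) fun s hs => ⟨by linarith [hs.1], by linarith [hs.2]⟩
  have hI : ∀ {φ : ℝ → ℝ} {a b : ℝ}, ContinuousOn φ (Icc a b) → a ≤ b →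
      IntervalIntegrable φ volume a b := fun h hab =>
    ContinuousOn.intervalIntegrable (by rwa [uIcc_of_le hab])
  set φ : ℝ → ℝ := fun u => C * ((n + 1) * (2 * u - 1) ^ n * omegaHat μ u) with hφ
  have s1 : ∫ s in (0:ℝ)..1, (n + 1) * s ^ n * omegaHat μ s ≤
      ∫ s in (0:ℝ)..1, φ ((1 / 2) * s + 1 / 2) := by
    refine intervalIntegral.integral_mono_on_of_le_Ioo zero_le_one (hI (hpc n) zero_le_one)
      (hI ?_ zero_le_one) fun s hs => ?_
    · refine continuousOn_const.mul (ContinuousOn.mul (by fun_prop) hc2)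
    · have h := hD s ⟨hs.1.le, hs.2⟩
      have e : (1 + s) / 2 = 1 / 2 * s + 1 / 2 := by ring
      rw [e] at h
      have := mul_le_mul_of_nonneg_left h
        (mul_nonneg (by positivity) (pow_nonneg hs.1.le n) : (0:ℝ) ≤ (n + 1) * s ^ n)
      refine this.trans (le_of_eq ?_)
      simp only [hφ]
      have e2 : 2 * (1 / 2 * s + 1 / 2) - 1 = s := by ring
      rw [e2]; ring
  have s2 : ∫ s in (0:ℝ)..1, φ ((1 / 2) * s + 1 / 2) = 2 * ∫ u in (1 / 2 : ℝ)..1, φ u := by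
    rw [intervalIntegral.integral_comp_mul_add φ (by norm_num : (1 / 2 : ℝ) ≠ 0)]
    norm_num
  have hsub : Icc (1 / 2 : ℝ) 1 ⊆ Icc 0 1 := Icc_subset_Icc (by norm_num) le_rfl
  have s3 : ∫ u in (1 / 2 : ℝ)..1, φ u ≤
      ∫ u in (1 / 2 : ℝ)..1, C * (((2 * n : ℕ) + 1) * u ^ (2 * n) * omegaHat μ u) := by
    refine intervalIntegral.integral_mono_on_of_le_Ioo (by norm_num) (hI ?_ (by norm_num))
      (hI ?_ (by norm_num)) fun u hu => ?_
    · exact continuousOn_const.mul (ContinuousOn.mul (by fun_prop) (hcont.mono hsub))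
    · exact continuousOn_const.mul ((hpc (2 * n)).mono hsub)
    · have hu1 : 1 / 2 < u := hu.1
      have h1 := hμ.omegaHat_nonneg ⟨by linarith, hu.2.le⟩
      have h2 : (2 * u - 1) ^ n ≤ u ^ (2 * n) := by
        rw [pow_mul]
        exact pow_le_pow_left₀ (by linarith) (by nlinarith [sq_nonneg (u - 1)]) n
      have h3 : (n:ℝ) + 1 ≤ (2 * n : ℕ) + 1 := by push_cast; linarith [(n.cast_nonneg : (0:ℝ) ≤ n)]
      have h4 : 0 ≤ (2 * u - 1) ^ n := pow_nonneg (by linarith) n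
      simp only [hφ]
      gcongr
  have s4 : ∫ u in (1 / 2 : ℝ)..1, (((2 * n : ℕ) : ℝ) + 1) * u ^ (2 * n) * omegaHat μ u ≤
      ∫ u in (0:ℝ)..1, (((2 * n : ℕ) : ℝ) + 1) * u ^ (2 * n) * omegaHat μ u := by
    refine intervalIntegral.integral_mono_interval (by norm_num) (by norm_num) le_rfl ?_
      (hI (hpc (2 * n)) zero_le_one)
    filter_upwards [ae_restrict_mem measurableSet_Ioc] with u hu
    exact mul_nonneg (mul_nonneg (by positivity) (pow_nonneg hu.1.le _))
      (hμ.omegaHat_nonneg ⟨hu.1.le, hu.2⟩)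
  rw [intervalIntegral.integral_const_mul C (fun u => (((2 * n : ℕ) : ℝ) + 1) * u ^ (2 * n) *
    omegaHat μ u)] at s3
  rw [s2] at s1
  have := mul_le_mul_of_nonneg_left s4 hC.le
  linarith

lemma momentCoeff_pos (hμ : IsRadialWeight μ) (hpos : ∀ r ∈ Ico (0:ℝ) 1, 0 < omegaHat μ r)
    (k : ℕ) : 0 < momentCoeff μ k := by
  rw [momentCoeff_eq]; exact hμ.moment_pos hpos _

lemma momentCoeff_anti (hμ : IsRadialWeight μ) {j k : ℕ} (h : j ≤ k) :
    momentCoeff μ k ≤ momentCoeff μ j := by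
  rw [momentCoeff_eq, momentCoeff_eq]; exact hμ.moment_anti (by omega)

lemma momentCoeff_sub (hμ : IsRadialWeight μ) (k : ℕ) :
    momentCoeff μ k - momentCoeff μ (k + 1) =
      ∫ t in (0:ℝ)..1, (t ^ (2 * k + 1) * (1 - t ^ 2)) * μ t := by
  have h0 : (0:ℝ) ∈ Icc (0:ℝ) 1 := ⟨le_rfl, zero_le_one⟩
  have h1 : (1:ℝ) ∈ Icc (0:ℝ) 1 := ⟨zero_le_one, le_rfl⟩
  rw [momentCoeff_eq, momentCoeff_eq, ← intervalIntegral.integral_sub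
    (hμ.intervalIntegrable_mul (continuous_pow _).continuousOn h0 h1)
    (hμ.intervalIntegrable_mul (continuous_pow _).continuousOn h0 h1)]
  refine intervalIntegral.integral_congr fun t _ => ?_
  ring

lemma momentCoeff_convex (hμ : IsRadialWeight μ) (k : ℕ) :
    momentCoeff μ (k + 1) - momentCoeff μ (k + 2) ≤ momentCoeff μ k - momentCoeff μ (k + 1) := by
  rw [hμ.momentCoeff_sub, hμ.momentCoeff_sub]
  refine hμ.integral_mul_mono (by fun_prop) (by fun_prop) le_rfl zero_le_one le_rfl fun t ht => ?_
  refine mul_le_mul_of_nonneg_right (pow_le_pow_of_le_one ht.1.le ht.2.le (by omega)) ?_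
  nlinarith [ht.1, ht.2]

lemma exists_momentCoeff_sub_le (hμ : IsRadialWeight μ)
    (hpos : ∀ r ∈ Ico (0:ℝ) 1, 0 < omegaHat μ r) (hD : InDhat μ) :
    ∃ C : ℝ, 0 ≤ C ∧ ∀ k : ℕ,
      (k + 1 : ℝ) * (momentCoeff μ k - momentCoeff μ (k + 1)) ≤ C * momentCoeff μ (k + 2) := by
  obtain ⟨C, hC, hD⟩ := hD
  set M : ℕ → ℝ := fun n => ∫ t in (0:ℝ)..1, t ^ n * μ t with hM
  have hMpos : ∀ n, 0 < M n := hμ.moment_pos hpos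
  have hdbl : ∀ n, M (n + 1) ≤ 2 * C * M (2 * n + 1) := hμ.moment_doubling hC hD
  have hcoef : ∀ k, momentCoeff μ k = M (2 * k + 1) := momentCoeff_eq μ
  have hkey : ∀ k : ℕ, (k + 1 : ℝ) * (momentCoeff μ k - momentCoeff μ (k + 1)) ≤
      2 * M (k + 1) := fun k => by
    have h1 : (((k / 2 : ℕ) : ℝ) + 1) * (momentCoeff μ k - momentCoeff μ (k + 1)) ≤ M (k + 1) := by
      rw [hμ.momentCoeff_sub, ← intervalIntegral.integral_const_mul]
      simp_rw [← mul_assoc (((k / 2 : ℕ) : ℝ) + 1)]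
      refine hμ.integral_mul_mono (by fun_prop) (by fun_prop) le_rfl zero_le_one le_rfl
        fun t ht => ?_
      have h2 : t ^ (2 * k + 1) ≤ t ^ (k + 1) * (t ^ 2) ^ (k / 2) := by
        rw [← pow_mul, ← pow_add]
        exact pow_le_pow_of_le_one ht.1.le ht.2.le (by omega)
      have ht2 : t ^ 2 ≤ 1 := pow_le_one₀ ht.1.le ht.2.le
      have h3 := succ_mul_one_sub_mul_pow_le (sq_nonneg t) ht2 (k / 2)
      have h4 : 0 ≤ (((k / 2 : ℕ) : ℝ) + 1) * (1 - t ^ 2) :=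
        mul_nonneg (by positivity) (by linarith)
      calc (((k / 2 : ℕ) : ℝ) + 1) * t ^ (2 * k + 1) * (1 - t ^ 2)
          = (((k / 2 : ℕ) : ℝ) + 1) * (1 - t ^ 2) * t ^ (2 * k + 1) := by ring
        _ ≤ (((k / 2 : ℕ) : ℝ) + 1) * (1 - t ^ 2) * (t ^ (k + 1) * (t ^ 2) ^ (k / 2)) :=
            mul_le_mul_of_nonneg_left h2 h4
        _ = t ^ (k + 1) * ((((k / 2 : ℕ) : ℝ) + 1) * ((1 - t ^ 2) * (t ^ 2) ^ (k / 2))) := by ring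
        _ ≤ t ^ (k + 1) * 1 := mul_le_mul_of_nonneg_left h3 (pow_nonneg ht.1.le _)
        _ = t ^ (k + 1) := mul_one _
    have h5 : (k + 1 : ℝ) ≤ 2 * (((k / 2 : ℕ) : ℝ) + 1) := by
      have : k + 1 ≤ 2 * (k / 2 + 1) := by omega
      exact_mod_cast this
    have h6 : 0 ≤ momentCoeff μ k - momentCoeff μ (k + 1) :=
      sub_nonneg.2 (hμ.momentCoeff_anti (Nat.le_succ k))
    calc _ ≤ 2 * (((k / 2 : ℕ) : ℝ) + 1) * (momentCoeff μ k - momentCoeff μ (k + 1)) :=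
          mul_le_mul_of_nonneg_right h5 h6
      _ ≤ _ := by linarith
  refine ⟨2 * (2 * C) ^ 3 + 2 * M 1 / M 5, by have := hMpos 1; have := hMpos 5; positivity,
    fun k => (hkey k).trans ?_⟩
  rw [hcoef]
  rcases Nat.eq_zero_or_pos k with rfl | hk
  · have h1 := hMpos 1
    have h5 := hMpos 5
    have : 2 * M 1 / M 5 * M 5 = 2 * M 1 := by field_simp
    have h3 : 0 ≤ 2 * (2 * C) ^ 3 * M 5 := by positivity
    simp only [zero_add, Nat.reduceMul, Nat.reduceAdd]
    linarith
  · have a1 := hdbl k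
    have a2 := hdbl (2 * k)
    have a3 := hdbl (2 * (2 * k))
    have a4 : M (2 * (2 * (2 * k)) + 1) ≤ M (2 * (k + 2) + 1) := hμ.moment_anti (by omega)
    have c2 : (0:ℝ) ≤ 2 * C := by positivity
    have b1 : M (k + 1) ≤ (2 * C) ^ 3 * M (2 * (k + 2) + 1) := by
      calc _ ≤ 2 * C * (2 * C * (2 * C * M (2 * (k + 2) + 1))) := by
            refine a1.trans (mul_le_mul_of_nonneg_left (a2.trans (mul_le_mul_of_nonneg_left
              (a3.trans (mul_le_mul_of_nonneg_left a4 c2)) c2)) c2)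
        _ = _ := by ring
    have : 0 ≤ 2 * M 1 / M 5 * M (2 * (k + 2) + 1) := by
      have := hMpos 1; have := hMpos 5; have := hMpos (2 * (k + 2) + 1); positivity
    linarith

lemma exists_inv_momentCoeff_le (hμ : IsRadialWeight μ)
    (hpos : ∀ r ∈ Ico (0:ℝ) 1, 0 < omegaHat μ r) (hD : InDhat μ) :
    ∃ C : ℝ, 0 < C ∧ ∀ y ∈ Ico (0:ℝ) 1, ∀ k : ℕ,
      y ^ k * (momentCoeff μ k)⁻¹ ≤ C * (omegaHat μ (y ^ 2))⁻¹ := by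
  obtain ⟨C, hC, hD⟩ := hD
  refine ⟨4 / 3 * C ^ 2, by positivity, fun y hy k => ?_⟩
  set x := y ^ 2 with hx
  have hx0 : 0 ≤ x := sq_nonneg y
  have hx1 : x < 1 := by rw [hx]; nlinarith [hy.1, hy.2]
  have d1 := hD x ⟨hx0, hx1⟩
  have d2 := hD ((1 + x) / 2) ⟨by linarith, by linarith⟩
  set z := (1 + (1 + x) / 2) / 2 with hz
  have hz0 : 3 / 4 ≤ z := by rw [hz]; linarith
  have hz1 : z ≤ 1 := by rw [hz]; linarith
  have hzy : y ≤ z ^ 2 := by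
    have : z = (3 + y ^ 2) / 4 := by rw [hz, hx]; ring
    rw [this]
    nlinarith [hy.1, hy.2, mul_nonneg hy.1 (sub_nonneg.2 hy.2.le), sq_nonneg (y ^ 2 - 1),
      sq_nonneg (y - 1), mul_nonneg (sub_nonneg.2 hy.2.le) (sq_nonneg (y - 1))]
  have h1 := hμ.moment_lower (2 * k + 1) (y := z) ⟨by linarith, hz1⟩
  rw [← momentCoeff_eq] at h1
  have hWx := hpos x ⟨hx0, hx1⟩
  have hm := hμ.momentCoeff_pos hpos k
  have h2 : omegaHat μ x ≤ C ^ 2 * omegaHat μ z := by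
    calc _ ≤ C * (C * omegaHat μ z) := d1.trans (mul_le_mul_of_nonneg_left d2 hC.le)
      _ = _ := by ring
  have hWz : 0 ≤ omegaHat μ z := hμ.omegaHat_nonneg ⟨by linarith, hz1⟩
  have h3 : y ^ k * (3 / 4) ≤ z ^ (2 * k + 1) := by
    rw [pow_succ, pow_mul]
    exact mul_le_mul (pow_le_pow_left₀ hy.1 hzy k) hz0 (by norm_num) (by positivity)
  have h4 : y ^ k * (3 / 4) * omegaHat μ x ≤ C ^ 2 * momentCoeff μ k := by
    calc _ ≤ z ^ (2 * k + 1) * (C ^ 2 * omegaHat μ z) := by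
          have := pow_nonneg hy.1 k
          gcongr
      _ = C ^ 2 * (z ^ (2 * k + 1) * omegaHat μ z) := by ring
      _ ≤ _ := by gcongr
  rw [← div_eq_mul_inv, ← div_eq_mul_inv, div_le_div_iff₀ hm hWx]
  linarith

end IsRadialWeight

namespace IsRadialWeight

variable {ω : ℝ → ℝ} {α : ℝ}

lemma continuousOn_omegaHat_rpow (hω : IsRadialWeight ω) (hα : 0 ≤ α) :
    ContinuousOn (fun t => omegaHat ω t ^ α) (Icc 0 1) :=
  hω.continuousOn_omegaHat.rpow_const fun _ _ => Or.inr hα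

lemma mul_omegaHat_rpow (hω : IsRadialWeight ω) (hα : 0 ≤ α) :
    IsRadialWeight fun r => ω r * omegaHat ω r ^ α := by
  refine ⟨fun r hr => mul_nonneg (hω.1 r hr) (Real.rpow_nonneg
    (hω.omegaHat_nonneg ⟨hr.1, hr.2.le⟩) α), ?_⟩
  rw [← integrableOn_Icc_iff_integrableOn_Ico (by finiteness)]
  exact ((integrableOn_Icc_iff_integrableOn_Ico (by simp)).2 hω.2).mul_continuousOn
    (hω.continuousOn_omegaHat_rpow hα) isCompact_Icc

lemma omegaHat_mul_rpow_eq (α r : ℝ) :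
    omegaHat (fun r => ω r * omegaHat ω r ^ α) r = ∫ t in r..1, omegaHat ω t ^ α * ω t := by
  simp only [omegaHat, mul_comm]

lemma omegaHat_mul_rpow_le (hω : IsRadialWeight ω) (hα : 0 ≤ α) {y : ℝ} (hy : y ∈ Icc (0:ℝ) 1) :
    omegaHat (fun r => ω r * omegaHat ω r ^ α) y ≤ omegaHat ω y ^ α * omegaHat ω y := by
  rw [omegaHat_mul_rpow_eq]
  have := hω.integral_mul_mono (φ := fun t => omegaHat ω t ^ α)
    (ψ := fun _ => omegaHat ω y ^ α) (hω.continuousOn_omegaHat_rpow hα) continuousOn_const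
    hy.1 hy.2 le_rfl fun t ht => Real.rpow_le_rpow
      (hω.omegaHat_nonneg ⟨hy.1.trans ht.1.le, ht.2.le⟩) (hω.omegaHat_anti hy.1 ht.1.le ht.2.le) hα
  rwa [intervalIntegral.integral_const_mul] at this

lemma le_omegaHat_mul_rpow (hω : IsRadialWeight ω) (hα : 0 ≤ α) {y : ℝ} (hy : y ∈ Icc (0:ℝ) 1) :
    (1 / 2) ^ α * (1 / 2) * (omegaHat ω y ^ α * omegaHat ω y) ≤
      omegaHat (fun r => ω r * omegaHat ω r ^ α) y := by
  have h0 := hω.omegaHat_nonneg hy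
  obtain ⟨z, hz, hzv⟩ := hω.exists_omegaHat_eq hy.1 hy.2 le_rfl (v := omegaHat ω y / 2)
    (by rw [omegaHat_one]; positivity) (by linarith)
  have hz' : z ∈ Icc (0:ℝ) 1 := ⟨hy.1.trans hz.1, hz.2⟩
  have h1 : (1:ℝ) ∈ Icc (0:ℝ) 1 := ⟨zero_le_one, le_rfl⟩
  have hc := hω.continuousOn_omegaHat_rpow hα
  rw [omegaHat_mul_rpow_eq, ← intervalIntegral.integral_add_adjacent_intervals
    (hω.intervalIntegrable_mul hc hy hz') (hω.intervalIntegrable_mul hc hz' h1)]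
  have h2 := hω.integral_nonneg (φ := fun t => omegaHat ω t ^ α) hz'.1 hz'.2 le_rfl
    fun t ht => Real.rpow_nonneg (hω.omegaHat_nonneg ⟨hz'.1.trans ht.1.le, ht.2.le⟩) α
  have h3 := hω.integral_mul_mono (φ := fun _ => (omegaHat ω y / 2) ^ α)
    (ψ := fun t => omegaHat ω t ^ α) continuousOn_const hc hy.1 hz.1 hz.2 fun t ht => by
      rw [← hzv]
      exact Real.rpow_le_rpow (hω.omegaHat_nonneg hz')
        (hω.omegaHat_anti (hy.1.trans ht.1.le) ht.2.le hz.2) hα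
  rw [intervalIntegral.integral_const_mul, ← hω.omegaHat_sub hy hz', hzv] at h3
  have e : (1 / 2 : ℝ) ^ α * (1 / 2) * (omegaHat ω y ^ α * omegaHat ω y) =
      (omegaHat ω y / 2) ^ α * (omegaHat ω y - omegaHat ω y / 2) := by
    rw [div_eq_mul_one_div (omegaHat ω y) 2, Real.mul_rpow h0 (by norm_num)]; ring
  rw [e]
  linarith

lemma omegaHat_mul_rpow_pos (hω : IsRadialWeight ω) (hα : 0 ≤ α)
    (hpos : ∀ r ∈ Ico (0:ℝ) 1, 0 < omegaHat ω r) (r : ℝ) (hr : r ∈ Ico (0:ℝ) 1) :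
    0 < omegaHat (fun r => ω r * omegaHat ω r ^ α) r := by
  have := hpos r hr
  exact lt_of_lt_of_le (by positivity) (hω.le_omegaHat_mul_rpow hα ⟨hr.1, hr.2.le⟩)

lemma inDhat_mul_rpow (hω : IsRadialWeight ω) (hα : 0 ≤ α) (hD : InDhat ω) :
    InDhat fun r => ω r * omegaHat ω r ^ α := by
  obtain ⟨C, hC, hD⟩ := hD
  refine ⟨C ^ α * C * ((1 / 2) ^ α * (1 / 2))⁻¹, by positivity, fun r hr => ?_⟩
  have hr2 : (1 + r) / 2 ∈ Icc (0:ℝ) 1 := ⟨by linarith [hr.1], by linarith [hr.2]⟩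
  have h0 := hω.omegaHat_nonneg ⟨hr.1, hr.2.le⟩
  have h1 := hω.omegaHat_nonneg hr2
  have hd := hD r hr
  have hl := hω.le_omegaHat_mul_rpow hα hr2
  set c : ℝ := (1 / 2) ^ α * (1 / 2) with hc
  have hcpos : 0 < c := by positivity
  calc _ ≤ omegaHat ω r ^ α * omegaHat ω r := hω.omegaHat_mul_rpow_le hα ⟨hr.1, hr.2.le⟩
    _ ≤ (C * omegaHat ω ((1 + r) / 2)) ^ α * (C * omegaHat ω ((1 + r) / 2)) := by gcongr
    _ = C ^ α * C * c⁻¹ * (c * (omegaHat ω ((1 + r) / 2) ^ α * omegaHat ω ((1 + r) / 2))) := by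
        rw [Real.mul_rpow hC.le h1]; field_simp
    _ ≤ _ := by gcongr

/-- Integration of a negative power of the truncated tail. -/
lemma integral_max_rpow_le (hω : IsRadialWeight ω) {q : ℝ} (hq : 0 < q) {v : ℝ} (hv : 0 < v) :
    ∫ s in (0:ℝ)..1, max (omegaHat ω s) v ^ (-(q + 1)) * ω s ≤
      (1 + (1 - (2:ℝ) ^ (-q))⁻¹) * v ^ (-q) := by
  have hcont : ContinuousOn (fun s => max (omegaHat ω s) v ^ (-(q + 1))) (Icc 0 1) :=
    (ContinuousOn.sup hω.continuousOn_omegaHat continuousOn_const).rpow_const fun s _ =>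
      Or.inl (lt_of_lt_of_le hv (le_max_right _ _)).ne'
  have h1 : (1:ℝ) ∈ Icc (0:ℝ) 1 := ⟨zero_le_one, le_rfl⟩
  set ρ : ℝ := (2:ℝ) ^ (-q) with hρ
  have hρ0 : 0 < ρ := by positivity
  have hρ1 : ρ < 1 := Real.rpow_lt_one_of_one_lt_of_neg one_lt_two (by linarith)
  have hpw : ∀ {x : ℝ}, 0 < x → x ^ (-(q + 1)) * x = x ^ (-q) := fun {x} hx => by
    conv_lhs => rw [show -(q + 1) = -q - 1 by ring, Real.rpow_sub_one hx.ne']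
    field_simp
  have main : ∀ n : ℕ, ∀ a ∈ Icc (0:ℝ) 1, omegaHat ω a ≤ 2 ^ n * v →
      ∫ s in a..1, max (omegaHat ω s) v ^ (-(q + 1)) * ω s ≤
        (1 + ∑ i ∈ Finset.range n, ρ ^ i) * v ^ (-q) := fun n => by
    induction n with
    | zero =>
      intro a ha hav
      have := hω.integral_mul_mono (ψ := fun _ => v ^ (-(q + 1))) hcont continuousOn_const
        ha.1 ha.2 le_rfl fun t ht =>
          Real.rpow_le_rpow_of_nonpos hv (le_max_right _ _) (by linarith)
      rw [intervalIntegral.integral_const_mul] at this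
      refine this.trans ?_
      simp only [pow_zero, one_mul] at hav
      simp only [Finset.range_zero, Finset.sum_empty, add_zero, one_mul]
      rw [← hpw hv]
      exact mul_le_mul_of_nonneg_left hav (by positivity)
    | succ n ih =>
      intro a ha hav
      rw [Finset.sum_range_succ]
      rcases le_total (omegaHat ω a) (2 ^ n * v) with h | h
      · refine (ih a ha h).trans ?_
        gcongr
        have := pow_pos hρ0 n
        linarith
      obtain ⟨b, hb, hbv⟩ := hω.exists_omegaHat_eq ha.1 ha.2 le_rfl (v := 2 ^ n * v)
        (by rw [omegaHat_one]; positivity) h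
      have hb' : b ∈ Icc (0:ℝ) 1 := ⟨ha.1.trans hb.1, hb.2⟩
      have hw : 0 < 2 ^ n * v := by positivity
      rw [← intervalIntegral.integral_add_adjacent_intervals
        (hω.intervalIntegrable_mul hcont ha hb') (hω.intervalIntegrable_mul hcont hb' h1)]
      have h2 := ih b hb' hbv.le
      have h3 := hω.integral_mul_mono (ψ := fun _ => (2 ^ n * v) ^ (-(q + 1))) hcont
        continuousOn_const ha.1 hb.1 hb.2 fun t ht => by
          refine Real.rpow_le_rpow_of_nonpos hw ?_ (by linarith)
          rw [← hbv]
          exact (hω.omegaHat_anti (ha.1.trans ht.1.le) ht.2.le hb.2).trans (le_max_left _ _)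
      rw [intervalIntegral.integral_const_mul, ← hω.omegaHat_sub ha hb', hbv] at h3
      have h4 : (2 ^ n * v) ^ (-(q + 1)) * (omegaHat ω a - 2 ^ n * v) ≤ ρ ^ n * v ^ (-q) := by
        calc _ ≤ (2 ^ n * v) ^ (-(q + 1)) * (2 ^ n * v) := by
              refine mul_le_mul_of_nonneg_left ?_ (by positivity)
              rw [pow_succ] at hav; linarith
          _ = (2 ^ n * v) ^ (-q) := hpw hw
          _ = ρ ^ n * v ^ (-q) := by
              rw [Real.mul_rpow (by positivity) hv.le, hρ, ← Real.rpow_natCast,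
                ← Real.rpow_natCast, ← Real.rpow_mul (by norm_num), ← Real.rpow_mul (by norm_num),
                mul_comm (n:ℝ)]
      linarith
  obtain ⟨n, hn⟩ := pow_unbounded_of_one_lt (omegaHat ω 0 / v) one_lt_two
  refine (main n 0 ⟨le_rfl, zero_le_one⟩ ((div_lt_iff₀ hv).1 hn).le).trans ?_
  gcongr
  rw [← tsum_geometric_of_lt_one hρ0.le hρ1]
  exact (summable_geometric_of_lt_one hρ0.le hρ1).sum_le_tsum _ fun i _ => by positivity

lemma exists_le_integral_mul (hω : IsRadialWeight ω) (hD : InDhat ω) :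
    ∃ c : ℝ, 0 < c ∧ ∀ t ∈ Ico (0:ℝ) 1, c * omegaHat ω t ≤ ∫ s in t..1, s * ω s := by
  obtain ⟨C, hC, hD⟩ := hD
  refine ⟨(1 / 2) * C⁻¹, by positivity, fun t ht => ?_⟩
  have h1 : (1:ℝ) ∈ Icc (0:ℝ) 1 := ⟨zero_le_one, le_rfl⟩
  have ht' : t ∈ Icc (0:ℝ) 1 := ⟨ht.1, ht.2.le⟩
  set z := (1 + t) / 2 with hz
  have hz' : z ∈ Icc (0:ℝ) 1 := ⟨by linarith [ht.1], by linarith [ht.2]⟩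
  have htz : t ≤ z := by linarith [ht.2]
  have hc : ContinuousOn (fun s : ℝ => s) (Icc 0 1) := continuousOn_id
  rw [← intervalIntegral.integral_add_adjacent_intervals
    (hω.intervalIntegrable_mul hc ht' hz') (hω.intervalIntegrable_mul hc hz' h1)]
  have h2 := hω.integral_nonneg (φ := fun s => s) ht.1 htz hz'.2 fun s hs => ht.1.trans hs.1.le
  have h3 := hω.integral_mul_mono (φ := fun _ => 1 / 2) (ψ := fun s => s) continuousOn_const hc
    hz'.1 hz'.2 le_rfl fun s hs => by have := ht.1; have := hs.1; linarith
  rw [intervalIntegral.integral_const_mul] at h3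
  have h4 : C⁻¹ * omegaHat ω t ≤ omegaHat ω z := by
    rw [inv_mul_le_iff₀ hC]; exact hD t ht
  have h5 : (1 / 2 : ℝ) * omegaHat ω z ≤ ∫ s in z..1, s * ω s := h3
  linarith

end IsRadialWeight

lemma circleMap_zero_eq_circlePt (r θ : ℝ) : circleMap 0 r θ = circlePt r θ := by
  simp [circleMap, circlePt]

lemma MpE_eq {p r : ℝ} (hp : 0 < p) (hr : 0 ≤ r) {f : ℂ → ℂ}
    (hf : ContinuousOn f (Metric.sphere 0 r)) :
    MpE p r f = ENNReal.ofReal (circleAverage (fun z => ‖f z‖ ^ p) 0 r ^ (1 / p)) := by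
  have hci : CircleIntegrable (fun z => ‖f z‖ ^ p) 0 r :=
    (hf.norm.rpow_const fun _ _ => Or.inr hp.le).circleIntegrable hr
  have hI : IntegrableOn (fun θ => ‖f (circlePt r θ)‖ ^ p) (Ioo 0 (2 * Real.pi)) := by
    have := (intervalIntegrable_iff_integrableOn_Ioo_of_le Real.two_pi_pos.le).1 hci
    simpa only [circleMap_zero_eq_circlePt] using this
  have h0 : 0 ≤ circleAverage (fun z => ‖f z‖ ^ p) 0 r :=
    Real.circleAverage_nonneg_of_nonneg fun z _ => by positivity
  rw [MpE, ← ENNReal.ofReal_rpow_of_nonneg h0 (by positivity)]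
  congr 1
  rw [← ofReal_integral_eq_lintegral_ofReal hI
    (Filter.Eventually.of_forall fun θ => by positivity),
    ← ENNReal.ofReal_mul (by positivity), Real.circleAverage_def,
    intervalIntegral.integral_of_le Real.two_pi_pos.le, integral_Ioc_eq_integral_Ioo]
  simp only [circleMap_zero_eq_circlePt, one_div, smul_eq_mul]

lemma MpE_one_eq {r : ℝ} (hr : 0 ≤ r) {f : ℂ → ℂ} (hf : ContinuousOn f (Metric.sphere 0 r)) :
    MpE 1 r f = ENNReal.ofReal (circleAverage (fun z => ‖f z‖) 0 r) := by
  rw [MpE_eq one_pos hr hf]; simp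

lemma MpE_two_le_iff {r B : ℝ} (hr : 0 ≤ r) (hB : 0 ≤ B) {f : ℂ → ℂ}
    (hf : ContinuousOn f (Metric.sphere 0 r)) :
    MpE 2 r f ≤ ENNReal.ofReal B ↔ circleAverage (fun z => ‖f z‖ ^ 2) 0 r ≤ B ^ 2 := by
  rw [MpE_eq two_pos hr hf, ENNReal.ofReal_le_ofReal_iff hB, ← Real.sqrt_eq_rpow,
    Real.sqrt_le_left hB]
  norm_num

lemma dilateF_zero (f : ℂ → ℂ) (r : ℝ) : dilateF f r 0 = f 0 := by simp [dilateF]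

lemma circleAverage_mul_eq {E : Type*} [NormedAddCommGroup E] [NormedSpace ℝ E] (u : ℂ → E)
    (r s : ℝ) : circleAverage u 0 (r * s) = circleAverage (fun z => u (r * z)) 0 s := by
  simp only [Real.circleAverage_def, circleMap_zero_eq_circlePt, circlePt]
  push_cast
  simp only [mul_assoc]

lemma circleAverage_eq_unit {E : Type*} [NormedAddCommGroup E] [NormedSpace ℝ E] (u : ℂ → E)
    (r : ℝ) : circleAverage u 0 r = circleAverage (fun z => u (r * z)) 0 1 := by
  rw [← circleAverage_mul_eq, mul_one]

lemma DifferentiableOn.dilateF {f : ℂ → ℂ} (hf : DifferentiableOn ℂ f (Metric.ball 0 1)) {r : ℝ}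
    (h0 : 0 ≤ r) (h1 : r < 1) : DiffContOnCl ℂ (dilateF f r) (Metric.ball 0 1) := by
  refine DifferentiableOn.diffContOnCl ?_
  rw [closure_ball _ one_ne_zero]
  refine hf.comp (by fun_prop) fun z hz => ?_
  rw [mem_closedBall_zero_iff] at hz
  rw [mem_ball_zero_iff, norm_mul, Complex.norm_real, Real.norm_of_nonneg h0]
  nlinarith [norm_nonneg z]

lemma circleAverage_norm_mono {f : ℂ → ℂ} (hf : DifferentiableOn ℂ f (Metric.ball 0 1)) {s t : ℝ}
    (hs : 0 ≤ s) (hst : s ≤ t) (ht : t < 1) :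
    circleAverage (fun z => ‖f z‖) 0 s ≤ circleAverage (fun z => ‖f z‖) 0 t := by
  rcases hst.eq_or_lt with rfl | hlt
  · rfl
  have ht0 : 0 < t := hs.trans_lt hlt
  have := circleAverage_norm_le (hf.dilateF ht0.le ht) (ρ := s / t) (by positivity)
    ((div_le_one ht0).2 hst)
  simp only [dilateF] at this
  rwa [← circleAverage_mul_eq (fun z => ‖f z‖), ← circleAverage_mul_eq (fun z => ‖f z‖), mul_one,
    mul_div_cancel₀ _ ht0.ne'] at this

lemma hasSum_taylorCoeff {f : ℂ → ℂ} {R : ℝ} (hf : DifferentiableOn ℂ f (Metric.ball 0 R)) {z : ℂ}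
    (hz : ‖z‖ < R) : HasSum (fun k => taylorCoeff f k * z ^ k) (f z) := by
  have := Complex.hasSum_taylorSeries_on_ball hf (mem_ball_zero_iff.2 hz)
  have e : (fun k => taylorCoeff f k * z ^ k) =
      fun n : ℕ => (n.factorial : ℂ)⁻¹ • (z - 0) ^ n • iteratedDeriv n f 0 := by
    ext n; rw [taylorCoeff, sub_zero, smul_eq_mul, smul_eq_mul]; ring
  rwa [e]

lemma summable_norm_taylorCoeff {f : ℂ → ℂ} {R : ℝ} (hf : DifferentiableOn ℂ f (Metric.ball 0 R))
    {r : ℝ} (h0 : 0 ≤ r) (h1 : r < R) : Summable fun k => ‖taylorCoeff f k‖ * r ^ k := by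
  have := (hasSum_taylorCoeff hf (z := (r:ℂ)) (by simpa [abs_of_nonneg h0] using h1)).summable.norm
  simpa [norm_mul, norm_pow, abs_of_nonneg h0] using this

/-- A power series converging on the unit disc. -/
lemma differentiableOn_tsum_pow {c : ℕ → ℂ} {R : ℝ} (hc : ∀ r, 0 ≤ r → r < R →
    Summable fun k => ‖c k‖ * r ^ k) :
    DifferentiableOn ℂ (fun z => ∑' k, c k * z ^ k) (Metric.ball 0 R) := by
  intro z hz
  rw [mem_ball_zero_iff] at hz
  obtain ⟨r, hr1, hr2⟩ := exists_between hz
  have h0 : 0 ≤ r := (norm_nonneg z).trans hr1.le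
  have : DifferentiableOn ℂ (fun z => ∑' k, c k * z ^ k) (Metric.ball 0 r) :=
    Complex.differentiableOn_tsum_of_summable_norm (hc r h0 hr2) (fun k => by fun_prop)
      Metric.isOpen_ball fun k w hw => by
        rw [norm_mul, norm_pow]
        have := (mem_ball_zero_iff.1 hw).le
        gcongr
  exact (this.differentiableAt (Metric.isOpen_ball.mem_nhds
    (mem_ball_zero_iff.2 hr1))).differentiableWithinAt

lemma summable_mul_pow {c : ℕ → ℂ} {r : ℝ} (hc : Summable fun k => ‖c k‖ * r ^ k) {z : ℂ}
    (hz : ‖z‖ ≤ r) : Summable fun k => c k * z ^ k :=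
  Summable.of_norm_bounded hc fun k => by rw [norm_mul, norm_pow]; gcongr

lemma taylorCoeff_tsum {c : ℕ → ℂ} {R : ℝ} (hR : 0 < R) (hc : ∀ r, 0 ≤ r → r < R →
    Summable fun k => ‖c k‖ * r ^ k) (n : ℕ) :
    taylorCoeff (fun z => ∑' k, c k * z ^ k) n = c n := by
  have key : ∀ a : ℕ → ℂ, (∀ z : ℂ, ‖z‖ < R → HasSum (fun k => a k * z ^ k) (∑' k, c k * z ^ k)) →
      HasFPowerSeriesAt (fun z => ∑' k, c k * z ^ k)
        (FormalMultilinearSeries.ofScalars ℂ a) 0 := fun a ha => by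
    rw [hasFPowerSeriesAt_iff]
    filter_upwards [Metric.ball_mem_nhds (0:ℂ) hR] with z hz
    simpa [mul_comm] using ha z (mem_ball_zero_iff.1 hz)
  have h1 := key (taylorCoeff fun z => ∑' k, c k * z ^ k) fun z hz =>
    hasSum_taylorCoeff (differentiableOn_tsum_pow hc) hz
  have h2 := key c fun z hz => (summable_mul_pow (hc _ (norm_nonneg z) hz) le_rfl).hasSum
  have := congrArg (fun p => FormalMultilinearSeries.coeff p n) (h1.eq_formalMultilinearSeries h2)
  simpa using this

lemma integral_tsum_fourier_mul {T : ℝ} [Fact (0 < T)] {c : ℕ → ℂ} (hc : Summable fun k => ‖c k‖)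
    {H : AddCircle T → ℂ} (hH : Continuous H) :
    ∫ x, (∑' k : ℕ, c k * fourier (k : ℤ) x) * H x ∂AddCircle.haarAddCircle =
      ∑' k : ℕ, c k * ∫ x, fourier (k : ℤ) x * H x ∂AddCircle.haarAddCircle := by
  have := (hasSum_integral_of_summable_integral_norm (μ := AddCircle.haarAddCircle)
    (F := fun (k : ℕ) (x : AddCircle T) => c k * (fourier (k : ℤ) x * H x))
    (fun k => Continuous.integrable_haarAddCircle (by fun_prop)) ?_).tsum_eq
  · simp_rw [integral_const_mul] at this
    rw [this]
    simp_rw [← tsum_mul_right, mul_assoc]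
  · simp only [norm_mul, Circle.norm_coe, fourier_apply, one_mul, integral_const_mul]
    exact hc.mul_right _

/-- Parseval's formula for absolutely convergent series. -/
lemma circleAverage_tsum_mul_conj {a b : ℕ → ℂ} (ha : Summable fun k => ‖a k‖)
    (hb : Summable fun k => ‖b k‖) :
    circleAverage (fun z => (∑' k, a k * z ^ k) * (starRingEnd ℂ) (∑' k, b k * z ^ k)) 0 1 =
      ∑' k, a k * (starRingEnd ℂ) (b k) := by
  have : Fact (0 < 2 * Real.pi) := ⟨Real.two_pi_pos⟩
  have hf : ∀ (k : ℕ) (x : AddCircle (2 * Real.pi)),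
      (AddCircle.toCircle x : ℂ) ^ k = fourier (k : ℤ) x := fun k x => by
    rw [fourier_apply, AddCircle.toCircle_zsmul]; simp
  rw [circleAverage_eq_integral_haarAddCircle]
  simp_rw [hf]
  have hcb := continuous_tsum_fourier (T := 2 * Real.pi) hb
  rw [integral_tsum_fourier_mul ha (H := fun x => (starRingEnd ℂ) (∑' k : ℕ, b k *
    fourier (k : ℤ) x)) (Complex.continuous_conj.comp hcb)]
  refine tsum_congr fun k => ?_
  congr 1
  have e : ∀ x : AddCircle (2 * Real.pi), fourier (k : ℤ) x *
      (starRingEnd ℂ) (∑' j : ℕ, b j * fourier (j : ℤ) x) =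
      (starRingEnd ℂ) ((∑' j : ℕ, b j * fourier (j : ℤ) x) * fourier (-(k : ℤ)) x) := fun x => by
    rw [map_mul, fourier_neg, Complex.conj_conj, mul_comm]
  simp_rw [e]
  rw [integral_conj, integral_tsum_fourier_mul hb (fourier (-(k : ℤ))).continuous]
  simp_rw [← fourier_add, integral_fourier]
  rw [tsum_eq_single k]
  · simp
  · intro j hj
    rw [if_neg (by omega), mul_zero]

lemma continuousOn_circleAverage_norm {f : ℂ → ℂ} (hf : ContinuousOn f (Metric.ball 0 1)) :
    ContinuousOn (fun t => circleAverage (fun z => ‖f z‖) 0 t) (Ico 0 1) := by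
  refine Real.ContinuousOn.circleAverage (hf.norm.mono fun z hz => ?_) fun r hr => hr.1
  simpa using hz.2

lemma circleAverage_norm_nonneg (f : ℂ → ℂ) (t : ℝ) : 0 ≤ circleAverage (fun z => ‖f z‖) 0 t :=
  Real.circleAverage_nonneg_of_nonneg fun _ _ => norm_nonneg _

section Lpq

variable {ω : ℝ → ℝ} {q : ℝ} {f : ℂ → ℂ}

lemma lintegral_MpE_one_eq (hq : 0 ≤ q)
    (hf : ContinuousOn f (Metric.ball 0 1)) :
    ∫⁻ r in Ioo (0:ℝ) 1, (MpE 1 r f) ^ q * ENNReal.ofReal (r * ω r) =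
      ∫⁻ r in Ioo (0:ℝ) 1, ENNReal.ofReal
        (circleAverage (fun z => ‖f z‖) 0 r ^ q * (r * ω r)) := by
  refine setLIntegral_congr_fun measurableSet_Ioo fun r hr => ?_
  have hA := circleAverage_norm_nonneg f r
  have hs : Metric.sphere (0:ℂ) r ⊆ Metric.ball 0 1 := fun z hz => by
    rw [mem_sphere_zero_iff_norm] at hz
    rw [mem_ball_zero_iff, hz]
    exact hr.2
  rw [MpE_one_eq hr.1.le (hf.mono hs), ENNReal.ofReal_rpow_of_nonneg hA hq,
    ENNReal.ofReal_mul (p := _ ^ q) (by positivity)]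

lemma InApq.integrableOn (hω : IsRadialWeight ω) (hq : 0 < q) (hf : InApq ω 1 q f) :
    IntegrableOn (fun r => circleAverage (fun z => ‖f z‖) 0 r ^ q * (r * ω r)) (Ioo 0 1) := by
  have hfc := hf.1.continuousOn
  have hw : IntegrableOn ω (Ioo 0 1) := hω.2.mono_set Ioo_subset_Ico_self
  refine ⟨?_, ?_⟩
  · refine AEStronglyMeasurable.mul ?_ (AEStronglyMeasurable.mul ?_ hw.1)
    · exact (((continuousOn_circleAverage_norm hfc).mono Ioo_subset_Ico_self).rpow_const
        fun _ _ => Or.inr hq.le).aestronglyMeasurable measurableSet_Ioo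
    · exact continuous_id.aestronglyMeasurable
  · rw [hasFiniteIntegral_iff_ofReal]
    · rw [← lintegral_MpE_one_eq hq.le hfc]
      have := hf.2
      rw [LpqNormE, ENNReal.rpow_lt_top_iff_of_pos (by positivity)] at this
      exact this
    · refine (ae_restrict_iff' measurableSet_Ioo).2 (Eventually.of_forall fun r hr => ?_)
      have hA := circleAverage_norm_nonneg f r
      have := hω.1 r ⟨hr.1.le, hr.2⟩
      have := hr.1
      simp only [Pi.zero_apply]
      positivity

lemma InApq.toReal_rpow (hω : IsRadialWeight ω) (hq : 0 < q) (hf : InApq ω 1 q f) :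
    (LpqNormE ω 1 q f).toReal ^ q =
      ∫ r in Ioo (0:ℝ) 1, circleAverage (fun z => ‖f z‖) 0 r ^ q * (r * ω r) := by
  have hfc := hf.1.continuousOn
  rw [LpqNormE, lintegral_MpE_one_eq hq.le hfc, ← ofReal_integral_eq_lintegral_ofReal
    (hf.integrableOn hω hq), ← ENNReal.toReal_rpow, ENNReal.toReal_ofReal, ← Real.rpow_mul,
    one_div_mul_cancel hq.ne', Real.rpow_one]
  all_goals
    first
    | refine setIntegral_nonneg measurableSet_Ioo fun r hr => ?_
    | refine (ae_restrict_iff' measurableSet_Ioo).2 (Eventually.of_forall fun r hr => ?_)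
    have hA := circleAverage_norm_nonneg f r
    have := hω.1 r ⟨hr.1.le, hr.2⟩
    have := hr.1
    positivity

lemma exists_circleAverage_mul_le (hω : IsRadialWeight ω) (hD : InDhat ω) (hq : 0 < q) :
    ∃ C : ℝ, 0 < C ∧ ∀ f : ℂ → ℂ, InApq ω 1 q f → ∀ t ∈ Ico (0:ℝ) 1,
      circleAverage (fun z => ‖f z‖) 0 t * omegaHat ω t ^ (1 / q) ≤
        C * (LpqNormE ω 1 q f).toReal := by
  obtain ⟨c, hc, hW⟩ := hω.exists_le_integral_mul hD
  refine ⟨c⁻¹ ^ (1 / q), by positivity, fun f hf t ht => ?_⟩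
  have h0 := hω.omegaHat_nonneg ⟨ht.1, ht.2.le⟩
  have hA := circleAverage_norm_nonneg f t
  set A := circleAverage (fun z => ‖f z‖) 0 t
  have hN : 0 ≤ (LpqNormE ω 1 q f).toReal := ENNReal.toReal_nonneg
  have key : A ^ q * (c * omegaHat ω t) ≤ (LpqNormE ω 1 q f).toReal ^ q := by
    calc A ^ q * (c * omegaHat ω t) ≤ A ^ q * ∫ s in t..1, s * ω s := by gcongr; exact hW t ht
      _ = ∫ s in Ioo t 1, A ^ q * (s * ω s) := by
        rw [intervalIntegral.integral_of_le ht.2.le, integral_Ioc_eq_integral_Ioo,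
          integral_const_mul]
      _ ≤ ∫ s in Ioo t 1, circleAverage (fun z => ‖f z‖) 0 s ^ q * (s * ω s) := by
        refine setIntegral_mono_on ?_ ((hf.integrableOn hω hq).mono_set
          (Ioo_subset_Ioo_left ht.1)) measurableSet_Ioo fun s hs => ?_
        · refine Integrable.const_mul ?_ _
          exact (intervalIntegrable_iff_integrableOn_Ioo_of_le ht.2.le).1
            (hω.intervalIntegrable_mul continuousOn_id ⟨ht.1, ht.2.le⟩ ⟨zero_le_one, le_rfl⟩)
        · have := hω.1 s ⟨ht.1.trans hs.1.le, hs.2⟩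
          have := ht.1.trans hs.1.le
          have := circleAverage_norm_mono hf.1 ht.1 hs.1.le hs.2
          gcongr
      _ ≤ _ := by
        rw [hf.toReal_rpow hω hq]
        refine setIntegral_mono_set (hf.integrableOn hω hq) ?_
          (Ioo_subset_Ioo_left ht.1).eventuallyLE
        refine (ae_restrict_iff' measurableSet_Ioo).2 (Eventually.of_forall fun r hr => ?_)
        have := circleAverage_norm_nonneg f r
        have := hω.1 r ⟨hr.1.le, hr.2⟩
        have := hr.1
        simp only [Pi.zero_apply]
        positivity
  have h2 : A ^ q * omegaHat ω t ≤ c⁻¹ * (LpqNormE ω 1 q f).toReal ^ q := by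
    rw [inv_mul_eq_div, le_div_iff₀ hc]; linarith
  have h3 := Real.rpow_le_rpow (by positivity) h2 (by positivity : 0 ≤ 1 / q)
  rwa [Real.mul_rpow (by positivity) h0, Real.mul_rpow (by positivity) (by positivity),
    ← Real.rpow_mul hA, ← Real.rpow_mul hN, mul_one_div_cancel hq.ne', Real.rpow_one,
    Real.rpow_one] at h3

lemma LpqNormE_le_of_lintegral_le {B : ℝ} (hq : 0 < q) (hB : 0 ≤ B)
    (h : ∫⁻ r in Ioo (0:ℝ) 1, (MpE 1 r f) ^ q * ENNReal.ofReal (r * ω r) ≤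
      ENNReal.ofReal (B ^ q)) : LpqNormE ω 1 q f ≤ ENNReal.ofReal B := by
  refine (ENNReal.rpow_le_rpow h (by positivity : 0 ≤ 1 / q)).trans ?_
  rw [ENNReal.ofReal_rpow_of_nonneg (by positivity) (by positivity), ← Real.rpow_mul hB,
    mul_one_div_cancel hq.ne', Real.rpow_one]

lemma IsRadialWeight.lintegral_ofReal_mul_eq (hω : IsRadialWeight ω) {φ : ℝ → ℝ}
    (hφ : ContinuousOn φ (Icc 0 1)) (h0 : ∀ s ∈ Ioo (0:ℝ) 1, 0 ≤ φ s) :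
    ∫⁻ s in Ioo (0:ℝ) 1, ENNReal.ofReal (φ s * ω s) =
      ENNReal.ofReal (∫ s in (0:ℝ)..1, φ s * ω s) := by
  rw [intervalIntegral.integral_of_le zero_le_one, integral_Ioc_eq_integral_Ioo,
    ofReal_integral_eq_lintegral_ofReal]
  · exact (intervalIntegrable_iff_integrableOn_Ioo_of_le zero_le_one).1
      (hω.intervalIntegrable_mul hφ ⟨le_rfl, zero_le_one⟩ ⟨zero_le_one, le_rfl⟩)
  · exact (ae_restrict_iff' measurableSet_Ioo).2 (Eventually.of_forall fun s hs =>
      mul_nonneg (h0 s hs) (hω.1 s ⟨hs.1.le, hs.2⟩))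

lemma LpqNormE_le_of_MpE_le (hω : IsRadialWeight ω) (hq : 0 < q) {B : ℝ} (hB : 0 ≤ B)
    (h : ∀ s ∈ Ioo (0:ℝ) 1, MpE 1 s f ≤ ENNReal.ofReal B) :
    LpqNormE ω 1 q f ≤ ENNReal.ofReal (B * omegaHat ω 0 ^ (1 / q)) := by
  have hh := hω.omegaHat_nonneg ⟨le_rfl, zero_le_one⟩
  refine LpqNormE_le_of_lintegral_le hq (by positivity) ?_
  rw [Real.mul_rpow hB (by positivity), ← Real.rpow_mul hh, one_div_mul_cancel hq.ne',
    Real.rpow_one, omegaHat, ← intervalIntegral.integral_const_mul, ← hω.lintegral_ofReal_mul_eq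
    continuousOn_const fun _ _ => by positivity]
  refine setLIntegral_mono' measurableSet_Ioo fun s hs => ?_
  rw [ENNReal.ofReal_mul (p := B ^ q) (by positivity), ← ENNReal.ofReal_rpow_of_nonneg hB hq.le]
  have := hω.1 s ⟨hs.1.le, hs.2⟩
  gcongr
  · exact h s hs
  · exact mul_le_of_le_one_left this hs.2.le

lemma exists_LpqNormE_le (hω : IsRadialWeight ω) (hpos : ∀ r ∈ Ico (0:ℝ) 1, 0 < omegaHat ω r)
    (hq : 0 < q) :
    ∃ C : ℝ, 0 < C ∧ ∀ r ∈ Ico (0:ℝ) 1, ∀ A : ℝ, 0 ≤ A → ∀ F : ℂ → ℂ,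
      (∀ s ∈ Ioo (0:ℝ) 1, MpE 1 s F ≤
        ENNReal.ofReal (A * (omegaHat ω (r * s) ^ (1 / q) * omegaHat ω (r * s))⁻¹)) →
      LpqNormE ω 1 q F ≤ ENNReal.ofReal (C * A * (omegaHat ω r)⁻¹) := by
  have hK : 0 < 1 + (1 - (2:ℝ) ^ (-q))⁻¹ := by
    have : (2:ℝ) ^ (-q) < 1 := Real.rpow_lt_one_of_one_lt_of_neg one_lt_two (by linarith)
    have := inv_pos.2 (sub_pos.2 this)
    linarith
  refine ⟨(1 + (1 - (2:ℝ) ^ (-q))⁻¹) ^ (1 / q), by positivity, fun r hr A hA F hF => ?_⟩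
  have hv := hpos r hr
  have hcont : ContinuousOn (fun s => A ^ q * max (omegaHat ω s) (omegaHat ω r) ^ (-(q + 1)))
      (Icc 0 1) := continuousOn_const.mul <|
    (ContinuousOn.sup hω.continuousOn_omegaHat continuousOn_const).rpow_const fun s _ =>
      Or.inl (lt_of_lt_of_le hv (le_max_right _ _)).ne'
  have hm : ∀ s, 0 < max (omegaHat ω s) (omegaHat ω r) := fun s =>
    lt_of_lt_of_le hv (le_max_right _ _)
  refine LpqNormE_le_of_lintegral_le hq (by positivity) ?_
  have h1 : A ^ q * ∫ s in (0:ℝ)..1, max (omegaHat ω s) (omegaHat ω r) ^ (-(q + 1)) * ω s ≤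
      ((1 + (1 - (2:ℝ) ^ (-q))⁻¹) ^ (1 / q) * A * (omegaHat ω r)⁻¹) ^ q := by
    rw [Real.mul_rpow (by positivity) (by positivity), Real.mul_rpow (by positivity) hA,
      ← Real.rpow_mul hK.le, one_div_mul_cancel hq.ne', Real.rpow_one, Real.inv_rpow hv.le,
      ← Real.rpow_neg hv.le]
    have := mul_le_mul_of_nonneg_left (hω.integral_max_rpow_le hq hv) (Real.rpow_nonneg hA q)
    linarith
  refine le_trans ?_ (ENNReal.ofReal_le_ofReal h1)
  rw [← intervalIntegral.integral_const_mul]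
  simp_rw [← mul_assoc]
  rw [← hω.lintegral_ofReal_mul_eq hcont fun s _ => by have := hm s; positivity]
  refine setLIntegral_mono' measurableSet_Ioo fun s hs => ?_
  have hrs : r * s ∈ Ico (0:ℝ) 1 := ⟨mul_nonneg hr.1 hs.1.le, by nlinarith [hr.1, hr.2, hs.1, hs.2]⟩
  have hu := hpos _ hrs
  have hmax : max (omegaHat ω s) (omegaHat ω r) ≤ omegaHat ω (r * s) :=
    max_le (hω.omegaHat_anti hrs.1 (mul_le_of_le_one_left hs.1.le hr.2.le) hs.2.le)
      (hω.omegaHat_anti hrs.1 (mul_le_of_le_one_right hr.1 hs.2.le) hr.2.le)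
  have hms := hm s
  rw [ENNReal.ofReal_mul (p := A ^ q * _) (q := ω s) (by positivity)]
  have hws := hω.1 s ⟨hs.1.le, hs.2⟩
  refine mul_le_mul' ?_ (ENNReal.ofReal_le_ofReal (mul_le_of_le_one_left hws hs.2.le))
  refine (ENNReal.rpow_le_rpow (hF s hs) hq.le).trans ?_
  rw [ENNReal.ofReal_rpow_of_nonneg (by positivity) hq.le]
  refine ENNReal.ofReal_le_ofReal ?_
  rw [Real.mul_rpow hA (by positivity), Real.inv_rpow (by positivity),
    Real.mul_rpow (by positivity) hu.le, ← Real.rpow_mul hu.le, one_div_mul_cancel hq.ne',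
    Real.rpow_one, Real.rpow_neg hms.le, add_comm, Real.rpow_add hms, Real.rpow_one]
  gcongr

end Lpq

lemma BMOANormE_le {φ : ℂ → ℂ} (hφ : DiffContOnCl ℂ φ (Metric.ball 0 1)) {A B : ℝ} (hA : 0 ≤ A)
    (hB : 0 ≤ B) (h0 : ‖φ 0‖ ≤ A) (h : ∀ a ∈ Metric.ball (0:ℂ) 1,
      circleAverage (fun z => ‖φ (discAut a z) - φ a‖ ^ 2) 0 1 ≤ B ^ 2) :
    BMOANormE φ ≤ ENNReal.ofReal (A + B) := by
  rw [BMOANormE, ENNReal.ofReal_add hA hB]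
  refine add_le_add (ENNReal.ofReal_le_ofReal h0) (iSup₂_le fun a ha => iSup₂_le fun r hr => ?_)
  have hd : DiffContOnCl ℂ (fun z => φ (discAut a z) - φ a) (Metric.ball 0 1) :=
    (diffContOnCl_comp_discAut (mem_ball_zero_iff.1 ha) hφ).sub_const _
  refine (MpE_two_le_iff hr.1.le hB (f := fun z => φ (discAut a z) - φ a)
    (hd.continuousOn_closedBall.mono ?_)).2
    ((circleAverage_norm_sq_le hd hr.1.le hr.2.le).trans (h a ha))
  exact Metric.sphere_subset_closedBall.trans (Metric.closedBall_subset_closedBall hr.2.le)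

lemma of_BMOANormE_le {φ : ℂ → ℂ} (hφ : DiffContOnCl ℂ φ (Metric.ball 0 1)) {B : ℝ}
    (hB : 0 ≤ B) (h : BMOANormE φ ≤ ENNReal.ofReal B) :
    ‖φ 0‖ ≤ B ∧ ∀ a ∈ Metric.ball (0:ℂ) 1,
      circleAverage (fun z => ‖φ (discAut a z) - φ a‖ ^ 2) 0 1 ≤ B ^ 2 := by
  rw [BMOANormE] at h
  refine ⟨(ENNReal.ofReal_le_ofReal_iff hB).1 ((self_le_add_right _ _).trans h), fun a ha => ?_⟩
  have h2 := (self_le_add_left _ _).trans h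
  have hd : DiffContOnCl ℂ (fun z => φ (discAut a z) - φ a) (Metric.ball 0 1) :=
    (diffContOnCl_comp_discAut (mem_ball_zero_iff.1 ha) hφ).sub_const _
  have hc : ContinuousOn (fun r => circleAverage (fun z => ‖φ (discAut a z) - φ a‖ ^ 2) 0 r)
      (Icc 0 1) := by
    refine Real.ContinuousOn.circleAverage ((hd.continuousOn_closedBall.norm.pow 2).mono
      fun z hz => ?_) fun r hr => hr.1
    simpa using hz.2
  have hcl : (1:ℝ) ∈ closure (Ioo (0:ℝ) 1) := by rw [closure_Ioo zero_ne_one]; simp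
  refine ContinuousWithinAt.closure_le hcl ((hc 1 (by simp)).mono Ioo_subset_Icc_self)
    continuousWithinAt_const fun r hr => ?_
  refine (MpE_two_le_iff hr.1.le hB (f := fun z => φ (discAut a z) - φ a)
    (hd.continuousOn_closedBall.mono ?_)).1 ?_
  · exact Metric.sphere_subset_closedBall.trans (Metric.closedBall_subset_closedBall hr.2.le)
  · exact (le_iSup₂_of_le a ha (le_iSup₂_of_le (f := fun r _ => MpE 2 r (fun z =>
      φ ((a - z) / (1 - (starRingEnd ℂ) a * z)) - φ a)) r hr le_rfl)).trans h2

/-- The power series with coefficients `f̂(k) * conj (ĝ(k))`. -/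
def pairingSeries (f g : ℂ → ℂ) (x : ℂ) : ℂ :=
  ∑' k : ℕ, taylorCoeff f k * (starRingEnd ℂ) (taylorCoeff g k) * x ^ k

section Pairing

variable {f g : ℂ → ℂ}

lemma summable_pairing (hf : DifferentiableOn ℂ f (Metric.ball 0 1))
    (hg : DifferentiableOn ℂ g (Metric.ball 0 1)) (r : ℝ) (h0 : 0 ≤ r) (h1 : r < 1) :
    Summable fun k => ‖taylorCoeff f k * (starRingEnd ℂ) (taylorCoeff g k)‖ * r ^ k := by
  have hs1 : √r < 1 := by rw [Real.sqrt_lt' one_pos]; simpa using h1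
  have := Summable.mul_of_nonneg (summable_norm_taylorCoeff hf (Real.sqrt_nonneg r) hs1)
    (summable_norm_taylorCoeff hg (Real.sqrt_nonneg r) hs1) (fun k => by positivity)
    fun k => by positivity
  refine (this.comp_injective (i := fun k : ℕ => (k, k)) fun a b h => (Prod.ext_iff.1 h).1).congr
    fun k => ?_
  simp only [Function.comp, norm_mul, RCLike.norm_conj]
  have : r ^ k = √r ^ k * √r ^ k := by rw [← mul_pow, Real.mul_self_sqrt h0]
  rw [this]; ring

lemma circleAverage_dilate_mul_conj (hf : DifferentiableOn ℂ f (Metric.ball 0 1))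
    (hg : DifferentiableOn ℂ g (Metric.ball 0 1)) {r t : ℝ} (hr0 : 0 ≤ r) (hr1 : r < 1)
    (ht0 : 0 ≤ t) (ht1 : t < 1) :
    circleAverage (fun z => dilateF f r z * (starRingEnd ℂ) (dilateF g t z)) 0 1 =
      pairingSeries f g ((r * t : ℝ) : ℂ) := by
  have e : ∀ (F : ℂ → ℂ), DifferentiableOn ℂ F (Metric.ball 0 1) → ∀ s : ℝ, 0 ≤ s → s < 1 →
      ∀ z ∈ Metric.sphere (0:ℂ) |1|, dilateF F s z = ∑' k, (taylorCoeff F k * (s:ℂ) ^ k) * z ^ k :=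
    fun F hF s hs0 hs1 z hz => by
      have hz' : ‖z‖ = 1 := by simpa using hz
      have := hasSum_taylorCoeff hF (z := (s:ℂ) * z) (by
        rw [norm_mul, hz', Complex.norm_real, Real.norm_of_nonneg hs0]; linarith)
      simp_rw [mul_pow, ← mul_assoc] at this
      exact this.tsum_eq.symm
  have hsum : ∀ (F : ℂ → ℂ), DifferentiableOn ℂ F (Metric.ball 0 1) → ∀ s : ℝ, 0 ≤ s → s < 1 →
      Summable fun k => ‖taylorCoeff F k * (s:ℂ) ^ k‖ := fun F hF s hs0 hs1 => by
    simpa [abs_of_nonneg hs0] using summable_norm_taylorCoeff hF hs0 hs1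
  rw [Real.circleAverage_congr_sphere
    (f₂ := fun z => (∑' k, (taylorCoeff f k * (r:ℂ) ^ k) * z ^ k) *
    (starRingEnd ℂ) (∑' k, (taylorCoeff g k * (t:ℂ) ^ k) * z ^ k)) fun z hz => by
      simp only [e f hf r hr0 hr1 z hz, e g hg t ht0 ht1 z hz],
    circleAverage_tsum_mul_conj (hsum f hf r hr0 hr1) (hsum g hg t ht0 ht1), pairingSeries]
  refine tsum_congr fun k => ?_
  simp only [map_mul, map_pow, Complex.conj_ofReal]
  push_cast
  ring

lemma norm_pairingSeries_le (hf : DifferentiableOn ℂ f (Metric.ball 0 1))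
    (hg : DifferentiableOn ℂ g (Metric.ball 0 1)) {ρ t B : ℝ} (hρ : ρ ∈ Icc (0:ℝ) 1)
    (ht : t ∈ Ico (0:ℝ) 1) (hB : 0 ≤ B) (h : BMOANormE (dilateF g t) ≤ ENNReal.ofReal B) :
    ‖pairingSeries f g ((ρ * t ^ 2 : ℝ) : ℂ)‖ ≤ 13 * B * circleAverage (fun z => ‖f z‖) 0 t := by
  have hρt0 : 0 ≤ ρ * t := mul_nonneg hρ.1 ht.1
  have hρt : ρ * t ≤ t := mul_le_of_le_one_left ht.1 hρ.2
  obtain ⟨h0, h2⟩ := of_BMOANormE_le (hg.dilateF ht.1 ht.2) hB h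
  have h3 := norm_circleAverage_mul_conj_le (hf.dilateF hρt0 (hρt.trans_lt ht.2))
    (hg.dilateF ht.1 ht.2) hB h2
  rw [circleAverage_dilate_mul_conj hf hg hρt0 (hρt.trans_lt ht.2) ht.1 ht.2,
    show ρ * t * t = ρ * t ^ 2 by ring] at h3
  have h4 : circleAverage (fun z => ‖dilateF f (ρ * t) z‖) 0 1 =
      circleAverage (fun z => ‖f z‖) 0 (ρ * t) :=
    (circleAverage_eq_unit (fun z => ‖f z‖) (ρ * t)).symm
  rw [h4] at h3
  have h5 := circleAverage_norm_mono hf hρt0 hρt ht.2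
  have h6 := circleAverage_norm_nonneg f (ρ * t)
  refine h3.trans ?_
  gcongr
  linarith

lemma continuousOn_pairingSeries (hf : DifferentiableOn ℂ f (Metric.ball 0 1))
    (hg : DifferentiableOn ℂ g (Metric.ball 0 1)) :
    ContinuousOn (pairingSeries f g) (Metric.ball 0 1) :=
  (differentiableOn_tsum_pow (summable_pairing hf hg)).continuousOn

lemma norm_mul_momentCoeff_le {μ : ℝ → ℝ} (hμ : IsRadialWeight μ) (a : ℂ) (k : ℕ) :
    ‖a * ((momentCoeff μ k : ℝ) : ℂ)‖ ≤ ‖a‖ * momentCoeff μ 0 := by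
  have h0 : 0 ≤ momentCoeff μ k := by
    rw [momentCoeff_eq]
    exact hμ.integral_nonneg (φ := fun t => t ^ (2 * k + 1)) le_rfl zero_le_one le_rfl
      fun t ht => pow_nonneg ht.1.le _
  rw [norm_mul, Complex.norm_real, Real.norm_of_nonneg h0]
  gcongr
  exact hμ.momentCoeff_anti (Nat.zero_le k)

lemma hasSum_pairing {μ : ℝ → ℝ} (hμ : IsRadialWeight μ)
    (hf : DifferentiableOn ℂ f (Metric.ball 0 1)) (hg : DifferentiableOn ℂ g (Metric.ball 0 1))
    {ρ : ℝ} (hρ : ρ ∈ Ico (0:ℝ) 1) :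
    HasSum (fun k : ℕ => taylorCoeff f k * (starRingEnd ℂ) (taylorCoeff g k) *
      ((momentCoeff μ k : ℝ) : ℂ) * (ρ:ℂ) ^ k)
      (∫ t in Ioo (0:ℝ) 1, pairingSeries f g ((ρ * t ^ 2 : ℝ) : ℂ) * ((t * μ t : ℝ) : ℂ)) := by
  set c : ℕ → ℂ := fun k => taylorCoeff f k * (starRingEnd ℂ) (taylorCoeff g k) with hc
  have hsum := summable_pairing hf hg ρ hρ.1 hρ.2
  have hI : ∀ k : ℕ, IntegrableOn (fun t => t ^ (2 * k + 1) * μ t) (Ioo 0 1) := fun k =>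
    (intervalIntegrable_iff_integrableOn_Ioo_of_le zero_le_one).1
      (hμ.intervalIntegrable_mul (continuous_pow _).continuousOn ⟨le_rfl, zero_le_one⟩
        ⟨zero_le_one, le_rfl⟩)
  have hm : ∀ k : ℕ, ∫ t in Ioo (0:ℝ) 1, t ^ (2 * k + 1) * μ t = momentCoeff μ k := fun k => by
    rw [momentCoeff_eq, intervalIntegral.integral_of_le zero_le_one, integral_Ioc_eq_integral_Ioo]
  have key := hasSum_integral_of_summable_integral_norm (μ := volume.restrict (Ioo (0:ℝ) 1))
    (F := fun (k : ℕ) (t : ℝ) => c k * (ρ:ℂ) ^ k * ((t ^ (2 * k + 1) * μ t : ℝ) : ℂ))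
    (fun k => Integrable.const_mul (hI k).ofReal _) ?_
  · have e1 : ∀ k, ∫ t in Ioo (0:ℝ) 1, c k * (ρ:ℂ) ^ k * ((t ^ (2 * k + 1) * μ t : ℝ) : ℂ) =
        c k * ((momentCoeff μ k : ℝ) : ℂ) * (ρ:ℂ) ^ k := fun k => by
      rw [integral_const_mul, integral_complex_ofReal, hm]; ring
    simp_rw [e1] at key
    have e3 : ∀ t : ℝ, ∑' k, c k * (ρ:ℂ) ^ k * ((t ^ (2 * k + 1) * μ t : ℝ) : ℂ) =
        pairingSeries f g ((ρ * t ^ 2 : ℝ) : ℂ) * ((t * μ t : ℝ) : ℂ) := fun t => ?_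
    · simpa only [e3] using key
    simp only [pairingSeries]
    rw [← tsum_mul_right]
    refine tsum_congr fun k => ?_
    push_cast
    ring
  · have e2 : ∀ k, ∫ t in Ioo (0:ℝ) 1, ‖c k * (ρ:ℂ) ^ k * ((t ^ (2 * k + 1) * μ t : ℝ) : ℂ)‖ =
        ‖c k‖ * ρ ^ k * momentCoeff μ k := fun k => by
      rw [← hm, ← integral_const_mul]
      refine setIntegral_congr_fun measurableSet_Ioo fun t ht => ?_
      simp only [norm_mul, norm_pow, Complex.norm_real, Real.norm_eq_abs, abs_of_nonneg hρ.1,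
        abs_of_nonneg ht.1.le, abs_of_nonneg (hμ.1 t ⟨ht.1.le, ht.2⟩)]
    simp_rw [e2]
    refine Summable.of_norm_bounded (hsum.mul_right (momentCoeff μ 0)) fun k => ?_
    have := norm_mul_momentCoeff_le hμ (((‖c k‖ * ρ ^ k : ℝ) : ℂ)) k
    have h0 := hρ.1
    rwa [← Complex.ofReal_mul, Complex.norm_real, Complex.norm_real,
      Real.norm_of_nonneg (by positivity : 0 ≤ ‖c k‖ * ρ ^ k)] at this

lemma BMOANormE_dilateF_le {ω : ℝ → ℝ} (hpos : ∀ r ∈ Ico (0:ℝ) 1, 0 < omegaHat ω r)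
    (hg : XInfNormE BMOANormE ω g < ⊤) {t : ℝ} (ht : t ∈ Ioo (0:ℝ) 1) :
    BMOANormE (dilateF g t) ≤
      ENNReal.ofReal ((XInfNormE BMOANormE ω g).toReal * (omegaHat ω t)⁻¹) := by
  have hh := hpos t ⟨ht.1.le, ht.2⟩
  have h1 : BMOANormE (dilateF g t) * ENNReal.ofReal (omegaHat ω t) ≤ XInfNormE BMOANormE ω g :=
    le_iSup₂_of_le (f := fun r _ => BMOANormE (dilateF g r) * ENNReal.ofReal (omegaHat ω r)) t ht
      le_rfl
  rw [ENNReal.ofReal_mul ENNReal.toReal_nonneg, ENNReal.ofReal_toReal hg.ne,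
    ENNReal.ofReal_inv_of_pos hh, ← div_eq_mul_inv]
  exact (ENNReal.le_div_iff_mul_le (Or.inl (by simpa using hh)) (Or.inl (by simp))).2 h1

theorem exists_pairing_bound {ω : ℝ → ℝ} (hω : IsRadialWeight ω)
    (hpos : ∀ r ∈ Ico (0:ℝ) 1, 0 < omegaHat ω r) (hD : InDhat ω) {q : ℝ} (hq0 : 0 < q)
    (hq1 : q ≤ 1) :
    ∃ C : ℝ, 0 < C ∧ ∀ g : ℂ → ℂ, DifferentiableOn ℂ g (Metric.ball 0 1) →
      XInfNormE BMOANormE ω g < ⊤ → ∀ f : ℂ → ℂ, InApq ω 1 q f →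
        ∃ l : ℂ, HasPairingC (momentCoeff fun r => ω r * omegaHat ω r ^ (1 / q)) f g l ∧
          ‖l‖ ≤ C * (XInfNormE BMOANormE ω g).toReal * (LpqNormE ω 1 q f).toReal := by
  obtain ⟨C, hC, hCf⟩ := exists_circleAverage_mul_le hω hD hq0
  refine ⟨13 * C ^ (1 - q), by positivity, fun g hg hgb f hf => ?_⟩
  set μ : ℝ → ℝ := fun r => ω r * omegaHat ω r ^ (1 / q) with hμdef
  have hμ : IsRadialWeight μ := hω.mul_omegaHat_rpow (by positivity)
  set G := (XInfNormE BMOANormE ω g).toReal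
  have hG : 0 ≤ G := ENNReal.toReal_nonneg
  set N := (LpqNormE ω 1 q f).toReal with hNdef
  have hN : 0 ≤ N := ENNReal.toReal_nonneg
  set A : ℝ → ℝ := fun t => circleAverage (fun z => ‖f z‖) 0 t with hAdef
  have hA : ∀ t, 0 ≤ A t := circleAverage_norm_nonneg f
  set bound : ℝ → ℝ := fun t => 13 * G * (C * N) ^ (1 - q) * (A t ^ q * (t * ω t)) with hbound
  have hbI : IntegrableOn bound (Ioo 0 1) := (hf.integrableOn hω hq0).const_mul _
  have hle : ∀ ρ ∈ Icc (0:ℝ) 1, ∀ t ∈ Ioo (0:ℝ) 1,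
      ‖pairingSeries f g ((ρ * t ^ 2 : ℝ) : ℂ) * ((t * μ t : ℝ) : ℂ)‖ ≤ bound t :=
    fun ρ hρ t ht => by
      have ht' : t ∈ Ico (0:ℝ) 1 := ⟨ht.1.le, ht.2⟩
      have hh := hpos t ht'
      have hw := hω.1 t ht'
      have h1 := norm_pairingSeries_le hf.1 hg hρ ht' (by positivity)
        (BMOANormE_dilateF_le hpos hgb ht)
      have h2 : A t * omegaHat ω t ^ (1 / q) ≤ C * N := hCf f hf t ht'
      have h3 : A t * (omegaHat ω t)⁻¹ * omegaHat ω t ^ (1 / q) ≤ A t ^ q * (C * N) ^ (1 - q) := by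
        calc A t * (omegaHat ω t)⁻¹ * omegaHat ω t ^ (1 / q)
            = A t ^ q * (A t * omegaHat ω t ^ (1 / q)) ^ (1 - q) := by
              rw [Real.mul_rpow (hA t) (by positivity), ← Real.rpow_mul hh.le, ← mul_assoc,
                ← Real.rpow_add_of_nonneg (hA t) hq0.le (by linarith),
                show 1 / q * (1 - q) = -1 + 1 / q by field_simp; ring, Real.rpow_add hh,
                Real.rpow_neg_one]
              simp only [add_sub_cancel, Real.rpow_one]
              ring
          _ ≤ _ := by
            have := hA t
            have : 0 ≤ 1 - q := by linarith
            gcongr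
      have hμt := hμ.1 t ht'
      have ht0 := ht.1
      rw [norm_mul, Complex.norm_real, Real.norm_of_nonneg (by positivity)]
      calc _ ≤ 13 * (G * (omegaHat ω t)⁻¹) * A t * (t * μ t) := by gcongr
        _ = 13 * G * (A t * (omegaHat ω t)⁻¹ * omegaHat ω t ^ (1 / q)) * (t * ω t) := by
          rw [hμdef]; ring
        _ ≤ 13 * G * (A t ^ q * (C * N) ^ (1 - q)) * (t * ω t) := by gcongr
        _ = bound t := by rw [hbound]; ring
  have hmem : ∀ ρ ∈ Icc (0:ℝ) 1, ∀ t ∈ Ioo (0:ℝ) 1,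
      ((ρ * t ^ 2 : ℝ) : ℂ) ∈ Metric.ball (0:ℂ) 1 := fun ρ hρ t ht => by
    have h1 := hρ.1
    rw [mem_ball_zero_iff, Complex.norm_real, Real.norm_of_nonneg (by positivity)]
    nlinarith [hρ.2, ht.1, ht.2, mul_pos ht.1 ht.1]
  have hpc := continuousOn_pairingSeries hf.1 hg
  have hfilt : ∀ᶠ ρ in 𝓝[<] (1:ℝ), ρ ∈ Ico (0:ℝ) 1 :=
    mem_of_superset (Ioo_mem_nhdsLT zero_lt_one) Ioo_subset_Ico_self
  refine ⟨∫ t in Ioo (0:ℝ) 1, pairingSeries f g ((t ^ 2 : ℝ) : ℂ) * ((t * μ t : ℝ) : ℂ),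
    ⟨fun ρ hρ => (hasSum_pairing hμ hf.1 hg hρ).summable, ?_⟩, ?_⟩
  · have key : Tendsto (fun ρ : ℝ => ∫ t in Ioo (0:ℝ) 1,
        pairingSeries f g ((ρ * t ^ 2 : ℝ) : ℂ) * ((t * μ t : ℝ) : ℂ)) (𝓝[<] 1)
        (𝓝 (∫ t in Ioo (0:ℝ) 1, pairingSeries f g ((t ^ 2 : ℝ) : ℂ) * ((t * μ t : ℝ) : ℂ))) := by
      refine tendsto_integral_filter_of_dominated_convergence bound ?_ ?_ hbI ?_
      · filter_upwards [hfilt] with ρ hρ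
        refine AEStronglyMeasurable.mul ?_ ?_
        · refine (hpc.comp (by fun_prop) fun t ht => hmem ρ ⟨hρ.1, hρ.2.le⟩ t ht
            ).aestronglyMeasurable measurableSet_Ioo
        · have : IntegrableOn (fun t => t * μ t) (Ioo 0 1) :=
            (intervalIntegrable_iff_integrableOn_Ioo_of_le zero_le_one).1
              (hμ.intervalIntegrable_mul continuousOn_id ⟨le_rfl, zero_le_one⟩
                ⟨zero_le_one, le_rfl⟩)
          exact this.ofReal.1
      · filter_upwards [hfilt] with ρ hρ
        exact (ae_restrict_iff' measurableSet_Ioo).2 (Eventually.of_forall fun t ht =>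
          hle ρ ⟨hρ.1, hρ.2.le⟩ t ht)
      · refine (ae_restrict_iff' measurableSet_Ioo).2 (Eventually.of_forall fun t ht => ?_)
        refine Tendsto.mul_const _ ?_
        have hct : ContinuousAt (pairingSeries f g) ((t ^ 2 : ℝ) : ℂ) :=
          hpc.continuousAt (Metric.isOpen_ball.mem_nhds
            (by simpa using hmem 1 ⟨zero_le_one, le_rfl⟩ t ht))
        refine hct.tendsto.comp ?_
        have : Continuous fun ρ : ℝ => ((ρ * t ^ 2 : ℝ) : ℂ) := by fun_prop
        simpa using (this.tendsto 1).mono_left nhdsWithin_le_nhds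
    refine key.congr' ?_
    filter_upwards [hfilt] with ρ hρ
    exact (hasSum_pairing hμ hf.1 hg hρ).tsum_eq.symm
  · refine (norm_integral_le_of_norm_le hbI ((ae_restrict_iff' measurableSet_Ioo).2
      (Eventually.of_forall fun t ht => ?_))).trans_eq ?_
    · simpa using hle 1 ⟨zero_le_one, le_rfl⟩ t ht
    · rw [hbound, integral_const_mul, ← hf.toReal_rpow hω hq0, ← hNdef,
        Real.mul_rpow hC.le hN]
      calc _ = 13 * C ^ (1 - q) * G * (N ^ (1 - q) * N ^ q) := by ring
        _ = _ := by
          rw [← Real.rpow_add_of_nonneg hN (by linarith) hq0.le]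
          simp

end Pairing

section Dual

variable {ω : ℝ → ℝ} {q : ℝ}

/-- The coefficient multiplier `r ^ k / μ_{2k+1}`, where `μ = ω * ω̂ ^ (1 / q)`, maps `H¹` into
`A^{1,q}_ω` with norm controlled by `1 / ω̂(r)`. -/
lemma exists_LpqNormE_multiplier_le (hω : IsRadialWeight ω)
    (hpos : ∀ r ∈ Ico (0:ℝ) 1, 0 < omegaHat ω r) (hD : InDhat ω) (hq : 0 < q) :
    ∃ C : ℝ, 0 < C ∧ ∀ r ∈ Ico (0:ℝ) 1, ∀ c : ℕ → ℂ, Summable (fun k => ‖c k‖) →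
      LpqNormE ω 1 q (fun z => ∑' k : ℕ,
        ((r ^ k * (momentCoeff (fun t => ω t * omegaHat ω t ^ (1 / q)) k)⁻¹ : ℝ) : ℂ) * c k *
          z ^ k) ≤
        ENNReal.ofReal
          (C * circleAverage (fun z => ‖∑' k, c k * z ^ k‖) 0 1 * (omegaHat ω r)⁻¹) := by
  have hq' : 0 ≤ 1 / q := by positivity
  set μ : ℝ → ℝ := fun t => ω t * omegaHat ω t ^ (1 / q) with hμdef
  have hμ : IsRadialWeight μ := hω.mul_omegaHat_rpow hq'
  have hμpos : ∀ r ∈ Ico (0:ℝ) 1, 0 < omegaHat μ r := hω.omegaHat_mul_rpow_pos hq' hpos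
  have hμD : InDhat μ := hω.inDhat_mul_rpow hq' hD
  obtain ⟨C₁, hC₁, hN⟩ := exists_LpqNormE_le hω hpos hq
  obtain ⟨C₂, hC₂, hd⟩ := hμ.exists_momentCoeff_sub_le hμpos hμD
  obtain ⟨C₃, hC₃, hK⟩ := hμ.exists_inv_momentCoeff_le hμpos hμD
  set κ : ℝ := (1 / 2) ^ (1 / q) * (1 / 2) with hκ
  have hκ0 : 0 < κ := by positivity
  refine ⟨C₁ * ((16 * C₂ + 7) * C₃ * κ⁻¹), by positivity, fun r hr c hc => ?_⟩
  set I := circleAverage (fun z => ‖∑' k, c k * z ^ k‖) 0 1 with hI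
  have hI0 : 0 ≤ I := circleAverage_norm_nonneg _ _
  refine (hN r hr ((16 * C₂ + 7) * C₃ * κ⁻¹ * I) (by positivity) _ fun s hs => ?_).trans_eq
    (by congr 1; ring)
  have hrs : r * s ∈ Ico (0:ℝ) 1 :=
    ⟨mul_nonneg hr.1 hs.1.le, by nlinarith [hr.1, hr.2, hs.1, hs.2]⟩
  have hdiff : DifferentiableOn ℂ (fun z => ∑' k : ℕ,
      ((r ^ k * (momentCoeff μ k)⁻¹ : ℝ) : ℂ) * c k * z ^ k) (Metric.ball 0 1) := by
    refine differentiableOn_tsum_pow fun t ht0 ht1 => ?_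
    have hrt : r * t ∈ Ico (0:ℝ) 1 := ⟨mul_nonneg hr.1 ht0, by nlinarith [hr.1, hr.2]⟩
    refine Summable.of_norm_bounded (hc.mul_left (C₃ * (omegaHat μ ((r * t) ^ 2))⁻¹)) fun k => ?_
    have hm := (hμ.momentCoeff_pos hμpos k).le
    have hr0 := hr.1
    have := hK (r * t) hrt k
    rw [norm_mul, norm_norm, norm_mul, Complex.norm_real, Real.norm_of_nonneg (by positivity),
      Real.norm_of_nonneg (by positivity)]
    calc _ = ((r * t) ^ k * (momentCoeff μ k)⁻¹) * ‖c k‖ := by rw [mul_pow]; ring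
      _ ≤ _ := by gcongr
  have hsub : Metric.sphere (0:ℂ) s ⊆ Metric.ball 0 1 := fun z hz => by
    rw [mem_sphere_zero_iff_norm] at hz
    rw [mem_ball_zero_iff, hz]
    exact hs.2
  rw [MpE_one_eq hs.1.le (hdiff.continuousOn.mono hsub)]
  refine ENNReal.ofReal_le_ofReal ?_
  rw [circleAverage_eq_unit]
  have hy : √(r * s) ∈ Ico (0:ℝ) 1 :=
    ⟨Real.sqrt_nonneg _, by rw [Real.sqrt_lt' one_pos]; simpa using hrs.2⟩
  have hh := hpos _ hrs
  have hKK : ∀ k, √(r * s) ^ k * (momentCoeff μ k)⁻¹ ≤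
      C₃ * (κ⁻¹ * (omegaHat ω (r * s) ^ (1 / q) * omegaHat ω (r * s))⁻¹) := fun k => by
    have h1 := hK _ hy k
    rw [Real.sq_sqrt hrs.1] at h1
    refine h1.trans ?_
    rw [← mul_inv]
    have := hω.le_omegaHat_mul_rpow hq' ⟨hrs.1, hrs.2.le⟩
    gcongr
  have key := circleAverage_norm_tsum_inv_le (hμ.momentCoeff_pos hμpos)
    (fun k => hμ.momentCoeff_anti (Nat.le_succ k)) hμ.momentCoeff_convex hd hC₂ hy.1 hy.2
    (Real.sq_sqrt hrs.1).symm hKK hc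
  have e : (fun z : ℂ => ‖∑' k : ℕ, ((r ^ k * (momentCoeff μ k)⁻¹ : ℝ) : ℂ) * c k *
      ((s:ℂ) * z) ^ k‖) = fun z : ℂ => ‖∑' k : ℕ,
        (((r * s) ^ k * (momentCoeff μ k)⁻¹ : ℝ) : ℂ) * c k * z ^ k‖ := by
    funext z
    congr 1
    refine tsum_congr fun k => ?_
    push_cast
    ring
  rw [e]
  refine key.trans_eq ?_
  ring

lemma InApq.of_norm_le (hω : IsRadialWeight ω) (hq : 0 < q) {f : ℂ → ℂ}
    (hf : DifferentiableOn ℂ f (Metric.ball 0 1)) {B : ℝ} (hB : 0 ≤ B)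
    (h : ∀ z ∈ Metric.ball (0:ℂ) 1, ‖f z‖ ≤ B) :
    InApq ω 1 q f ∧ (LpqNormE ω 1 q f).toReal ≤ B * omegaHat ω 0 ^ (1 / q) := by
  have h0 := hω.omegaHat_nonneg ⟨le_rfl, zero_le_one⟩
  have key : LpqNormE ω 1 q f ≤ ENNReal.ofReal (B * omegaHat ω 0 ^ (1 / q)) := by
    refine LpqNormE_le_of_MpE_le hω hq hB fun s hs => ?_
    have hsub : Metric.sphere (0:ℂ) s ⊆ Metric.ball 0 1 := fun z hz => by
      rw [mem_sphere_zero_iff_norm] at hz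
      rw [mem_ball_zero_iff, hz]
      exact hs.2
    have hc := hf.continuousOn.mono hsub
    rw [MpE_one_eq hs.1.le hc]
    refine ENNReal.ofReal_le_ofReal ?_
    refine Real.circleAverage_mono_on_of_le_circle (hc.norm.circleIntegrable hs.1.le) fun z hz => ?_
    rw [abs_of_pos hs.1] at hz
    exact h z (hsub hz)
  exact ⟨⟨hf, key.trans_lt ENNReal.ofReal_lt_top⟩,
    ENNReal.toReal_le_of_le_ofReal (by positivity) key⟩

variable {L : (ℂ → ℂ) → ℂ} {M : ℝ}

lemma IsLinearOn.norm_sub_le (hL : IsLinearOn (InApq ω 1 q) L)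
    (hM : ∀ f, InApq ω 1 q f → ‖L f‖ ≤ M * (LpqNormE ω 1 q f).toReal) {f g : ℂ → ℂ}
    (hg : InApq ω 1 q g) (hfg : InApq ω 1 q (f - g)) :
    ‖L f - L g‖ ≤ M * (LpqNormE ω 1 q (f - g)).toReal := by
  have := hL.1 _ _ hfg hg
  rw [sub_add_cancel] at this
  rw [this, add_sub_cancel_right]
  exact hM _ hfg

lemma IsLinearOn.congr_of_eqOn (hω : IsRadialWeight ω) (hq : 0 < q)
    (hL : IsLinearOn (InApq ω 1 q) L)
    (hM : ∀ f, InApq ω 1 q f → ‖L f‖ ≤ M * (LpqNormE ω 1 q f).toReal) {f g : ℂ → ℂ}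
    (hg : InApq ω 1 q g) (h : EqOn f g (Metric.ball 0 1)) : L f = L g := by
  have hd : DifferentiableOn ℂ (f - g) (Metric.ball 0 1) :=
    (differentiableOn_const (0:ℂ)).congr fun z hz => by simp [h hz]
  obtain ⟨h1, h2⟩ := InApq.of_norm_le hω hq hd le_rfl fun z hz => by simp [h hz]
  have h3 : (LpqNormE ω 1 q (f - g)).toReal = 0 :=
    le_antisymm (by simpa using h2) ENNReal.toReal_nonneg
  have := hL.norm_sub_le hM hg h1
  rw [h3, mul_zero] at this
  exact sub_eq_zero.1 (norm_le_zero_iff.1 this)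

lemma inApq_pow (hω : IsRadialWeight ω) (hq : 0 < q) (k : ℕ) :
    InApq ω 1 q (fun z => z ^ k) ∧
      (LpqNormE ω 1 q fun z => z ^ k).toReal ≤ omegaHat ω 0 ^ (1 / q) := by
  have := InApq.of_norm_le hω hq (f := fun z => z ^ k) (by fun_prop) zero_le_one fun z hz => by
    rw [norm_pow]
    exact pow_le_one₀ (norm_nonneg z) (mem_ball_zero_iff.1 hz).le
  rwa [one_mul] at this

lemma norm_apply_pow_le (hω : IsRadialWeight ω) (hq : 0 < q) (hM0 : 0 ≤ M)
    (hM : ∀ f, InApq ω 1 q f → ‖L f‖ ≤ M * (LpqNormE ω 1 q f).toReal) (k : ℕ) :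
    ‖L fun z => z ^ k‖ ≤ M * omegaHat ω 0 ^ (1 / q) :=
  (hM _ (inApq_pow hω hq k).1).trans
    (mul_le_mul_of_nonneg_left (inApq_pow hω hq k).2 hM0)

/-- A bounded functional acts coefficientwise on absolutely convergent power series. -/
lemma IsLinearOn.hasSum_apply (hω : IsRadialWeight ω) (hq : 0 < q)
    (hL : IsLinearOn (InApq ω 1 q) L) (hM0 : 0 ≤ M)
    (hM : ∀ f, InApq ω 1 q f → ‖L f‖ ≤ M * (LpqNormE ω 1 q f).toReal) {c : ℕ → ℂ}
    (hc : Summable fun k => ‖c k‖) :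
    InApq ω 1 q (fun z => ∑' k, c k * z ^ k) ∧
      HasSum (fun k => c k * L fun z => z ^ k) (L fun z => ∑' k, c k * z ^ k) := by
  have hsub : ∀ a : ℕ → ℂ, Summable (fun k => ‖a k‖) →
      DifferentiableOn ℂ (fun z => ∑' k, a k * z ^ k) (Metric.ball 0 1) ∧
      (∀ z ∈ Metric.ball (0:ℂ) 1, ‖∑' k, a k * z ^ k‖ ≤ ∑' k, ‖a k‖) := fun a ha => by
    refine ⟨differentiableOn_tsum_pow fun r h0 h1 => ?_, fun z hz => ?_⟩
    · refine Summable.of_nonneg_of_le (fun k => by positivity) (fun k => ?_) ha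
      exact mul_le_of_le_one_right (norm_nonneg _) (pow_le_one₀ h0 h1.le)
    · refine tsum_of_norm_bounded ha.hasSum fun k => ?_
      rw [norm_mul, norm_pow]
      exact mul_le_of_le_one_right (norm_nonneg _)
        (pow_le_one₀ (norm_nonneg _) (mem_ball_zero_iff.1 hz).le)
  set F : ℂ → ℂ := fun z => ∑' k, c k * z ^ k with hF
  have hFA : InApq ω 1 q F := (InApq.of_norm_le hω hq (hsub c hc).1
    (tsum_nonneg fun k => norm_nonneg _) (hsub c hc).2).1
  have hpart : ∀ n : ℕ, InApq ω 1 q (fun z => ∑ k ∈ Finset.range n, c k * z ^ k) ∧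
      L (fun z => ∑ k ∈ Finset.range n, c k * z ^ k) =
        ∑ k ∈ Finset.range n, c k * L fun z => z ^ k := fun n => by
    have hA : ∀ n : ℕ, InApq ω 1 q (fun z => ∑ k ∈ Finset.range n, c k * z ^ k) := fun n => by
      refine (InApq.of_norm_le hω hq (by fun_prop) (B := ∑ k ∈ Finset.range n, ‖c k‖)
        (Finset.sum_nonneg fun k _ => norm_nonneg _) fun z hz => ?_).1
      refine norm_sum_le_of_le _ fun k _ => ?_
      rw [norm_mul, norm_pow]
      exact mul_le_of_le_one_right (norm_nonneg _)
        (pow_le_one₀ (norm_nonneg _) (mem_ball_zero_iff.1 hz).le)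
    refine ⟨hA n, ?_⟩
    induction n with
    | zero =>
      have := hL.2 0 _ (hA 0)
      rw [zero_smul, zero_mul] at this
      simp only [Finset.range_zero, Finset.sum_empty]
      exact this
    | succ n ih =>
      have hp := inApq_pow (ω := ω) hω hq n
      have hcp : InApq ω 1 q (c n • fun z => z ^ n) := by
        refine (InApq.of_norm_le hω hq (f := c n • fun z => z ^ n) (B := ‖c n‖)
          ((differentiableOn_pow n).const_smul (c n)) (norm_nonneg _) fun z hz => ?_).1
        simp only [Pi.smul_apply, norm_smul, norm_pow]
        exact mul_le_of_le_one_right (norm_nonneg _)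
          (pow_le_one₀ (norm_nonneg _) (mem_ball_zero_iff.1 hz).le)
      rw [Finset.sum_range_succ, ← ih, ← hL.2 _ _ hp.1, ← hL.1 _ _ (hA n) hcp]
      congr 1
      funext z
      simp [Finset.sum_range_succ]
  refine ⟨hFA, ?_⟩
  have hsumm : Summable fun k => c k * L fun z => z ^ k := by
    refine Summable.of_norm_bounded (hc.mul_right (M * omegaHat ω 0 ^ (1 / q))) fun k => ?_
    rw [norm_mul]
    exact mul_le_mul_of_nonneg_left (norm_apply_pow_le hω hq hM0 hM k) (norm_nonneg _)
  rw [hsumm.hasSum_iff_tendsto_nat, tendsto_iff_norm_sub_tendsto_zero]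
  have htail := tendsto_sum_nat_add fun k => ‖c k‖
  have hlim := (htail.mul_const (omegaHat ω 0 ^ (1 / q))).const_mul M
  rw [zero_mul, mul_zero] at hlim
  refine squeeze_zero (fun n => norm_nonneg _) (fun n => ?_) hlim
  have hdiffeq : EqOn (F - fun z => ∑ k ∈ Finset.range n, c k * z ^ k)
      (fun z => ∑' k, c (k + n) * z ^ (k + n)) (Metric.ball 0 1) := fun z hz => by
    have hs : Summable fun k => c k * z ^ k :=
      summable_mul_pow (r := 1) (by simpa using hc) (mem_ball_zero_iff.1 hz).le
    simp only [Pi.sub_apply, hF]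
    rw [← hs.sum_add_tsum_nat_add n, add_sub_cancel_left]
  obtain ⟨h1, h2⟩ := InApq.of_norm_le hω hq (f := F - fun z => ∑ k ∈ Finset.range n, c k * z ^ k)
    (B := ∑' k, ‖c (k + n)‖) (hFA.1.sub (hpart n).1.1) (tsum_nonneg fun k => norm_nonneg _)
    fun z hz => by
      rw [hdiffeq hz]
      refine tsum_of_norm_bounded ((summable_nat_add_iff n).2 hc).hasSum fun k => ?_
      rw [norm_mul, norm_pow]
      exact mul_le_of_le_one_right (norm_nonneg _)
        (pow_le_one₀ (norm_nonneg _) (mem_ball_zero_iff.1 hz).le)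
  have h3 := hL.norm_sub_le hM (hpart n).1 h1
  rw [(hpart n).2, norm_sub_rev] at h3
  exact h3.trans (mul_le_mul_of_nonneg_left h2 hM0)

end Dual

section Dilation

variable {ω : ℝ → ℝ} {q : ℝ} {f : ℂ → ℂ}

lemma tendsto_circleAverage_dilateF_sub (hf : DifferentiableOn ℂ f (Metric.ball 0 1)) {s : ℝ}
    (hs : s ∈ Ioo (0:ℝ) 1) :
    Tendsto (fun ρ => circleAverage (fun z => ‖(dilateF f ρ - f) z‖) 0 s) (𝓝[<] 1) (𝓝 0) := by
  have hcl : Metric.closedBall (0:ℂ) s ⊆ Metric.ball 0 1 := Metric.closedBall_subset_ball hs.2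
  obtain ⟨K, hK⟩ := (isCompact_closedBall (0:ℂ) s).exists_bound_of_continuousOn
    (hf.continuousOn.mono hcl)
  have hmem : ∀ θ, circleMap 0 s θ ∈ Metric.closedBall (0:ℂ) s := fun θ =>
    circleMap_mem_closedBall 0 hs.1.le θ
  have hρmem : ∀ ρ ∈ Ico (0:ℝ) 1, ∀ θ, (ρ:ℂ) * circleMap 0 s θ ∈ Metric.closedBall (0:ℂ) s :=
    fun ρ hρ θ => by
      have := hmem θ
      rw [mem_closedBall_zero_iff] at this ⊢
      rw [norm_mul, Complex.norm_real, Real.norm_of_nonneg hρ.1]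
      exact (mul_le_of_le_one_left (norm_nonneg _) hρ.2.le).trans this
  have hfilt : ∀ᶠ ρ in 𝓝[<] (1:ℝ), ρ ∈ Ico (0:ℝ) 1 :=
    mem_of_superset (Ioo_mem_nhdsLT zero_lt_one) Ioo_subset_Ico_self
  have hcomp : ∀ ρ ∈ Ico (0:ℝ) 1, Continuous fun θ => f ((ρ:ℂ) * circleMap 0 s θ) := fun ρ hρ =>
    hf.continuousOn.comp_continuous (by fun_prop) fun θ => hcl (hρmem ρ hρ θ)
  have hcomp1 : Continuous fun θ => f (circleMap 0 s θ) :=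
    hf.continuousOn.comp_continuous (by fun_prop) fun θ => hcl (hmem θ)
  have key : Tendsto (fun ρ : ℝ => ∫ θ in (0:ℝ)..2 * Real.pi,
      ‖(dilateF f ρ - f) (circleMap 0 s θ)‖) (𝓝[<] 1) (𝓝 (∫ _ in (0:ℝ)..2 * Real.pi, (0:ℝ))) := by
    refine intervalIntegral.tendsto_integral_filter_of_dominated_convergence (fun _ => K + K)
      ?_ ?_ (by simp) ?_
    · filter_upwards [hfilt] with ρ hρ
      exact ((hcomp ρ hρ).sub hcomp1).norm.aestronglyMeasurable
    · filter_upwards [hfilt] with ρ hρ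
      refine Eventually.of_forall fun θ _ => ?_
      rw [norm_norm]
      exact norm_sub_le_of_le (hK _ (hρmem ρ hρ θ)) (hK _ (hmem θ))
    · refine Eventually.of_forall fun θ _ => ?_
      have hct : ContinuousAt f (circleMap 0 s θ) :=
        hf.continuousOn.continuousAt (Metric.isOpen_ball.mem_nhds (hcl (hmem θ)))
      have h1 : Continuous fun ρ : ℝ => (ρ:ℂ) * circleMap 0 s θ := by fun_prop
      have h2 : Tendsto (fun ρ : ℝ => (ρ:ℂ) * circleMap 0 s θ) (𝓝[<] 1) (𝓝 (circleMap 0 s θ)) := by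
        simpa using (h1.tendsto 1).mono_left nhdsWithin_le_nhds
      simpa [dilateF] using ((hct.tendsto.comp h2).sub_const (f (circleMap 0 s θ))).norm
  rw [intervalIntegral.integral_zero] at key
  simpa [Real.circleAverage_def] using key.const_mul (2 * Real.pi)⁻¹

lemma circleAverage_dilateF_sub_le (hf : DifferentiableOn ℂ f (Metric.ball 0 1)) {s ρ : ℝ}
    (hs : s ∈ Ioo (0:ℝ) 1) (hρ : ρ ∈ Ico (0:ℝ) 1) :
    circleAverage (fun z => ‖(dilateF f ρ - f) z‖) 0 s ≤
      2 * circleAverage (fun z => ‖f z‖) 0 s := by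
  have hsub : Metric.sphere (0:ℂ) s ⊆ Metric.ball 0 1 := fun z hz => by
    rw [mem_sphere_zero_iff_norm] at hz
    rw [mem_ball_zero_iff, hz]
    exact hs.2
  have hc : ContinuousOn f (Metric.sphere 0 s) := hf.continuousOn.mono hsub
  have hcd : ContinuousOn (dilateF f ρ) (Metric.sphere 0 s) :=
    (hf.dilateF hρ.1 hρ.2).differentiableOn.continuousOn.mono hsub
  have h1 : circleAverage (fun z => ‖(dilateF f ρ - f) z‖) 0 s ≤
      circleAverage (fun z => ‖dilateF f ρ z‖ + ‖f z‖) 0 s :=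
    Real.circleAverage_mono ((hcd.sub hc).norm.circleIntegrable hs.1.le)
      ((hcd.norm.add hc.norm).circleIntegrable hs.1.le) fun z _ => norm_sub_le _ _
  rw [Real.circleAverage_fun_add (hcd.norm.circleIntegrable hs.1.le)
    (hc.norm.circleIntegrable hs.1.le)] at h1
  have h2 : circleAverage (fun z => ‖dilateF f ρ z‖) 0 s ≤ circleAverage (fun z => ‖f z‖) 0 s := by
    have := circleAverage_mul_eq (fun z => ‖f z‖) ρ s
    rw [show circleAverage (fun z => ‖dilateF f ρ z‖) 0 s = _ from this.symm]
    exact circleAverage_norm_mono hf (mul_nonneg hρ.1 hs.1.le)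
      (mul_le_of_le_one_left hs.1.le hρ.2.le) hs.2
  linarith

/-- Dilations converge in `A^{1,q}_ω`. -/
lemma InApq.dilateF_sub (hω : IsRadialWeight ω) (hq : 0 < q) (hf : InApq ω 1 q f) :
    (∀ ρ ∈ Ico (0:ℝ) 1, InApq ω 1 q (dilateF f ρ - f)) ∧
      Tendsto (fun ρ => (LpqNormE ω 1 q (dilateF f ρ - f)).toReal) (𝓝[<] 1) (𝓝 0) := by
  have hd : ∀ ρ ∈ Ico (0:ℝ) 1, DifferentiableOn ℂ (dilateF f ρ - f) (Metric.ball 0 1) :=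
    fun ρ hρ => (hf.1.dilateF hρ.1 hρ.2).differentiableOn.sub hf.1
  set D : ℝ → ℝ → ℝ := fun ρ s => circleAverage (fun z => ‖(dilateF f ρ - f) z‖) 0 s with hD
  have hD0 : ∀ ρ s, 0 ≤ D ρ s := fun ρ s => circleAverage_norm_nonneg _ _
  set bound : ℝ → ℝ≥0∞ := fun s => ENNReal.ofReal
    (2 ^ q * (circleAverage (fun z => ‖f z‖) 0 s ^ q * (s * ω s))) with hb
  have hle : ∀ ρ ∈ Ico (0:ℝ) 1, ∀ s ∈ Ioo (0:ℝ) 1,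
      ENNReal.ofReal (D ρ s ^ q * (s * ω s)) ≤ bound s := fun ρ hρ s hs => by
    refine ENNReal.ofReal_le_ofReal ?_
    have h1 := circleAverage_dilateF_sub_le hf.1 hs hρ
    have h2 := hω.1 s ⟨hs.1.le, hs.2⟩
    have h3 := hs.1
    have h4 := hD0 ρ s
    rw [← mul_assoc (2 ^ q), ← Real.mul_rpow zero_le_two (circleAverage_norm_nonneg _ _)]
    gcongr
  have hbfin : ∫⁻ s in Ioo (0:ℝ) 1, bound s ≠ ⊤ := by
    have := (hf.integrableOn hω hq).const_mul (2 ^ q)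
    exact this.lintegral_lt_top.ne
  have hlim : Tendsto (fun ρ => ∫⁻ s in Ioo (0:ℝ) 1, ENNReal.ofReal (D ρ s ^ q * (s * ω s)))
      (𝓝[<] 1) (𝓝 (∫⁻ _ in Ioo (0:ℝ) 1, 0)) := by
    have hfilt : ∀ᶠ ρ in 𝓝[<] (1:ℝ), ρ ∈ Ico (0:ℝ) 1 :=
      mem_of_superset (Ioo_mem_nhdsLT zero_lt_one) Ioo_subset_Ico_self
    refine tendsto_lintegral_filter_of_dominated_convergence' bound ?_ ?_ hbfin ?_
    · filter_upwards [hfilt] with ρ hρ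
      refine AEMeasurable.ennreal_ofReal ?_
      refine AEMeasurable.mul ?_ (AEMeasurable.mul aemeasurable_id
        (hω.2.mono_set Ioo_subset_Ico_self).1.aemeasurable)
      exact ((((continuousOn_circleAverage_norm (hd ρ hρ).continuousOn).mono
        Ioo_subset_Ico_self).rpow_const fun _ _ => Or.inr hq.le).aestronglyMeasurable
          measurableSet_Ioo).aemeasurable
    · filter_upwards [hfilt] with ρ hρ
      exact (ae_restrict_iff' measurableSet_Ioo).2 (Eventually.of_forall fun s hs => hle ρ hρ s hs)
    · refine (ae_restrict_iff' measurableSet_Ioo).2 (Eventually.of_forall fun s hs => ?_)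
      have h1 := ((tendsto_circleAverage_dilateF_sub hf.1 hs).rpow_const
        (Or.inr hq.le : (0:ℝ) ≠ 0 ∨ 0 ≤ q)).mul_const (s * ω s)
      rw [Real.zero_rpow hq.ne', zero_mul] at h1
      have h2 := ENNReal.tendsto_ofReal h1
      rw [ENNReal.ofReal_zero] at h2
      exact h2
  have heq : ∀ ρ ∈ Ico (0:ℝ) 1, LpqNormE ω 1 q (dilateF f ρ - f) =
      (∫⁻ s in Ioo (0:ℝ) 1, ENNReal.ofReal (D ρ s ^ q * (s * ω s))) ^ (1 / q) := fun ρ hρ => by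
    rw [LpqNormE, lintegral_MpE_one_eq hq.le (hd ρ hρ).continuousOn]
  refine ⟨fun ρ hρ => ⟨hd ρ hρ, ?_⟩, ?_⟩
  · rw [heq ρ hρ]
    refine ENNReal.rpow_lt_top_of_nonneg (by positivity) (ne_top_of_le_ne_top hbfin ?_)
    exact setLIntegral_mono' measurableSet_Ioo fun s hs => hle ρ hρ s hs
  · have h2 := (ENNReal.continuous_rpow_const (y := 1 / q)).tendsto _ |>.comp hlim
    rw [lintegral_zero, ENNReal.zero_rpow_of_pos (by positivity)] at h2
    have h3 := (ENNReal.tendsto_toReal ENNReal.zero_ne_top).comp h2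
    rw [ENNReal.toReal_zero] at h3
    refine h3.congr' ?_
    filter_upwards [mem_of_superset (Ioo_mem_nhdsLT (zero_lt_one (α := ℝ))) Ioo_subset_Ico_self]
      with ρ hρ
    simp only [Function.comp, heq ρ hρ]

/-- The values of a bounded functional are recovered from its values on monomials. -/
lemma IsLinearOn.tendsto_tsum_taylorCoeff {L : (ℂ → ℂ) → ℂ} {M : ℝ} (hω : IsRadialWeight ω)
    (hq : 0 < q) (hL : IsLinearOn (InApq ω 1 q) L) (hM0 : 0 ≤ M)
    (hM : ∀ f, InApq ω 1 q f → ‖L f‖ ≤ M * (LpqNormE ω 1 q f).toReal) (hf : InApq ω 1 q f) :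
    (∀ ρ ∈ Ico (0:ℝ) 1, Summable fun k => taylorCoeff f k * (ρ:ℂ) ^ k * L fun z => z ^ k) ∧
    Tendsto (fun ρ : ℝ => ∑' k, taylorCoeff f k * (ρ:ℂ) ^ k * L fun z => z ^ k) (𝓝[<] 1)
      (𝓝 (L f)) := by
  have hsum : ∀ ρ ∈ Ico (0:ℝ) 1, HasSum (fun k => taylorCoeff f k * (ρ:ℂ) ^ k * L fun z => z ^ k)
      (L (dilateF f ρ)) := fun ρ hρ => by
    have hs : Summable fun k => ‖taylorCoeff f k * (ρ:ℂ) ^ k‖ := by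
      simpa [abs_of_nonneg hρ.1] using summable_norm_taylorCoeff hf.1 hρ.1 hρ.2
    obtain ⟨h1, h2⟩ := hL.hasSum_apply hω hq hM0 hM hs
    rwa [hL.congr_of_eqOn hω hq hM (f := dilateF f ρ) h1 fun z hz => ?_]
    have := hasSum_taylorCoeff hf.1 (z := (ρ:ℂ) * z) (by
      rw [norm_mul, Complex.norm_real, Real.norm_of_nonneg hρ.1]
      have := mem_ball_zero_iff.1 hz
      nlinarith [hρ.1, hρ.2, norm_nonneg z])
    simp_rw [mul_pow, ← mul_assoc] at this
    exact this.tsum_eq.symm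
  refine ⟨fun ρ hρ => (hsum ρ hρ).summable, ?_⟩
  have hfilt : ∀ᶠ ρ in 𝓝[<] (1:ℝ), ρ ∈ Ico (0:ℝ) 1 :=
    mem_of_superset (Ioo_mem_nhdsLT zero_lt_one) Ioo_subset_Ico_self
  have h : Tendsto (fun ρ : ℝ => L (dilateF f ρ)) (𝓝[<] 1) (𝓝 (L f)) := by
    rw [tendsto_iff_norm_sub_tendsto_zero]
    have hlim := (hf.dilateF_sub hω hq).2.const_mul M
    rw [mul_zero] at hlim
    refine squeeze_zero' (Eventually.of_forall fun _ => norm_nonneg _) ?_ hlim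
    filter_upwards [hfilt] with ρ hρ
    exact hL.norm_sub_le hM hf ((hf.dilateF_sub hω hq).1 ρ hρ)
  refine h.congr' ?_
  filter_upwards [hfilt] with ρ hρ
  exact (hsum ρ hρ).tsum_eq.symm

end Dilation

section Oscillation

variable {h : ℂ → ℂ} {a : ℂ} {R : ℝ}

/-- The analytic function agreeing with `P_a (h - h(a))` on the unit circle. -/
lemma exists_differentiableOn_eq_poissonKernel_mul (hR : 1 < R)
    (hh : DifferentiableOn ℂ h (Metric.ball 0 R)) (ha : ‖a‖ < 1) :
    ∃ R' : ℝ, ∃ F : ℂ → ℂ, 1 < R' ∧ DifferentiableOn ℂ F (Metric.ball 0 R') ∧ F 0 = 0 ∧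
      ∀ z ∈ Metric.sphere (0:ℂ) 1, F z = poissonKernel 0 a z * (h z - h a) := by
  have ha0 := norm_nonneg a
  refine ⟨min R (2 / (1 + ‖a‖)),
    fun z => dslope h a z * (((1 - ‖a‖ ^ 2 : ℝ) : ℂ) * z / (1 - (starRingEnd ℂ) a * z)),
    lt_min hR ((one_lt_div (by positivity)).2 (by linarith)), ?_, by simp, fun z hz => ?_⟩
  · refine DifferentiableOn.mul ?_ (DifferentiableOn.div (by fun_prop) (by fun_prop) fun z hz => ?_)
    · exact ((Complex.differentiableOn_dslope (Metric.isOpen_ball.mem_nhds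
        (mem_ball_zero_iff.2 (ha.trans hR)))).2 hh).mono
          (Metric.ball_subset_ball (min_le_left _ _))
    · have hz2 : ‖z‖ < 2 / (1 + ‖a‖) := (mem_ball_zero_iff.1 hz).trans_le (min_le_right _ _)
      rw [lt_div_iff₀ (by positivity)] at hz2
      intro h0
      have h1 : ‖(starRingEnd ℂ) a * z‖ = 1 := by rw [← sub_eq_zero.1 h0]; simp
      rw [norm_mul, RCLike.norm_conj] at h1
      nlinarith [norm_nonneg z]
  · have hz1 : ‖z‖ = 1 := mem_sphere_zero_iff_norm.1 hz
    have hza : z ≠ a := by rintro rfl; linarith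
    have hne : z - a ≠ 0 := sub_ne_zero.2 hza
    have hz0 : z ≠ 0 := by rintro rfl; simp at hz1
    have hzz : z * (starRingEnd ℂ) z = 1 := by rw [Complex.mul_conj']; simp [hz1]
    have h1 : 1 - (starRingEnd ℂ) a * z = z * (starRingEnd ℂ) (z - a) := by
      rw [map_sub, mul_sub, hzz]; ring
    have hc : (starRingEnd ℂ) (z - a) ≠ 0 := by simpa [← map_sub] using hne
    have h2 : ((‖z - a‖ ^ 2 : ℝ) : ℂ) = (z - a) * (starRingEnd ℂ) (z - a) := by
      rw [Complex.mul_conj']; push_cast; rfl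
    change dslope h a z * _ = _
    rw [dslope_of_ne _ hza, slope_def_field, poissonKernel_def, sub_zero, sub_zero, hz1, h1,
      Complex.ofReal_div, h2, one_pow]
    field_simp

/-- The mean oscillation of `h` over the hyperbolic disc centred at `a`, expressed by duality. -/
lemma exists_circleAverage_sq_eq (hR : 1 < R) (hh : DifferentiableOn ℂ h (Metric.ball 0 R))
    (ha : ‖a‖ < 1) :
    ∃ R' : ℝ, ∃ F : ℂ → ℂ, 1 < R' ∧ DifferentiableOn ℂ F (Metric.ball 0 R') ∧
      circleAverage (fun z => ‖h (discAut a z) - h a‖ ^ 2) 0 1 =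
        (circleAverage (fun z => F z * (starRingEnd ℂ) (h z)) 0 1).re ∧
      circleAverage (fun z => ‖F z‖) 0 1 ^ 2 ≤
        circleAverage (fun z => ‖h (discAut a z) - h a‖ ^ 2) 0 1 := by
  obtain ⟨R', F, hR', hF, hF0, hFz⟩ := exists_differentiableOn_eq_poissonKernel_mul hR hh ha
  have hcl : ∀ {ρ : ℝ} {f : ℂ → ℂ}, 1 < ρ → DifferentiableOn ℂ f (Metric.ball 0 ρ) →
      DiffContOnCl ℂ f (Metric.ball 0 1) := fun {ρ f} hρ hf => by
    refine DifferentiableOn.diffContOnCl (hf.mono ?_)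
    rw [closure_ball _ one_ne_zero]
    exact Metric.closedBall_subset_ball hρ
  have hhc := (hcl hR hh).continuousOn_sphere
  have hFc := (hcl hR' hF).continuousOn_sphere
  refine ⟨R', F, hR', hF, ?_, ?_⟩
  · rw [circleAverage_comp_discAut ha (u := fun z => ‖h z - h a‖ ^ 2) (by fun_prop)]
    have hFconj : ContinuousOn (fun z => F z * (starRingEnd ℂ) (h z)) (Metric.sphere 0 1) :=
      hFc.mul (Complex.continuous_conj.comp_continuousOn hhc)
    have hFconst : DiffContOnCl ℂ (fun z => F z * (starRingEnd ℂ) (h a)) (Metric.ball 0 1) :=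
      (hcl hR' hF).smul diffContOnCl_const
    have e1 : circleAverage (fun z => poissonKernel 0 a z * ‖h z - h a‖ ^ 2) 0 1 =
        circleAverage (fun z => (F z * (starRingEnd ℂ) (h z)).re -
          (F z * (starRingEnd ℂ) (h a)).re) 0 1 := by
      refine Real.circleAverage_congr_sphere fun z hz => ?_
      rw [abs_one] at hz
      rw [← Complex.sub_re, ← mul_sub, ← map_sub, hFz z hz, mul_assoc, Complex.mul_conj',
        ← Complex.ofReal_pow, ← Complex.ofReal_mul, Complex.ofReal_re]
    rw [e1, Real.circleAverage_fun_sub (f₁ := fun z => (F z * (starRingEnd ℂ) (h z)).re)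
      (f₂ := fun z => (F z * (starRingEnd ℂ) (h a)).re)
      (circleIntegrable_of_sphere (Complex.continuous_re.comp_continuousOn hFconj))
      (circleIntegrable_of_sphere
        (Complex.continuous_re.comp_continuousOn hFconst.continuousOn_sphere)),
      circleAverage_re_of_diffContOnCl hFconst zero_le_one le_rfl, hF0, zero_mul, Complex.zero_re,
      sub_zero]
    exact circleAverage_re (circleIntegrable_of_sphere hFconj)
  · have hosc : ContinuousOn (fun z => ‖h (discAut a z) - h a‖) (Metric.sphere 0 1) :=
      ((diffContOnCl_comp_discAut ha (hcl hR hh)).continuousOn_sphere.sub continuousOn_const).norm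
    have e1 : circleAverage (fun z => ‖F z‖) 0 1 =
        circleAverage (fun z => ‖h (discAut a z) - h a‖) 0 1 := by
      rw [circleAverage_comp_discAut ha (u := fun z => ‖h z - h a‖) (by fun_prop)]
      refine Real.circleAverage_congr_sphere fun z hz => ?_
      rw [abs_one] at hz
      rw [hFz z hz, norm_mul, Complex.norm_real, Real.norm_of_nonneg (poissonKernel_nonneg ha hz)]
    rw [e1]
    set u : ℂ → ℝ := fun z => ‖h (discAut a z) - h a‖
    set A := circleAverage u 0 1
    have h1 : 0 ≤ circleAverage (fun z => (u z ^ 2 - (2 * A) • u z) + A ^ 2) 0 1 :=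
      Real.circleAverage_nonneg_of_nonneg fun z _ => by
        have := sq_nonneg (u z - A)
        simp only [smul_eq_mul]; nlinarith
    have hu2 : CircleIntegrable (fun z => u z ^ 2) 0 1 := circleIntegrable_of_sphere (hosc.pow 2)
    have hu1 : CircleIntegrable (fun z => (2 * A) • u z) 0 1 :=
      circleIntegrable_of_sphere (ContinuousOn.const_smul hosc (2 * A))
    rw [Real.circleAverage_fun_add (f₁ := fun z => u z ^ 2 - (2 * A) • u z) (hu2.sub hu1)
        (circleIntegrable_const _ _ _),
      Real.circleAverage_fun_sub hu2 hu1, Real.circleAverage_fun_smul, Real.circleAverage_const,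
      smul_eq_mul] at h1
    change A ^ 2 ≤ circleAverage (fun z => u z ^ 2) 0 1
    nlinarith

end Oscillation

section Dual

variable {ω : ℝ → ℝ} {q : ℝ}

/-- The dilations of the function representing a bounded functional have mean oscillation
controlled by the norm of the functional. -/
lemma exists_circleAverage_sq_le_of_functional (hω : IsRadialWeight ω)
    (hpos : ∀ r ∈ Ico (0:ℝ) 1, 0 < omegaHat ω r) (hD : InDhat ω) (hq : 0 < q) :
    ∃ C : ℝ, 0 < C ∧ ∀ L : (ℂ → ℂ) → ℂ, IsLinearOn (InApq ω 1 q) L → ∀ M : ℝ, 0 ≤ M →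
      (∀ f, InApq ω 1 q f → ‖L f‖ ≤ M * (LpqNormE ω 1 q f).toReal) →
      ∀ g : ℂ → ℂ, DifferentiableOn ℂ g (Metric.ball 0 1) →
      (∀ k, taylorCoeff g k = (starRingEnd ℂ) (L fun z => z ^ k) *
        ((momentCoeff (fun t => ω t * omegaHat ω t ^ (1 / q)) k)⁻¹ : ℝ)) →
      ∀ r ∈ Ioo (0:ℝ) 1, ∀ a ∈ Metric.ball (0:ℂ) 1,
        circleAverage (fun z => ‖dilateF g r (discAut a z) - dilateF g r a‖ ^ 2) 0 1 ≤
          (M * C * (omegaHat ω r)⁻¹) ^ 2 := by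
  have hq' : 0 ≤ 1 / q := by positivity
  set m := momentCoeff fun t => ω t * omegaHat ω t ^ (1 / q) with hm
  have hmpos : ∀ k, 0 < m k :=
    (hω.mul_omegaHat_rpow hq').momentCoeff_pos (hω.omegaHat_mul_rpow_pos hq' hpos)
  obtain ⟨K, -, hK⟩ := (hω.mul_omegaHat_rpow hq').exists_inv_momentCoeff_le
    (hω.omegaHat_mul_rpow_pos hq' hpos) (hω.inDhat_mul_rpow hq' hD)
  obtain ⟨C, hC, hCL⟩ := exists_LpqNormE_multiplier_le hω hpos hD hq
  refine ⟨C, hC, fun L hL M hM0 hM g hg hgk r hr a ha => ?_⟩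
  have hr1 : 1 < r⁻¹ := (one_lt_inv₀ hr.1).2 hr.2
  have hrI : r ∈ Ico (0:ℝ) 1 := ⟨hr.1.le, hr.2⟩
  have hh : DifferentiableOn ℂ (dilateF g r) (Metric.ball 0 r⁻¹) := by
    refine hg.comp (by fun_prop) fun z hz => ?_
    rw [mem_ball_zero_iff] at hz ⊢
    rw [norm_mul, Complex.norm_real, Real.norm_of_nonneg hr.1.le]
    calc r * ‖z‖ < r * r⁻¹ := mul_lt_mul_of_pos_left hz hr.1
      _ = 1 := mul_inv_cancel₀ hr.1.ne'
  obtain ⟨R, F, hR, hF, hN, hA⟩ := exists_circleAverage_sq_eq hr1 hh (mem_ball_zero_iff.1 ha)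
  set b : ℕ → ℂ := fun k => taylorCoeff g k * (r:ℂ) ^ k with hb
  have hbs : Summable fun k => ‖b k‖ := by
    simpa [hb, abs_of_pos hr.1] using summable_norm_taylorCoeff hg hr.1.le hr.2
  have hFs : Summable fun k => ‖taylorCoeff F k‖ := by
    simpa using summable_norm_taylorCoeff hF zero_le_one hR
  have hFz : ∀ z ∈ Metric.sphere (0:ℂ) 1, ∑' k, taylorCoeff F k * z ^ k = F z := fun z hz =>
    (hasSum_taylorCoeff hF (by rwa [mem_sphere_zero_iff_norm.1 hz])).tsum_eq
  have hgz : ∀ z ∈ Metric.sphere (0:ℂ) 1, ∑' k, b k * z ^ k = dilateF g r z := fun z hz => by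
    have := (hasSum_taylorCoeff hg (z := (r:ℂ) * z) (by
      rw [norm_mul, mem_sphere_zero_iff_norm.1 hz]; simpa [abs_of_pos hr.1] using hr.2)).tsum_eq
    simp_rw [mul_pow, ← mul_assoc] at this
    exact this
  set c : ℕ → ℂ := fun k => ((r ^ k * (m k)⁻¹ : ℝ) : ℂ) * taylorCoeff F k with hc
  have hcs : Summable fun k => ‖c k‖ := by
    refine Summable.of_nonneg_of_le (fun k => norm_nonneg _) (fun k => ?_) (hFs.mul_left
      (K * (omegaHat (fun t => ω t * omegaHat ω t ^ (1 / q)) (r ^ 2))⁻¹))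
    have := hmpos k
    rw [hc, norm_mul, Complex.norm_real, Real.norm_of_nonneg
      (mul_nonneg (pow_nonneg hr.1.le _) (inv_nonneg.2 this.le))]
    exact mul_le_mul_of_nonneg_right (hK r hrI k) (norm_nonneg _)
  obtain ⟨hcA, hcL⟩ := hL.hasSum_apply hω hq hM0 hM hcs
  have e1 : circleAverage (fun z => F z * (starRingEnd ℂ) (dilateF g r z)) 0 1 =
      L fun z => ∑' k, c k * z ^ k := by
    rw [← hcL.tsum_eq]
    trans circleAverage (fun z => (∑' k, taylorCoeff F k * z ^ k) *
      (starRingEnd ℂ) (∑' k, b k * z ^ k)) 0 1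
    · refine Real.circleAverage_congr_sphere fun z hz => ?_
      rw [abs_one] at hz
      simp only [hFz z hz, hgz z hz]
    · rw [circleAverage_tsum_mul_conj hFs hbs]
      refine tsum_congr fun k => ?_
      simp only [hb, hc, hgk, map_mul, map_pow, Complex.conj_conj, Complex.conj_ofReal]
      push_cast
      ring
  have e2 : circleAverage (fun z => ‖∑' k, taylorCoeff F k * z ^ k‖) 0 1 =
      circleAverage (fun z => ‖F z‖) 0 1 := by
    refine Real.circleAverage_congr_sphere fun z hz => ?_
    rw [abs_one] at hz
    simp only [hFz z hz]
  have h1 := hCL r hrI _ hFs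
  rw [e2] at h1
  set A := circleAverage (fun z => ‖F z‖) 0 1
  have hA0 : 0 ≤ A := circleAverage_norm_nonneg F 1
  have hh0 := hpos r hrI
  have h2 := ENNReal.toReal_le_of_le_ofReal (by positivity) h1
  have h3 : (L fun z => ∑' k, c k * z ^ k).re ≤ M * (C * A * (omegaHat ω r)⁻¹) :=
    (Complex.re_le_norm _).trans ((hM _ hcA).trans (mul_le_mul_of_nonneg_left h2 hM0))
  rw [← e1, ← hN] at h3
  nlinarith [sq_nonneg (M * C * (omegaHat ω r)⁻¹ - A)]

/-- The bound of a functional is nonnegative. -/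
lemma nonneg_of_functional_bound (hω : IsRadialWeight ω)
    (hpos : ∀ r ∈ Ico (0:ℝ) 1, 0 < omegaHat ω r) (hD : InDhat ω) (hq : 0 < q)
    {L : (ℂ → ℂ) → ℂ} {M : ℝ}
    (hM : ∀ f, InApq ω 1 q f → ‖L f‖ ≤ M * (LpqNormE ω 1 q f).toReal) : 0 ≤ M := by
  obtain ⟨C, hC, hCf⟩ := exists_circleAverage_mul_le hω hD hq
  have h1 := hCf _ (inApq_pow hω hq 0).1 0 ⟨le_rfl, one_pos⟩
  have h2 := hM _ (inApq_pow hω hq 0).1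
  have h3 : 0 < omegaHat ω 0 ^ (1 / q) := Real.rpow_pos_of_pos (hpos 0 ⟨le_rfl, one_pos⟩) _
  simp only [pow_zero, norm_one, Real.circleAverage_const, one_mul] at h1 h2
  have h4 := pos_of_mul_pos_right (h3.trans_le h1) hC.le
  exact nonneg_of_mul_nonneg_left ((norm_nonneg _).trans h2) h4

/-- Every bounded functional on `A^{1,q}_ω` is represented by a function in `BMOA(∞,ω)`. -/
lemma exists_representation (hω : IsRadialWeight ω)
    (hpos : ∀ r ∈ Ico (0:ℝ) 1, 0 < omegaHat ω r) (hD : InDhat ω) (hq : 0 < q) :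
    ∃ C : ℝ, 0 < C ∧ ∀ L : (ℂ → ℂ) → ℂ, IsLinearOn (InApq ω 1 q) L →
      (∃ M : ℝ, ∀ f, InApq ω 1 q f → ‖L f‖ ≤ M * (LpqNormE ω 1 q f).toReal) →
      ∃ g : ℂ → ℂ, DifferentiableOn ℂ g (Metric.ball 0 1) ∧
        XInfNormE BMOANormE ω g < ⊤ ∧
        (∀ f, InApq ω 1 q f →
          HasPairingC (momentCoeff fun r => ω r * omegaHat ω r ^ (1 / q)) f g (L f)) ∧
        ∀ M : ℝ, (∀ f, InApq ω 1 q f → ‖L f‖ ≤ M * (LpqNormE ω 1 q f).toReal) →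
          (XInfNormE BMOANormE ω g).toReal ≤ C * M := by
  have hq' : 0 ≤ 1 / q := by positivity
  set m := momentCoeff fun t => ω t * omegaHat ω t ^ (1 / q) with hm
  have hmpos : ∀ k, 0 < m k :=
    (hω.mul_omegaHat_rpow hq').momentCoeff_pos (hω.omegaHat_mul_rpow_pos hq' hpos)
  obtain ⟨K, -, hK⟩ := (hω.mul_omegaHat_rpow hq').exists_inv_momentCoeff_le
    (hω.omegaHat_mul_rpow_pos hq' hpos) (hω.inDhat_mul_rpow hq' hD)
  obtain ⟨C, hC, hCL⟩ := exists_circleAverage_sq_le_of_functional hω hpos hD hq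
  have hh0 : 0 < omegaHat ω 0 := hpos 0 ⟨le_rfl, one_pos⟩
  have hm0 := hmpos 0
  set A := omegaHat ω 0 ^ (1 / q) * (m 0)⁻¹ with hAdef
  have hA : 0 < A := by positivity
  refine ⟨A * omegaHat ω 0 + C, by positivity, fun L hL ⟨M₀, hM₀⟩ => ?_⟩
  set b : ℕ → ℂ := fun k => (starRingEnd ℂ) (L fun z => z ^ k) * ((m k)⁻¹ : ℝ) with hb
  have hbn : ∀ k, ‖b k‖ = ‖L fun z => z ^ k‖ * (m k)⁻¹ := fun k => by
    rw [hb, norm_mul, RCLike.norm_conj, Complex.norm_real,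
      Real.norm_of_nonneg (inv_nonneg.2 (hmpos k).le)]
  have hM₀0 := nonneg_of_functional_bound hω hpos hD hq hM₀
  have hbs : ∀ r, 0 ≤ r → r < 1 → Summable fun k => ‖b k‖ * r ^ k := fun r h0 h1 => by
    obtain ⟨y, hy0, hy1, hyr⟩ : ∃ y : ℝ, 0 ≤ y ∧ y < 1 ∧ y * y = r :=
      ⟨√r, Real.sqrt_nonneg r, by rw [Real.sqrt_lt' one_pos]; simpa, Real.mul_self_sqrt h0⟩
    refine Summable.of_nonneg_of_le (fun k => by positivity) (fun k => ?_)
      ((summable_geometric_of_lt_one hy0 hy1).mul_left (M₀ * omegaHat ω 0 ^ (1 / q) *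
        (K * (omegaHat (fun t => ω t * omegaHat ω t ^ (1 / q)) (y ^ 2))⁻¹)))
    have h2 := norm_apply_pow_le hω hq hM₀0 hM₀ k
    have h3 := hK y ⟨hy0, hy1⟩ k
    have h4 := hmpos k
    rw [hbn, ← hyr, mul_pow]
    calc ‖L fun z => z ^ k‖ * (m k)⁻¹ * (y ^ k * y ^ k)
        = ‖L fun z => z ^ k‖ * (y ^ k * (m k)⁻¹) * y ^ k := by ring
      _ ≤ _ := by gcongr
  set g : ℂ → ℂ := fun z => ∑' k, b k * z ^ k with hg
  have hgd : DifferentiableOn ℂ g (Metric.ball 0 1) := differentiableOn_tsum_pow hbs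
  have hgk : ∀ k, taylorCoeff g k = b k := taylorCoeff_tsum one_pos hbs
  have hnorm : ∀ M : ℝ, (∀ f, InApq ω 1 q f → ‖L f‖ ≤ M * (LpqNormE ω 1 q f).toReal) →
      XInfNormE BMOANormE ω g ≤ ENNReal.ofReal ((A * omegaHat ω 0 + C) * M) := fun M hM => by
    have hM0 := nonneg_of_functional_bound hω hpos hD hq hM
    refine iSup₂_le fun r hr => ?_
    have hhr : 0 < omegaHat ω r := hpos r ⟨hr.1.le, hr.2⟩
    have h0 : ‖dilateF g r 0‖ ≤ M * A := by
      have : g 0 = b 0 := by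
        rw [← hgk 0]; simp [taylorCoeff]
      rw [dilateF_zero, this, hbn, hAdef, ← mul_assoc]
      exact mul_le_mul_of_nonneg_right (norm_apply_pow_le hω hq hM0 hM 0) (inv_nonneg.2 hm0.le)
    have h1 := BMOANormE_le (hgd.dilateF hr.1.le hr.2) (by positivity)
      (B := M * C * (omegaHat ω r)⁻¹) (by positivity) h0 (hCL L hL M hM0 hM g hgd hgk r hr)
    refine (mul_le_mul_left h1 _).trans ?_
    rw [← ENNReal.ofReal_mul (by positivity)]
    refine ENNReal.ofReal_le_ofReal ?_
    have h2 : omegaHat ω r ≤ omegaHat ω 0 :=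
      hω.omegaHat_anti le_rfl hr.1.le hr.2.le
    calc (M * A + M * C * (omegaHat ω r)⁻¹) * omegaHat ω r
        = M * A * omegaHat ω r + M * C := by field_simp
      _ ≤ M * A * omegaHat ω 0 + M * C := by gcongr
      _ = _ := by ring
  refine ⟨g, hgd, (hnorm M₀ hM₀).trans_lt ENNReal.ofReal_lt_top, fun f hf => ?_, fun M hM => ?_⟩
  · obtain ⟨h1, h2⟩ := hL.tendsto_tsum_taylorCoeff hω hq hM₀0 hM₀ hf
    have e : ∀ (ρ : ℝ) (k : ℕ), taylorCoeff f k * (starRingEnd ℂ) (taylorCoeff g k) *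
        ((m k : ℝ) : ℂ) * (ρ:ℂ) ^ k = taylorCoeff f k * (ρ:ℂ) ^ k * L fun z => z ^ k :=
      fun ρ k => by
        have : ((m k : ℝ) : ℂ) ≠ 0 := Complex.ofReal_ne_zero.2 (hmpos k).ne'
        rw [hgk, hb]
        rw [map_mul, Complex.conj_conj, Complex.conj_ofReal, Complex.ofReal_inv]
        field_simp
    simp only [HasPairingC, e]
    exact ⟨h1, h2⟩
  · have hM0 := nonneg_of_functional_bound hω hpos hD hq hM
    exact ENNReal.toReal_le_of_le_ofReal (by positivity) (hnorm M hM)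

end Dual

/-- For `ω ∈ D̂` and `0<q≤1`, `(A^{1,q}_ω)* ≃ BMOA(∞,ω)` under the
`A²_{μ_q}`-pairing, `μ_q = ω ω̂^{1/q}`, with equivalence of norms. -/
theorem duality_A1q_qsmall
    (ω : ℝ → ℝ) (hω : IsRadialWeight ω)
    (hpos : ∀ r ∈ Set.Ico (0:ℝ) 1, 0 < omegaHat ω r)
    (hD : InDhat ω)
    (q : ℝ) (hq0 : 0 < q) (hq1 : q ≤ 1)
    (μq : ℝ → ℝ) (hμq : μq = fun r => ω r * omegaHat ω r ^ (1 / q)) :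
    ∃ C₁ > (0:ℝ), ∃ C₂ > (0:ℝ),
      (∀ g : ℂ → ℂ, DifferentiableOn ℂ g (Metric.ball 0 1) →
        XInfNormE BMOANormE ω g < ⊤ →
        ∀ f : ℂ → ℂ, InApq ω 1 q f →
          ∃ l : ℂ, HasPairingC (momentCoeff μq) f g l ∧
            ‖l‖ ≤ C₂ * (XInfNormE BMOANormE ω g).toReal * (LpqNormE ω 1 q f).toReal) ∧
      (∀ L : (ℂ → ℂ) → ℂ, IsLinearOn (InApq ω 1 q) L →
        (∃ M : ℝ, ∀ f : ℂ → ℂ, InApq ω 1 q f → ‖L f‖ ≤ M * (LpqNormE ω 1 q f).toReal) →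
        ∃ g : ℂ → ℂ, DifferentiableOn ℂ g (Metric.ball 0 1) ∧
          XInfNormE BMOANormE ω g < ⊤ ∧
          (∀ f : ℂ → ℂ, InApq ω 1 q f → HasPairingC (momentCoeff μq) f g (L f)) ∧
          (∀ M : ℝ, (∀ f : ℂ → ℂ, InApq ω 1 q f → ‖L f‖ ≤ M * (LpqNormE ω 1 q f).toReal) →
            (XInfNormE BMOANormE ω g).toReal ≤ C₁ * M)) := by
  subst hμq
  obtain ⟨C₁, hC₁, h₁⟩ := exists_representation hω hpos hD hq0
  obtain ⟨C₂, hC₂, h₂⟩ := exists_pairing_bound hω hpos hD hq0 hq1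
  exact ⟨C₁, hC₁, C₂, hC₂, h₂, h₁⟩
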